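/- Let K be a number field and A a finite-dimensional central simple K-algebra. Suppose that for every finite place v of K the K_v-algebra K_v ⊗_K A is isomorphic to a matrix algebra over K_v, and that for every real embedding τ : K → ℝ the ℝ-algebra ℝ ⊗_{K,τ} A is isomorphic to a matrix algebra over ℝ. Then A is isomorphic to a matrix algebra over K. Equivalently, the natural map from the Brauer group Br(K) to the product of the Brauer groups Br(K_v) over all places v of K is injective. -/

import Mathlib

section FileQ
set_option autoImplicit false

namespace ABHN

/-- `f` has finite kernel and cokernel, with index quotient `r`. -/
def HasIx {G : Type*} [CommGroup G] (f : G →* G) (r : ℚ) : Prop :=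
  f.range.index ≠ 0 ∧ Nat.card f.ker ≠ 0 ∧ (f.range.index : ℚ) = r * Nat.card f.ker

theorem HasIx.unique {G : Type*} [CommGroup G] {f : G →* G} {r s : ℚ}
    (h : HasIx f r) (h' : HasIx f s) : r = s := by
  have h1 : (Nat.card f.ker : ℚ) ≠ 0 := by exact_mod_cast h.2.1
  exact mul_right_cancel₀ h1 (h.2.2.symm.trans h'.2.2)

theorem HasIx.ne_zero {G : Type*} [CommGroup G] {f : G →* G} {r : ℚ} (h : HasIx f r) : r ≠ 0 := by
  rintro rfl
  have := h.2.2
  rw [zero_mul] at this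
  exact h.1 (by exact_mod_cast this)

theorem HasIx.pos {G : Type*} [CommGroup G] {f : G →* G} {r : ℚ} (h : HasIx f r) : 0 < r := by
  have h1 : (0:ℚ) < Nat.card f.ker := by exact_mod_cast Nat.pos_of_ne_zero h.2.1
  have h2 : (0:ℚ) < f.range.index := by exact_mod_cast Nat.pos_of_ne_zero h.1
  rw [h.2.2] at h2
  exact pos_of_mul_pos_left h2 h1.le

theorem HasIx.comp {G : Type*} [CommGroup G] {f g : G →* G} {r s : ℚ}
    (hf : HasIx f r) (hg : HasIx g s) : HasIx (f.comp g) (r * s) := by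
  -- x = [G : g.range ⊔ ker f], z = [ker f ⊔ gr : gr], w = card (ker f ⊓ range g)
  have e1 : (f.comp g).range.index = (g.range ⊔ f.ker).index * f.range.index := by
    rw [MonoidHom.range_comp, Subgroup.index_map]
  have e2 : g.range.relIndex f.ker * (g.range ⊔ f.ker).index = g.range.index := by
    rw [← Subgroup.relIndex_sup_left f.ker g.range]
    exact Subgroup.relIndex_mul_index le_sup_left
  have e3 : Nat.card (f.ker ⊓ g.range : Subgroup G) * g.range.relIndex f.ker = Nat.card f.ker := by
    rw [← Subgroup.relIndex_bot_left, ← Subgroup.relIndex_bot_left,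
      ← Subgroup.inf_relIndex_right g.range f.ker, inf_comm g.range]
    exact Subgroup.relIndex_mul_relIndex _ _ _ bot_le inf_le_left
  have e4 : Nat.card (f.comp g).ker = Nat.card g.ker * Nat.card (f.ker ⊓ g.range : Subgroup G) := by
    have h1 : g.ker ≤ (f.comp g).ker := by
      intro x hx
      rw [MonoidHom.mem_ker] at hx ⊢
      simp [hx]
    have h2 : (f.comp g).ker.map g = f.ker ⊓ g.range := by
      rw [← MonoidHom.comap_ker, Subgroup.map_comap_eq, inf_comm]
    rw [← h2, ← Subgroup.relIndex_ker, ← Subgroup.relIndex_bot_left, ← Subgroup.relIndex_bot_left]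
    exact (Subgroup.relIndex_mul_relIndex _ _ _ bot_le h1).symm
  obtain ⟨f0, f1, f2⟩ := hf
  obtain ⟨g0, g1, g2⟩ := hg
  rw [← e2] at g0 g2
  rw [← e3] at f1 f2
  have a1 := left_ne_zero_of_mul g0
  have a2 := right_ne_zero_of_mul g0
  have a3 := left_ne_zero_of_mul f1
  refine ⟨?_, ?_, ?_⟩
  · rw [e1]; exact mul_ne_zero a2 f0
  · rw [e4]; exact mul_ne_zero g1 a3
  · rw [e1, e4]
    push_cast at f2 g2 ⊢
    have a1' : (g.range.relIndex f.ker : ℚ) ≠ 0 := by exact_mod_cast a1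
    apply mul_left_cancel₀ a1'
    rw [f2]
    linear_combination (r * Nat.card (f.ker ⊓ g.range : Subgroup G) * g.range.relIndex f.ker) * g2

theorem HasIx.id (G : Type*) [CommGroup G] : HasIx (MonoidHom.id G) 1 := by
  have h : (MonoidHom.id G).range = ⊤ := MonoidHom.range_eq_top.mpr (fun x => ⟨x, rfl⟩)
  refine ⟨?_, ?_, ?_⟩ <;> simp [h]

theorem HasIx.congr_ker_range {G : Type*} [CommGroup G] {f g : G →* G} {r : ℚ}
    (hf : HasIx f r) (h1 : f.range = g.range) (h2 : f.ker = g.ker) : HasIx g r := by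
  unfold HasIx at *
  rwa [← h1, ← h2]

theorem HasIx.exists {G : Type*} [CommGroup G] {f : G →* G} (h : f.range.index ≠ 0)
    (h' : Nat.card f.ker ≠ 0) : ∃ r, HasIx f r := by
  refine ⟨f.range.index / Nat.card f.ker, h, h', ?_⟩
  have : (Nat.card f.ker : ℚ) ≠ 0 := by exact_mod_cast h'
  field_simp

/-- `q`-invariant of the `p`-power map. -/
def HasQ (p : ℕ) (G : Type*) [CommGroup G] (r : ℚ) : Prop := HasIx (powMonoidHom p : G →* G) r

theorem HasIx.congr_equiv {G H : Type*} [CommGroup G] [CommGroup H] (e : G ≃* H)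
    {f : G →* G} {g : H →* H} (hfg : ∀ x, e (f x) = g (e x)) {r : ℚ}
    (h : HasIx f r) : HasIx g r := by
  have h1 : g.range = f.range.map e.toMonoidHom := by
    ext y
    constructor
    · rintro ⟨x, rfl⟩
      refine ⟨f (e.symm x), ⟨_, rfl⟩, ?_⟩
      simp [hfg]
    · rintro ⟨_, ⟨x, rfl⟩, rfl⟩
      exact ⟨e x, by simp [hfg]⟩
  have h2 : g.ker = f.ker.map e.toMonoidHom := by
    ext y
    constructor
    · intro hy
      refine ⟨e.symm y, ?_, by simp⟩
      apply e.injective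
      rw [hfg, e.apply_symm_apply, map_one]
      exact hy
    · rintro ⟨x, hx, rfl⟩
      show g (e x) = 1
      rw [← hfg, MonoidHom.mem_ker.1 hx, map_one]
  have h3 : Nat.card g.ker = Nat.card f.ker := by
    rw [h2]
    exact (Nat.card_congr (f.ker.equivMapOfInjective _ e.injective).toEquiv).symm
  have h4 : g.range.index = f.range.index := by
    rw [h1]
    exact Subgroup.index_map_equiv _ e
  unfold HasIx at *
  rwa [h3, h4]

theorem HasQ.congr {p : ℕ} {G H : Type*} [CommGroup G] [CommGroup H] (e : G ≃* H) {r : ℚ}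
    (h : HasQ p G r) : HasQ p H r :=
  HasIx.congr_equiv e (fun x => by simp) h

section ses
variable {p : ℕ} {B C : Type*} [CommGroup B] [CommGroup C] (π : B →* C)

theorem ses_aux (hπ : Function.Surjective π) :
    ∃ x y z : ℕ,
      (powMonoidHom p : B →* B).range.index = (powMonoidHom p : C →* C).range.index * x ∧
      (powMonoidHom p : π.ker →* π.ker).range.index = y * x ∧
      Nat.card (powMonoidHom p : C →* C).ker = z * y ∧
      Nat.card (powMonoidHom p : B →* B).ker
        = Nat.card (powMonoidHom p : π.ker →* π.ker).ker * z := by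
  set P : B →* B := powMonoidHom p
  set A : Subgroup B := π.ker
  have hPA : A ≤ A.comap P := by
    intro x hx
    have : π x = 1 := hx
    show π (x ^ p) = 1
    rw [map_pow, this, one_pow]
  have hcomap : A.comap P = ((powMonoidHom p : C →* C).ker).comap π := by
    ext x
    simp [P, A, MonoidHom.mem_ker]
  refine ⟨P.range.relIndex A, (A ⊔ P.ker).relIndex (A.comap P), A.relIndex P.ker, ?_, ?_, ?_, ?_⟩
  · have h1 : (powMonoidHom p : C →* C).range.comap π = P.range ⊔ A := by
      rw [← Subgroup.comap_map_eq]
      congr 1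
      ext y
      constructor
      · rintro ⟨c, rfl⟩
        obtain ⟨b, rfl⟩ := hπ c
        exact ⟨b ^ p, ⟨b, rfl⟩, by simp⟩
      · rintro ⟨_, ⟨b, rfl⟩, rfl⟩
        exact ⟨π b, by simp [P]⟩
    rw [← Subgroup.index_comap_of_surjective _ hπ, h1, ← Subgroup.relIndex_sup_left A P.range,
      mul_comm]
    exact (Subgroup.relIndex_mul_index le_sup_left).symm
  · have h1 : (powMonoidHom p : A →* A).range = (A.map P).subgroupOf A := by
      ext y
      constructor
      · rintro ⟨a, rfl⟩
        exact ⟨a, a.2, by simp [P]⟩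
      · rintro ⟨a, ha, hy⟩
        exact ⟨⟨a, ha⟩, Subtype.ext hy⟩
    have h2 : (A.map P) ≤ P.range ⊓ A := by
      rintro _ ⟨a, ha, rfl⟩
      exact ⟨⟨a, rfl⟩, hPA ha⟩
    rw [h1]
    change (A.map P).relIndex A = _
    rw [← Subgroup.relIndex_mul_relIndex _ _ _ h2 inf_le_right, Subgroup.inf_relIndex_right]
    congr 1
    rw [← Subgroup.map_comap_eq, Subgroup.relIndex_map_map]
    congr 1
    refine sup_eq_left.2 ?_
    intro x hx
    show P x ∈ A
    rw [MonoidHom.mem_ker.1 hx]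
    exact one_mem _
  · have h3 : A.relIndex (A.comap P) = Nat.card (powMonoidHom p : C →* C).ker := by
      rw [Subgroup.relIndex_ker, hcomap, Subgroup.map_comap_eq_self_of_surjective hπ]
    rw [← h3, ← Subgroup.relIndex_sup_left P.ker A]
    refine (Subgroup.relIndex_mul_relIndex _ _ _ le_sup_left ?_).symm
    refine sup_le hPA ?_
    intro x hx
    show P x ∈ A
    rw [MonoidHom.mem_ker.1 hx]
    exact one_mem _
  · have h1 : (powMonoidHom p : A →* A).ker = (A ⊓ P.ker).subgroupOf A := by
      ext y
      simp [MonoidHom.mem_ker, Subgroup.mem_subgroupOf, P, Subtype.ext_iff]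
    have h2 : Nat.card (powMonoidHom p : A →* A).ker = Nat.card (A ⊓ P.ker : Subgroup B) := by
      rw [h1]
      exact Nat.card_congr (Subgroup.subgroupOfEquivOfLe inf_le_left).toEquiv
    rw [h2, ← Subgroup.relIndex_bot_left, ← Subgroup.relIndex_bot_left,
      ← Subgroup.inf_relIndex_right A P.ker]
    exact (Subgroup.relIndex_mul_relIndex _ _ _ bot_le inf_le_right).symm

theorem HasQ.of_ker_quot (hπ : Function.Surjective π) {r s : ℚ} (hA : HasQ p π.ker r)
    (hC : HasQ p C s) : HasQ p B (r * s) := by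
  obtain ⟨x, y, z, h1, h2, h3, h4⟩ := ses_aux (p := p) π hπ
  obtain ⟨a0, a1, a2⟩ := hA
  obtain ⟨c0, c1, c2⟩ := hC
  rw [h2] at a0 a2
  rw [h3] at c1 c2
  have hy := left_ne_zero_of_mul a0
  refine ⟨?_, ?_, ?_⟩
  · rw [h1]; exact mul_ne_zero c0 (right_ne_zero_of_mul a0)
  · rw [h4]; exact mul_ne_zero a1 (left_ne_zero_of_mul c1)
  · rw [h1, h4]
    push_cast at *
    have hy' : (y : ℚ) ≠ 0 := by exact_mod_cast hy
    apply mul_left_cancel₀ hy'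
    rw [c2]
    linear_combination (s * z * y) * a2

theorem HasQ.quot (hπ : Function.Surjective π) {r s : ℚ} (hA : HasQ p π.ker r)
    (hB : HasQ p B s) : HasQ p C (s / r) := by
  have hr := HasIx.ne_zero hA
  obtain ⟨x, y, z, h1, h2, h3, h4⟩ := ses_aux (p := p) π hπ
  obtain ⟨a0, a1, a2⟩ := hA
  obtain ⟨c0, c1, c2⟩ := hB
  rw [h2] at a0 a2
  rw [h1] at c0 c2
  rw [h4] at c1 c2
  have hy := left_ne_zero_of_mul a0
  have hx := right_ne_zero_of_mul a0
  refine ⟨left_ne_zero_of_mul c0, ?_, ?_⟩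
  · rw [h3]; exact mul_ne_zero (right_ne_zero_of_mul c1) hy
  · rw [h3]
    push_cast at *
    have hx' : (x : ℚ) ≠ 0 := by exact_mod_cast hx
    apply mul_right_cancel₀ hx'
    rw [c2]
    field_simp
    linear_combination (- s * z ) * a2

end ses

theorem HasQ.of_finite (p : ℕ) (G : Type*) [CommGroup G] [Finite G] : HasQ p G 1 := by
  refine ⟨Subgroup.index_ne_zero_of_finite, Nat.card_pos.ne', ?_⟩
  rw [one_mul]
  norm_cast
  have h1 := (powMonoidHom p : G →* G).ker.card_mul_index
  rw [Subgroup.index_ker] at h1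
  have h2 := (powMonoidHom p : G →* G).range.card_mul_index
  have h3 : Nat.card (powMonoidHom p : G →* G).range ≠ 0 := Nat.card_pos.ne'
  rw [← h2, mul_comm] at h1
  exact (mul_left_cancel₀ h3 h1).symm

/-- finite index invariance -/
theorem HasQ.of_finiteIndex {p : ℕ} {G : Type*} [CommGroup G] (H : Subgroup G) (hH : H.index ≠ 0)
    {r : ℚ} (h : HasQ p H r) : HasQ p G r := by
  have : Finite (G ⧸ H) := Nat.finite_of_card_ne_zero hH
  have e : H ≃* (QuotientGroup.mk' H).ker := MulEquiv.subgroupCongr (QuotientGroup.ker_mk' H).symm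
  have := HasQ.of_ker_quot (p := p) (QuotientGroup.mk' H) (QuotientGroup.mk'_surjective H)
    (h.congr e) (HasQ.of_finite p _)
  simpa using this

theorem HasQ.finiteIndex {p : ℕ} {G : Type*} [CommGroup G] (H : Subgroup G) (hH : H.index ≠ 0)
    {r : ℚ} (h : HasQ p G r) : HasQ p H r := by
  -- need finiteness for `H`
  have : Finite (G ⧸ H) := Nat.finite_of_card_ne_zero hH
  have e : (QuotientGroup.mk' H).ker ≃* H := MulEquiv.subgroupCongr (QuotientGroup.ker_mk' H)
  obtain ⟨x, y, z, h1, h2, h3, h4⟩ := ses_aux (p := p) (QuotientGroup.mk' H) (QuotientGroup.mk'_surjective H)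
  have hC := HasQ.of_finite p (G ⧸ H)
  obtain ⟨s, hs⟩ := HasIx.exists (f := (powMonoidHom p : (QuotientGroup.mk' H).ker →* _))
    (by
      rw [h2]
      have := hC.2.1
      rw [h3] at this
      have h5 := h.1
      rw [h1] at h5
      exact mul_ne_zero (right_ne_zero_of_mul this) (right_ne_zero_of_mul h5))
    (by
      have h5 := h.2.1
      rw [h4] at h5
      exact left_ne_zero_of_mul h5)
  have h6 := HasQ.of_ker_quot (p := p) (QuotientGroup.mk' H) (QuotientGroup.mk'_surjective H) hs hC
  have h7 := HasIx.unique h h6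
  rw [mul_one] at h7
  subst h7
  exact HasQ.congr e hs

theorem HasQ.prod {p : ℕ} {G H : Type*} [CommGroup G] [CommGroup H] {r s : ℚ}
    (h : HasQ p G r) (h' : HasQ p H s) : HasQ p (G × H) (r * s) := by
  have e : G ≃* (MonoidHom.snd G H).ker :=
    { toFun := fun g => ⟨(g, 1), rfl⟩
      invFun := fun x => x.1.1
      left_inv := fun g => rfl
      right_inv := by
        rintro ⟨⟨a, b⟩, hb⟩
        have : b = 1 := hb
        subst this
        rfl
      map_mul' := fun a b => by ext <;> simp }
  exact HasQ.of_ker_quot (MonoidHom.snd G H) (fun y => ⟨(1, y), rfl⟩) (h.congr e) h'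

theorem HasQ.pi {p : ℕ} {G : Type*} [CommGroup G] {r : ℚ} (h : HasQ p G r) (n : ℕ) :
    HasQ p (Fin n → G) (r ^ n) := by
  induction n with
  | zero => simpa using HasQ.of_finite p (Fin 0 → G)
  | succ n ih =>
    have := HasQ.prod h ih
    rw [pow_succ, mul_comm]
    refine this.congr ?_
    exact { Fin.consEquiv (fun _ => G) with
      map_mul' := by
        intro a b
        ext i
        refine Fin.cases ?_ ?_ i <;> intros <;> simp [Fin.consEquiv] }

theorem HasQ.int {p : ℕ} (hp : p ≠ 0) : HasQ p (Multiplicative ℤ) p := by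
  have hker : (powMonoidHom p : Multiplicative ℤ →* Multiplicative ℤ).ker = ⊥ := by
    rw [MonoidHom.ker_eq_bot_iff]
    intro a b hab
    have : (p:ℤ) * a.toAdd = p * b.toAdd := by
      have := congrArg Multiplicative.toAdd hab
      simpa using this
    exact Multiplicative.toAdd.injective (mul_left_cancel₀ (by exact_mod_cast hp) this)
  have hidx : (powMonoidHom p : Multiplicative ℤ →* Multiplicative ℤ).range.index = p := by
    have : (powMonoidHom p : Multiplicative ℤ →* Multiplicative ℤ).range
        = (AddSubgroup.zmultiples (p:ℤ)).toSubgroup := by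
      ext x
      constructor
      · rintro ⟨y, rfl⟩
        exact ⟨y.toAdd, by simp [mul_comm]⟩
      · rintro ⟨k, hk⟩
        refine ⟨Multiplicative.ofAdd k, ?_⟩
        apply Multiplicative.toAdd.injective
        simpa [mul_comm] using hk
    rw [this, AddSubgroup.index_toSubgroup, Int.index_zmultiples]
    simp
  refine ⟨by rw [hidx]; exact hp, by rw [hker]; simp, by rw [hidx, hker]; simp⟩

end ABHN
end FileQ

section FileQ2
set_option autoImplicit false

namespace ABHN
open Polynomial

theorem cyclo_dvd (p : ℕ) (hp : p.Prime) :
    ∃ c : ℤ[X], ∏ i ∈ Finset.range (p-1), (1 - X ^ (i+1) : ℤ[X]) = (p : ℤ[X]) + (∑ i ∈ Finset.range p, X ^ i) * c := by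
  have := Fact.mk hp
  have hdvd : cyclotomic p ℤ ∣ ∏ i ∈ Finset.range (p-1), (1 - X ^ (i+1) : ℤ[X]) - (p : ℤ[X]) := by
    obtain ⟨ζ, hζ⟩ : ∃ ζ : ℂ, IsPrimitiveRoot ζ p := ⟨_, Complex.isPrimitiveRoot_exp p hp.ne_zero⟩
    rw [cyclotomic_eq_minpoly hζ hp.pos]
    apply minpoly.isIntegrallyClosed_dvd (hζ.isIntegral hp.pos)
    have h1 : p = (p - 1) + 1 := by have := hp.pos; omega
    rw [h1] at hζ
    have h := hζ.prod_one_sub_pow_eq_order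
    have h2 : ((p - 1 : ℕ) : ℂ) + 1 = p := by exact_mod_cast h1.symm
    simp [map_prod, h, h2]
  obtain ⟨c, hc⟩ := hdvd
  refine ⟨c, ?_⟩
  rw [cyclotomic_prime] at hc
  rw [← hc]; ring

variable {M : Type*} [CommGroup M]

/-- the hom `x ↦ x / σ x` -/
def Dhom (σ : M →* M) : M →* M := MonoidHom.id M / σ

/-- iterates -/
def itHom (σ : M →* M) : ℕ → (M →* M)
  | 0 => MonoidHom.id M
  | n+1 => σ.comp (itHom σ n)

theorem itHom_apply (σ : M →* M) (n : ℕ) (x : M) : itHom σ n x = σ^[n] x := by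
  induction n with
  | zero => rfl
  | succ n ih => rw [Function.iterate_succ_apply', ← ih]; rfl

def Nhom (p : ℕ) (σ : M →* M) : M →* M := ∏ i ∈ Finset.range p, itHom σ i

def fixG (σ : M →* M) : Subgroup M := (Dhom σ).ker

theorem Dhom_apply (σ : M →* M) (x : M) : Dhom σ x = x / σ x := rfl

theorem mem_fixG {σ : M →* M} {x : M} : x ∈ fixG σ ↔ σ x = x := by
  rw [fixG, MonoidHom.mem_ker, Dhom_apply, div_eq_one, eq_comm]

theorem Nhom_apply (p : ℕ) (σ : M →* M) (x : M) :
    Nhom p σ x = ∏ i ∈ Finset.range p, σ^[i] x := by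
  rw [Nhom, MonoidHom.finsetProd_apply]
  simp only [itHom_apply]

/-- additive version of an endomorphism -/
def addEnd (f : M →* M) : AddMonoid.End (Additive M) := MonoidHom.toAdditive f

theorem addEnd_inj {f g : M →* M} (h : addEnd f = addEnd g) : f = g :=
  MonoidHom.toAdditive.injective h

theorem addEnd_it (σ : M →* M) (i : ℕ) : addEnd (itHom σ i) = (addEnd σ) ^ i := by
  induction i with
  | zero => rfl
  | succ n ih => rw [pow_succ', ← ih]; rfl

theorem addEnd_D (σ : M →* M) : addEnd (Dhom σ) = 1 - addEnd σ := by
  ext x; rfl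

theorem addEnd_comp (f g : M →* M) : addEnd (f.comp g) = addEnd f * addEnd g := rfl

theorem addEnd_powHom (n : ℕ) : addEnd (powMonoidHom n : M →* M) = (n : AddMonoid.End (Additive M)) := by
  ext x
  simp [addEnd]
  rfl

theorem addEnd_N (p : ℕ) (σ : M →* M) : addEnd (Nhom p σ) = ∑ i ∈ Finset.range p, (addEnd σ) ^ i := by
  simp only [← addEnd_it]
  have : ∀ n, addEnd (Nhom n σ) = ∑ i ∈ Finset.range n, addEnd (itHom σ i) := by
    intro n
    induction n with
    | zero => rfl
    | succ n ih => rw [Finset.sum_range_succ, ← ih, Nhom, Finset.prod_range_succ]; rfl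
  exact this p

theorem ker_le_comp (f g : M →* M) : g.ker ≤ (f.comp g).ker := by
  intro x hx
  rw [MonoidHom.mem_ker] at hx ⊢
  rw [MonoidHom.comp_apply, hx, map_one]

theorem comp_range_le (f g : M →* M) : (f.comp g).range ≤ f.range := by
  rintro _ ⟨x, rfl⟩
  exact ⟨_, rfl⟩

theorem D_pow_facts (σ : M →* M) (p : ℕ) (hp : p.Prime) (hσ : itHom σ p = MonoidHom.id M) (i : ℕ) (hi : i + 1 < p) :
    (Dhom (itHom σ (i+1))).ker = (Dhom σ).ker ∧
    (Dhom (itHom σ (i+1))).range = (Dhom σ).range := by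
  have key : ∀ (τ : M →* M) (n : ℕ),
      (Dhom τ).ker ≤ (Dhom (itHom τ n)).ker ∧
      (Dhom (itHom τ n)).range ≤ (Dhom τ).range := by
    intro τ n
    have h1 : addEnd (Dhom (itHom τ n)) = addEnd (Dhom τ) * addEnd (Nhom n τ) := by
      rw [addEnd_D, addEnd_D, addEnd_N, addEnd_it]
      rw [mul_neg_geom_sum]
    have h2 : addEnd (Dhom (itHom τ n)) = addEnd (Nhom n τ) * addEnd (Dhom τ) := by
      rw [addEnd_D, addEnd_D, addEnd_N, addEnd_it]
      rw [geom_sum_mul_neg]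
    rw [← addEnd_comp] at h1 h2
    constructor
    · rw [addEnd_inj h2]; exact ker_le_comp _ _
    · rw [addEnd_inj h1]; exact comp_range_le _ _
  obtain ⟨k, hk⟩ : ∃ k : ℕ, (i+1) * k ≡ 1 [MOD p] := by
    have hc : Nat.Coprime (i+1) p := by
      apply Nat.Coprime.symm
      rw [hp.coprime_iff_not_dvd]
      intro h
      have := Nat.le_of_dvd (by omega) h
      omega
    exact (Nat.exists_mul_mod_eq_one_of_coprime hc hp.one_lt).imp fun k hk => by
      rw [Nat.ModEq, hk.2, Nat.mod_eq_of_lt hp.one_lt]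
  have hσ' : addEnd σ ^ p = 1 := by rw [← addEnd_it, hσ]; rfl
  have hs : itHom (itHom σ (i+1)) k = σ := by
    apply addEnd_inj
    rw [addEnd_it, addEnd_it, ← pow_mul]
    rw [← pow_mod_orderOf]
    have : (i+1)*k ≡ 1 [MOD orderOf (addEnd σ)] := hk.of_dvd (orderOf_dvd_of_pow_eq_one hσ')
    rw [this, pow_mod_orderOf, pow_one]
  have k1 := key σ (i+1)
  have k2 := key (itHom σ (i+1)) k
  rw [hs] at k2
  exact ⟨le_antisymm k2.1 k1.1, le_antisymm k1.2 k2.2⟩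

/-- on a group with `N = 1`, `t^(p-1) = q`. -/
theorem HasIx.D_of_N (σ : M →* M) (p : ℕ) (hp : p.Prime) (hσ : itHom σ p = MonoidHom.id M)
    (hN : Nhom p σ = 1) {u : ℚ} (hu : HasQ p M u) : ∃ t, HasIx (Dhom σ) t ∧ t ^ (p-1) = u := by
  obtain ⟨c, hc⟩ := cyclo_dvd p hp
  have h := congrArg (aeval (addEnd σ)) hc
  have hN' : ∑ i ∈ Finset.range p, (addEnd σ) ^ i = 0 := by
    rw [← addEnd_N, hN]; rfl
  rw [map_add, map_mul, map_sum] at h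
  simp only [map_pow, aeval_X, hN', zero_mul, add_zero, map_natCast, ← addEnd_powHom] at h
  -- existence
  have hex : ∃ t, HasIx (Dhom σ) t := by
    obtain ⟨q, hq⟩ : (1 - X : ℤ[X]) ∣ ∏ i ∈ Finset.range (p-1), (1 - X ^ (i+1) : ℤ[X]) := by
      apply dvd_trans _ (Finset.dvd_prod_of_mem _ (Finset.mem_range.mpr (show 0 < p - 1 by have := hp.two_le; omega)))
      simp
    set g : M →* M := MonoidHom.toAdditive.symm (aeval (addEnd σ) q) with hg
    have hg' : addEnd g = aeval (addEnd σ) q := rfl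
    have h1 : (Dhom σ).comp g = powMonoidHom p := by
      apply addEnd_inj
      rw [← h, hq, map_mul, addEnd_comp, addEnd_D, hg']; simp
    have h2 : g.comp (Dhom σ) = powMonoidHom p := by
      apply addEnd_inj
      rw [← h, hq, mul_comm, map_mul, addEnd_comp, addEnd_D, hg']; simp
    have r1 := comp_range_le (Dhom σ) g
    have r2 := ker_le_comp g (Dhom σ)
    rw [h1] at r1
    rw [h2] at r2
    apply HasIx.exists
    · exact fun h0 => hu.1 (Nat.eq_zero_of_zero_dvd (h0 ▸ Subgroup.index_dvd_of_le r1))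
    · have := Nat.finite_of_card_ne_zero hu.2.1
      have : Finite (Dhom σ).ker := Finite.of_injective _ (Subgroup.inclusion_injective r2)
      exact Nat.card_pos.ne'
  obtain ⟨t, ht⟩ := hex
  have h3 : ∀ n, n < p → ∃ g : M →* M,
      addEnd g = aeval (addEnd σ) (∏ i ∈ Finset.range n, (1 - X ^ (i+1) : ℤ[X])) ∧
      HasIx g (t ^ n) := by
    intro n
    induction n with
    | zero =>
      intro _
      refine ⟨MonoidHom.id M, ?_, ?_⟩
      · simp; rfl
      · simpa using HasIx.id M
    | succ n ih =>
      intro hn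
      obtain ⟨g, hg, hgt⟩ := ih (by omega)
      refine ⟨g.comp (Dhom (itHom σ (n+1))), ?_, ?_⟩
      · rw [Finset.prod_range_succ, map_mul, ← hg, addEnd_comp, addEnd_D, addEnd_it]
        simp
      · rw [pow_succ]
        have := D_pow_facts σ p hp hσ n hn
        exact hgt.comp (ht.congr_ker_range this.2.symm this.1.symm)
  obtain ⟨g, hg, hgt⟩ := h3 (p-1) (by have := hp.pos; omega)
  rw [h] at hg
  rw [addEnd_inj hg] at hgt
  exact ⟨t, ht, hgt.unique hu⟩

theorem Nhom_D (p : ℕ) (σ : M →* M) (hσ : itHom σ p = MonoidHom.id M) (x : M) : Nhom p σ (Dhom σ x) = 1 := by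
  have : (Nhom p σ).comp (Dhom σ) = 1 := by
    apply addEnd_inj
    rw [addEnd_comp, addEnd_N, addEnd_D, geom_sum_mul_neg, ← addEnd_it, hσ]
    exact sub_self _
  exact DFunLike.congr_fun this x

theorem gamma (σ : M →* M) (p : ℕ) (hp : p.Prime) (hσ : ∀ x, σ^[p] x = x)
    (hH : ∀ x, ∏ i ∈ Finset.range p, σ^[i] x = 1 → ∃ y, x = y / σ y) {r s : ℚ}
    (hr : HasQ p (fixG σ) r) (hs : HasQ p M s) :
    (((Nhom p σ).range.relIndex (fixG σ) : ℕ) : ℚ) ^ (p-1) = r ^ p / s := by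
  replace hσ : itHom σ p = MonoidHom.id M := by ext x; rw [itHom_apply, hσ]; rfl
  have hker : (Nhom p σ).ker = (Dhom σ).range := by
    ext x
    rw [MonoidHom.mem_ker, Nhom_apply]
    constructor
    · intro h
      obtain ⟨y, rfl⟩ := hH x h
      exact ⟨y, rfl⟩
    · rintro ⟨y, rfl⟩
      rw [← Nhom_apply, Nhom_D p σ hσ]
  set A := (Dhom σ).range with hA
  have hAq : HasQ p A (s / r) := by
    refine HasQ.quot (π := (Dhom σ).rangeRestrict) (Dhom σ).rangeRestrict_surjective ?_ hs
    rw [MonoidHom.ker_rangeRestrict]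
    exact hr
  have hσA : ∀ x ∈ A, σ x ∈ A := by
    rintro _ ⟨x, rfl⟩
    exact ⟨σ x, by simp [Dhom_apply]⟩
  set σA : A →* A := (σ.comp A.subtype).codRestrict A (fun x => hσA x x.2) with hσAdef
  have hit : ∀ n (x : A), ((σA^[n] x : A) : M) = σ^[n] (x : M) := by
    intro n x
    induction n with
    | zero => rfl
    | succ n ih => rw [Function.iterate_succ_apply', Function.iterate_succ_apply', ← ih]; rfl
  have h1 : itHom σA p = MonoidHom.id A := by
    ext x
    rw [itHom_apply, hit, ← itHom_apply, hσ]; rfl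
  have h2 : Nhom p σA = 1 := by
    ext x
    rw [Nhom_apply]
    push_cast
    simp only [hit]
    rw [← Nhom_apply]
    have : (x : M) ∈ (Nhom p σ).ker := by rw [hker]; exact x.2
    exact this
  obtain ⟨t, ht, htp⟩ := HasIx.D_of_N σA p hp h1 h2 hAq
  have hDA : ∀ x : A, ((Dhom σA x : A) : M) = Dhom σ x := fun x => rfl
  -- r = relIndex * t
  have key : r = (Nhom p σ).range.relIndex (fixG σ) * t := by
    have e1 : (powMonoidHom p : fixG σ →* fixG σ).range.index =
        ((fixG σ).map (Nhom p σ)).relIndex (fixG σ) := by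
      rw [Subgroup.relIndex]
      congr 1
      ext x
      rw [Subgroup.mem_subgroupOf, MonoidHom.mem_range, Subgroup.mem_map]
      have : ∀ y : fixG σ, Nhom p σ y = (y : M) ^ p := by
        intro y
        rw [Nhom_apply]
        have hy : σ y = y := mem_fixG.mp y.2
        rw [Finset.prod_congr rfl (fun i _ => Function.iterate_fixed hy i)]
        simp
      constructor
      · rintro ⟨y, rfl⟩
        exact ⟨y, y.2, this y⟩
      · rintro ⟨y, hy, hyx⟩
        exact ⟨⟨y, hy⟩, by ext; rw [← hyx, this ⟨y, hy⟩]; rfl⟩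
    have e2 : ((fixG σ).map (Nhom p σ)).relIndex (Nhom p σ).range * (Nhom p σ).range.relIndex (fixG σ) =
        ((fixG σ).map (Nhom p σ)).relIndex (fixG σ) := by
      apply Subgroup.relIndex_mul_relIndex
      · exact Subgroup.map_le_range _ _
      · rintro _ ⟨x, rfl⟩
        rw [fixG]
        have : (Dhom σ).comp (Nhom p σ) = 1 := by
          apply addEnd_inj
          rw [addEnd_comp, addEnd_N, addEnd_D, mul_neg_geom_sum, ← addEnd_it, hσ]
          exact sub_self _
        exact DFunLike.congr_fun this x
    have e3 : ((fixG σ).map (Nhom p σ)).relIndex (Nhom p σ).range = (Dhom σA).range.index := by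
      have q1 : (Dhom σA).range.index = (A.map (Dhom σ)).relIndex A := by
        rw [Subgroup.relIndex]
        congr 1
        ext x
        rw [Subgroup.mem_subgroupOf, MonoidHom.mem_range, Subgroup.mem_map]
        constructor
        · rintro ⟨y, rfl⟩
          exact ⟨y, y.2, rfl⟩
        · rintro ⟨y, hy, hyx⟩
          exact ⟨⟨y, hy⟩, Subtype.ext hyx⟩
      rw [q1]
      conv_rhs => rw [hA, MonoidHom.range_eq_map (Dhom σ), Subgroup.relIndex_map_map]
      conv_lhs => rw [MonoidHom.range_eq_map, Subgroup.relIndex_map_map]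
      rw [hker, hA, ← MonoidHom.range_eq_map, fixG, sup_comm]
      simp
    have e4 : Nat.card (powMonoidHom p : fixG σ →* fixG σ).ker = Nat.card (Dhom σA).ker := by
      rw [Nat.card_congr (Subgroup.equivMapOfInjective (powMonoidHom p : fixG σ →* fixG σ).ker
          (fixG σ).subtype (fixG σ).subtype_injective).toEquiv,
        Nat.card_congr (Subgroup.equivMapOfInjective (Dhom σA).ker A.subtype A.subtype_injective).toEquiv]
      congr 2
      ext x
      rw [Subgroup.mem_map, Subgroup.mem_map]
      constructor
      · rintro ⟨y, hy, rfl⟩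
        have hy1 : σ y = y := mem_fixG.mp y.2
        have hy2 : (y : M) ^ p = 1 := congrArg Subtype.val (MonoidHom.mem_ker.mp hy)
        have hyA : (y : M) ∈ A := by
          rw [← hker, MonoidHom.mem_ker, Nhom_apply,
            Finset.prod_congr rfl (fun i _ => Function.iterate_fixed hy1 i)]
          simpa using hy2
        exact ⟨⟨y, hyA⟩, Subtype.ext y.2, rfl⟩
      · rintro ⟨y, hy, rfl⟩
        have hy1 : (y : M) ∈ fixG σ := congrArg Subtype.val (MonoidHom.mem_ker.mp hy)
        refine ⟨⟨y, hy1⟩, ?_, rfl⟩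
        have hyA : (y : M) ∈ (Nhom p σ).ker := hker.ge y.2
        rw [MonoidHom.mem_ker, Nhom_apply,
            Finset.prod_congr rfl (fun i _ => Function.iterate_fixed (mem_fixG.mp hy1) i)] at hyA
        apply Subtype.ext
        simpa using hyA
    have hr3 := hr.2.2
    have ht3 := ht.2.2
    rw [e4, e1, ← e2, e3] at hr3
    push_cast at hr3
    rw [ht3] at hr3
    have : (Nat.card (Dhom σA).ker : ℚ) ≠ 0 := by exact_mod_cast ht.2.1
    apply mul_right_cancel₀ this
    rw [← hr3]; ring
  have ht0 := ht.ne_zero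
  have hr0 := hr.ne_zero
  have hs0 := hs.ne_zero
  have : ((Nhom p σ).range.relIndex (fixG σ) : ℚ) = r / t := by rw [key]; field_simp
  rw [this, div_pow, htp]
  obtain ⟨n, rfl⟩ : ∃ n, p = n + 1 := ⟨p - 1, by have := hp.pos; omega⟩
  simp only [Nat.add_sub_cancel, pow_succ]
  field_simp

end ABHN
end FileQ2

section FileKum
set_option autoImplicit false

namespace ABHN
open Polynomial IntermediateField

/-- `L = F(θ)` is a Kummer extension of degree `p`, `θ^p = b`. -/
structure Kum (p : ℕ) (F : Type*) {L : Type*} [Field F] [Field L] [Algebra F L] (ζ b : F) (θ : L) : Prop where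
  prime : p.Prime
  prim : IsPrimitiveRoot ζ p
  pow : θ ^ p = algebraMap F L b
  adj : F⟮θ⟯ = ⊤
  rank : Module.finrank F L = p

section
variable {p : ℕ} {F L : Type*} [Field F] [Field L] [Algebra F L] {ζ b : F} {θ : L}

theorem Kum.finDim (h : Kum p F ζ b θ) : FiniteDimensional F L :=
  Module.finite_of_finrank_pos (h.rank ▸ h.prime.pos)

theorem Kum.nonempty (h : Kum p F ζ b θ) : (primitiveRoots (Module.finrank F L) F).Nonempty :=
  ⟨ζ, by rw [mem_primitiveRoots (h.rank ▸ h.prime.pos), h.rank]; exact h.prim⟩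

theorem Kum.irr (h : Kum p F ζ b θ) : Irreducible (X ^ p - C b) := by
  have := h.finDim
  have h1 : NeZero (Module.finrank F L) := ⟨h.rank ▸ h.prime.ne_zero⟩
  have := irreducible_X_pow_sub_C_of_root_adjoin_eq_top (K := F) (L := L) (a := b) (α := θ) (by rw [h.rank, h.pow]) h.adj
  rwa [h.rank] at this

theorem Kum.galois (h : Kum p F ζ b θ) : IsGalois F L := by
  have := h.finDim
  have h1 : NeZero (Module.finrank F L) := ⟨h.rank ▸ h.prime.ne_zero⟩
  have h2 := h.irr
  rw [← h.rank] at h2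
  have := isSplittingField_X_pow_sub_C_of_root_adjoin_eq_top (K := F) (L := L) (a := b) (α := θ) h.nonempty
    (by rw [h.rank, h.pow]) h.adj
  exact isGalois_of_isSplittingField_X_pow_sub_C h.nonempty h2 L

theorem Kum.ne_zero (h : Kum p F ζ b θ) : b ≠ 0 := by
  rintro rfl
  have h1 := h.irr
  simp only [map_zero, sub_zero] at h1
  exact not_irreducible_pow h.prime.one_lt.ne' h1

theorem Kum.θ_ne_zero (h : Kum p F ζ b θ) : θ ≠ 0 := by
  rintro rfl
  have := h.pow
  rw [zero_pow h.prime.ne_zero] at this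
  exact h.ne_zero ((map_eq_zero _).mp this.symm)

theorem Kum.minpoly (h : Kum p F ζ b θ) : minpoly F θ = X ^ p - C b := by
  symm
  apply minpoly.eq_of_irreducible_of_monic h.irr
  · simp [h.pow]
  · exact monic_X_pow_sub_C _ h.prime.ne_zero

theorem Kum.exists_aeval (h : Kum p F ζ b θ) (y : L) : ∃ f : F[X], y = aeval θ f := by
  have := h.finDim
  have hy : y ∈ F⟮θ⟯ := h.adj ▸ mem_top
  rw [← mem_toSubalgebra, adjoin_simple_toSubalgebra_of_isAlgebraic (Algebra.IsAlgebraic.isAlgebraic θ)] at hy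
  rw [Algebra.adjoin_singleton_eq_range_aeval] at hy
  obtain ⟨f, hf⟩ := hy
  exact ⟨f, hf.symm⟩

theorem Kum.exists_σ (h : Kum p F ζ b θ) : ∃ σ : L ≃ₐ[F] L, σ θ = algebraMap F L ζ * θ := by
  have := h.finDim
  have hintg : IsIntegral F θ := Algebra.IsIntegral.isIntegral θ
  have hroot : algebraMap F L ζ * θ ∈ (_root_.minpoly F θ).aroots L := by
    rw [h.minpoly, mem_aroots]
    refine ⟨(monic_X_pow_sub_C _ h.prime.ne_zero).ne_zero, ?_⟩
    simp only [map_sub, map_pow, aeval_X, aeval_C, mul_pow, h.pow]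
    rw [← map_pow, h.prim.pow_eq_one, map_one, one_mul, sub_self]
  let ψ : F⟮θ⟯ →ₐ[F] L := (IntermediateField.algHomAdjoinIntegralEquiv F hintg).symm ⟨_, hroot⟩
  have hψ : ψ (AdjoinSimple.gen F θ) = algebraMap F L ζ * θ :=
    algHomAdjoinIntegralEquiv_symm_apply_gen F hintg ⟨_, hroot⟩
  let e : L →ₐ[F] F⟮θ⟯ := ((IntermediateField.equivOfEq h.adj).trans IntermediateField.topEquiv).symm.toAlgHom
  have he : e θ = AdjoinSimple.gen F θ := by
    apply ((IntermediateField.equivOfEq h.adj).trans IntermediateField.topEquiv).injective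
    simp only [e]
    erw [AlgEquiv.apply_symm_apply]
  refine ⟨AlgEquiv.ofBijective (ψ.comp e) ?_, ?_⟩
  · exact AlgHom.bijective _
  · rw [AlgEquiv.ofBijective_apply, AlgHom.comp_apply, he, hψ]

noncomputable def Kum.σ (h : Kum p F ζ b θ) : L ≃ₐ[F] L := h.exists_σ.choose

theorem Kum.σ_θ (h : Kum p F ζ b θ) : h.σ θ = algebraMap F L ζ * θ := h.exists_σ.choose_spec

theorem Kum.σ_it_θ (h : Kum p F ζ b θ) (i : ℕ) : h.σ^[i] θ = algebraMap F L (ζ ^ i) * θ := by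
  induction i with
  | zero => simp
  | succ n ih =>
    rw [Function.iterate_succ_apply', ih, map_mul, AlgEquiv.commutes, h.σ_θ, pow_succ, map_mul, mul_assoc]

theorem Kum.σ_it_aeval (h : Kum p F ζ b θ) (i : ℕ) (f : F[X]) :
    h.σ^[i] (aeval θ f) = aeval (algebraMap F L (ζ ^ i) * θ) f := by
  rw [← h.σ_it_θ]
  rw [← AlgEquiv.coe_pow]
  exact (aeval_algHom_apply (h.σ ^ i : L ≃ₐ[F] L) θ f).symm

theorem Kum.σ_pow (h : Kum p F ζ b θ) (x : L) : h.σ^[p] x = x := by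
  obtain ⟨f, rfl⟩ := h.exists_aeval x
  rw [h.σ_it_aeval, h.prim.pow_eq_one, map_one, one_mul]

theorem Kum.orderOf (h : Kum p F ζ b θ) : orderOf h.σ = p := by
  have := Fact.mk h.prime
  apply orderOf_eq_prime
  · ext x
    rw [AlgEquiv.coe_pow, h.σ_pow]; rfl
  · intro h1
    have h2 := h.σ_θ
    rw [h1] at h2
    have : algebraMap F L ζ = 1 := by
      apply mul_right_cancel₀ h.θ_ne_zero
      rw [← h2, one_mul]; rfl
    rw [← map_one (algebraMap F L)] at this
    exact h.prim.ne_one h.prime.one_lt ((algebraMap F L).injective this)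

theorem Kum.card (h : Kum p F ζ b θ) : Nat.card (L ≃ₐ[F] L) = p := by
  have := h.finDim
  have := h.galois
  rw [IsGalois.card_aut_eq_finrank, h.rank]

theorem Kum.gen (h : Kum p F ζ b θ) (x : L ≃ₐ[F] L) : x ∈ Subgroup.zpowers h.σ := by
  have := h.finDim
  have : Subgroup.zpowers h.σ = ⊤ := by
    apply Subgroup.eq_top_of_card_eq
    rw [Nat.card_zpowers, h.orderOf, h.card]
  rw [this]; trivial

theorem Kum.gen' (h : Kum p F ζ b θ) (x : L ≃ₐ[F] L) : ∃ i < p, x = h.σ ^ i := by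
  classical
  have := h.finDim
  have h1 := h.gen x
  rw [← mem_powers_iff_mem_zpowers, mem_powers_iff_mem_range_orderOf, h.orderOf] at h1
  simp only [Finset.mem_image, Finset.mem_range] at h1
  obtain ⟨i, hi, rfl⟩ := h1
  exact ⟨i, hi, rfl⟩

theorem Kum.norm_eq (h : Kum p F ζ b θ) (x : L) :
    algebraMap F L (Algebra.norm F x) = ∏ i ∈ Finset.range p, h.σ^[i] x := by
  have := h.finDim
  have := h.galois
  rw [Algebra.norm_eq_prod_automorphisms]
  symm
  apply Finset.prod_bij (fun i _ => h.σ ^ i)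
  · intros; simp
  · intro i hi j hj hij
    have := h.orderOf
    exact pow_injOn_Iio_orderOf (by simpa [this] using hi) (by simpa [this] using hj) hij
  · intro x _
    obtain ⟨i, hi, rfl⟩ := h.gen' x
    exact ⟨i, by simpa using hi, rfl⟩
  · intro i _
    rw [AlgEquiv.coe_pow]

theorem Kum.indep (h : Kum p F ζ b θ) (g : ℕ → L)
    (hg : ∀ c : L, ∑ i ∈ Finset.range p, g i * h.σ^[i] c = 0) : ∀ i < p, g i = 0 := by
  have h1 := linearIndependent_monoidHom L L
  have h2 : Function.Injective (fun i : Fin p => ((h.σ ^ (i : ℕ) : L ≃ₐ[F] L) : L →* L)) := by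
    intro i j hij
    have : h.σ ^ (i : ℕ) = h.σ ^ (j : ℕ) := by
      ext x; exact DFunLike.congr_fun hij x
    apply Fin.ext
    exact pow_injOn_Iio_orderOf (by simpa [h.orderOf] using i.2) (by simpa [h.orderOf] using j.2) this
  have h3 := h1.comp _ h2
  rw [Fintype.linearIndependent_iff] at h3
  intro i hi
  refine h3 (fun i => g i) ?_ ⟨i, hi⟩
  ext c
  rw [Finset.sum_apply]
  have := hg c
  rw [Finset.sum_range] at this
  simpa [AlgEquiv.coe_pow] using this

theorem Kum.h90 (h : Kum p F ζ b θ) (x : L) (hx : Algebra.norm F x = 1) : ∃ y : Lˣ, x = y / h.σ y := by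
  let g : ℕ → L := fun i => ∏ j ∈ Finset.range i, h.σ^[j] x
  have hN := h.norm_eq x
  rw [hx, map_one] at hN
  have hx0 : x ≠ 0 := by
    rintro rfl
    have := h.finDim
    rw [Algebra.norm_zero] at hx
    exact zero_ne_one hx
  have hgs : ∀ i, x * h.σ (g i) = g (i + 1) := by
    intro i
    simp only [g]
    rw [Finset.prod_range_succ', map_prod, mul_comm]
    simp only [Function.iterate_succ_apply', Function.iterate_zero, id]
  obtain ⟨c, hc⟩ : ∃ c : L, ∑ i ∈ Finset.range p, g i * h.σ^[i] c ≠ 0 := by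
    by_contra! hcon
    have := h.indep g hcon 0 h.prime.pos
    simp [g] at this
  refine ⟨Units.mk0 _ hc, ?_⟩
  rw [Units.val_mk0]
  have hσc : h.σ (∑ i ∈ Finset.range p, g i * h.σ^[i] c) ≠ 0 := by
    rwa [Ne, map_eq_zero_iff _ h.σ.injective]
  rw [eq_div_iff hσc, map_sum, Finset.mul_sum]
  have : ∀ i ∈ Finset.range p, x * h.σ (g i * h.σ^[i] c) = g (i+1) * h.σ^[i+1] c := by
    intro i _
    rw [map_mul, ← mul_assoc, hgs, Function.iterate_succ_apply']
  rw [Finset.sum_congr rfl this]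
  have e1 := Finset.sum_range_succ (fun i => g i * h.σ^[i] c) p
  rw [Finset.sum_range_succ'] at e1
  have e2 : g p * h.σ^[p] c = g 0 * h.σ^[0] c := by
    rw [h.σ_pow]
    simp only [g, ← hN]
    simp
  rw [e2] at e1
  exact add_right_cancel e1

theorem Kum.fixed (h : Kum p F ζ b θ) (x : L) (hx : h.σ x = x) : ∃ y, algebraMap F L y = x := by
  have := h.finDim
  have := h.galois
  have h1 : x ∈ (⊥ : IntermediateField F L) := by
    rw [IsGalois.mem_bot_iff_fixed]
    intro f
    obtain ⟨i, hi, rfl⟩ := h.gen' f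
    rw [AlgEquiv.coe_pow]
    exact Function.iterate_fixed hx i
  exact IntermediateField.mem_bot.mp h1

end

/-- existence -/
theorem exists_Kum {p : ℕ} (hp : p.Prime) {F : Type*} [Field F] {ζ b : F} (hζ : IsPrimitiveRoot ζ p)
    (hb : ∀ c, c ^ p ≠ b) [Fact (Irreducible (X ^ p - C b))] :
    Kum p F ζ b (AdjoinRoot.root (X ^ p - C b)) := by
  have hirr := X_pow_sub_C_irreducible_of_prime hp hb
  have hne : (X ^ p - C b : F[X]) ≠ 0 := hirr.ne_zero
  refine ⟨hp, hζ, ?_, ?_, ?_⟩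
  · have := AdjoinRoot.eval₂_root (X ^ p - C b)
    simpa [sub_eq_zero] using this
  · exact IntermediateField.adjoin_eq_top_of_algebra F _ (AdjoinRoot.adjoinRoot_eq_top)
  · rw [(AdjoinRoot.powerBasis hne).finrank, AdjoinRoot.powerBasis_dim]
    exact natDegree_X_pow_sub_C

/-- `a` is a norm from `F[X]/(X^p - b)`. -/
def NormRes (p : ℕ) {F : Type*} [Field F] (ζ b a : F) : Prop :=
  ∃ f : F[X], (X ^ p - C b) ∣ ∏ i ∈ Finset.range p, f.comp (C (ζ ^ i) * X) - C a

section
variable {p : ℕ} {F : Type*} [Field F] {ζ b : F}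

theorem NormRes.map {F' : Type*} [Field F'] (g : F →+* F') {a : F} (h : NormRes p ζ b a) :
    NormRes p (g ζ) (g b) (g a) := by
  obtain ⟨f, hf⟩ := h
  refine ⟨f.map g, ?_⟩
  have := Polynomial.map_dvd g hf
  simpa [Polynomial.map_prod, Polynomial.map_comp] using this

theorem NormRes.mul {a a' : F} (h : NormRes p ζ b a) (h' : NormRes p ζ b a') : NormRes p ζ b (a * a') := by
  obtain ⟨f, hf⟩ := h
  obtain ⟨f', hf'⟩ := h'
  refine ⟨f * f', ?_⟩
  simp only [mul_comp, Finset.prod_mul_distrib, C_mul]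
  have e : ∀ u v u' v' : F[X], u * u' - v * v' = (u - v) * u' + v * (u' - v') := by intros; ring
  rw [e]
  exact dvd_add (Dvd.dvd.mul_right hf _) (Dvd.dvd.mul_left hf' _)

theorem NormRes.pow_self (a : F) : NormRes p ζ b (a ^ p) := by
  refine ⟨C a, ?_⟩
  simp

theorem NormRes.npow {a : F} (h : NormRes p ζ b a) (n : ℕ) : NormRes p ζ b (a ^ n) := by
  induction n with
  | zero => simpa using NormRes.pow_self (p := p) (ζ := ζ) (b := b) (1 : F)
  | succ n ih => rw [pow_succ]; exact ih.mul h

theorem NormRes.inv {a : F} (h : NormRes p ζ b a) (hp : p ≠ 0) : NormRes p ζ b a⁻¹ := by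
  by_cases ha : a = 0
  · subst ha; simpa using h
  have : a⁻¹ = (a⁻¹) ^ p * a ^ (p - 1) := by
    obtain ⟨n, rfl⟩ := Nat.exists_eq_succ_of_ne_zero hp
    simp only [Nat.succ_eq_add_one, Nat.add_sub_cancel]
    rw [inv_pow, pow_succ, mul_inv, mul_assoc, mul_comm a⁻¹, ← mul_assoc, inv_mul_cancel₀ (pow_ne_zero _ ha), one_mul]
  rw [this]
  exact (NormRes.pow_self _).mul (h.npow _)

/-- subgroup of norm residues -/
def normSub (p : ℕ) (hp : p ≠ 0) {F : Type*} [Field F] (ζ b : F) : Subgroup Fˣ where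
  carrier := {a | NormRes p ζ b (a : F)}
  mul_mem' h h' := by simpa using NormRes.mul h h'
  one_mem' := by simpa using NormRes.pow_self (p := p) (ζ := ζ) (b := b) (1 : F)
  inv_mem' h := by simpa using NormRes.inv h hp

theorem NormRes.of_pow (hp : p.Prime) (hζ : IsPrimitiveRoot ζ p) {β : F} (hβ : β ≠ 0) (a : F) :
    NormRes p ζ (β ^ p) a := by
  classical
  have hinj : Set.InjOn (fun i => ζ ^ i * β) (Finset.range p : Set ℕ) := by
    intro i hi j hj hij
    exact hζ.pow_inj (by simpa using hi) (by simpa using hj) (mul_right_cancel₀ hβ hij)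
  let f : F[X] := Lagrange.interpolate (Finset.range p) (fun i => ζ ^ i * β) (fun i => if i = 0 then a else 1)
  have hf : ∀ i < p, f.eval (ζ ^ i * β) = if i = 0 then a else 1 := fun i hi =>
    Lagrange.eval_interpolate_at_node _ hinj (by simpa using hi)
  refine ⟨f, ?_⟩
  rw [X_pow_sub_C_eq_prod hζ hp.pos rfl]
  apply Finset.prod_dvd_of_coprime
  · intro i hi j hj hij
    exact isCoprime_X_sub_C_of_isUnit_sub (sub_ne_zero.mpr fun h => hij (hinj hi hj h)).isUnit
  · intro j hj
    rw [Finset.mem_range] at hj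
    rw [dvd_iff_isRoot, IsRoot, eval_sub, eval_C, eval_prod]
    simp only [eval_comp, eval_mul, eval_C, eval_X]
    rw [sub_eq_zero]
    have : ∀ i ∈ Finset.range p, f.eval (ζ ^ i * (ζ ^ j * β)) = if (i + j) % p = 0 then a else 1 := by
      intro i hi
      rw [← mul_assoc, ← pow_add, ← hf _ (Nat.mod_lt _ hp.pos)]
      congr 2
      conv_lhs => rw [← Nat.mod_add_div (i+j) p, pow_add, pow_mul, hζ.pow_eq_one, one_pow, mul_one]
    rw [Finset.prod_congr rfl this]
    rw [Finset.prod_eq_single ((p - j) % p)]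
    · rw [if_pos]
      rw [Nat.mod_add_mod, Nat.sub_add_cancel hj.le, Nat.mod_self]
    · intro i hi hne
      rw [if_neg]
      intro h0
      apply hne
      rw [Finset.mem_range] at hi
      rcases Nat.eq_zero_or_pos j with rfl | hj0
      · simp at h0 ⊢
        rwa [Nat.mod_eq_of_lt hi] at h0
      · rw [Nat.mod_eq_of_lt (by omega)]
        obtain ⟨k, hk⟩ := Nat.dvd_of_mod_eq_zero h0
        have : k = 1 := by
          have h1 : k < 2 := by
            by_contra h2
            have : p * 2 ≤ p * k := Nat.mul_le_mul_left _ (by omega)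
            omega
          have h2 : k ≠ 0 := by rintro rfl; omega
          omega
        subst this; omega
    · intro h; exact absurd (Finset.mem_range.mpr (Nat.mod_lt _ hp.pos)) h

theorem Kum.normRes_iff {L : Type*} [Field L] [Algebra F L] {θ : L} (h : Kum p F ζ b θ) {a : F} :
    NormRes p ζ b a ↔ ∃ y : L, Algebra.norm F y = a := by
  have key : ∀ f : F[X], (X ^ p - C b) ∣ ∏ i ∈ Finset.range p, f.comp (C (ζ ^ i) * X) - C a ↔
      Algebra.norm F (aeval θ f) = a := by
    intro f
    rw [← h.minpoly, minpoly.dvd_iff, map_sub, map_prod, aeval_C]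
    have : ∀ i ∈ Finset.range p, aeval θ (f.comp (C (ζ ^ i) * X)) = h.σ^[i] (aeval θ f) := by
      intro i _
      rw [h.σ_it_aeval, aeval_comp]; simp
    rw [Finset.prod_congr rfl this, ← h.norm_eq, sub_eq_zero]
    exact (algebraMap F L).injective.eq_iff
  constructor
  · rintro ⟨f, hf⟩
    exact ⟨_, (key f).mp hf⟩
  · rintro ⟨y, hy⟩
    obtain ⟨f, rfl⟩ := h.exists_aeval y
    exact ⟨f, (key f).mpr hy⟩

end
end ABHN
end FileKum

section FileLoc
set_option autoImplicit false

namespace ABHN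

theorem HasQ.commens {p : ℕ} {G : Type*} [CommGroup G] (A B : Subgroup G)
    (h1 : A.relIndex B ≠ 0) (h2 : B.relIndex A ≠ 0) {m : ℚ} (h : HasQ p A m) : HasQ p B m := by
  have hA : HasQ p (B.subgroupOf A) m := HasQ.finiteIndex _ h2 h
  apply HasQ.of_finiteIndex (A.subgroupOf B) h1
  refine HasQ.congr ?_ hA
  have e1 : B.subgroupOf A = (A ⊓ B).subgroupOf A := by rw [Subgroup.inf_subgroupOf_left]
  have e2 : A.subgroupOf B = (A ⊓ B).subgroupOf B := by rw [Subgroup.inf_subgroupOf_right]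
  exact (((MulEquiv.subgroupCongr e1).trans (Subgroup.subgroupOfEquivOfLe inf_le_left)).trans
    (Subgroup.subgroupOfEquivOfLe (inf_le_right : A ⊓ B ≤ B)).symm).trans (MulEquiv.subgroupCongr e2.symm)

theorem relIndex_ne_zero_of_compact_open {V : Type*} [AddCommGroup V] [TopologicalSpace V] [IsTopologicalAddGroup V]
    (A B : AddSubgroup V) (hA : IsCompact (A : Set V)) (hB : IsOpen (B : Set V)) : B.relIndex A ≠ 0 := by
  have : CompactSpace A := isCompact_iff_compactSpace.mp hA
  have h1 : IsOpen ((B.addSubgroupOf A : AddSubgroup A) : Set A) := hB.preimage continuous_subtype_val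
  have := AddSubgroup.quotient_finite_of_isOpen _ h1
  rw [AddSubgroup.relIndex]
  exact AddSubgroup.index_ne_zero_of_finite

theorem HasQ.commens_add {p : ℕ} {V : Type*} [AddCommGroup V] [TopologicalSpace V] [IsTopologicalAddGroup V]
    (A B : AddSubgroup V) (hA : IsCompact (A : Set V)) (hA' : IsOpen (A : Set V))
    (hB : IsCompact (B : Set V)) (hB' : IsOpen (B : Set V)) {m : ℚ}
    (h : HasQ p (AddSubgroup.toSubgroup A) m) : HasQ p (AddSubgroup.toSubgroup B) m := by
  apply HasQ.commens (AddSubgroup.toSubgroup A) (AddSubgroup.toSubgroup B) _ _ h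
  · exact relIndex_ne_zero_of_compact_open B A hB hA'
  · exact relIndex_ne_zero_of_compact_open A B hA hB'


section
variable {F : Type*} [NormedField F] [IsUltrametricDist F]

/-- the closed ball as a subgroup -/
def ballAdd (F : Type*) [NormedField F] [IsUltrametricDist F] (r : ℝ) (hr : 0 ≤ r) : AddSubgroup F where
  carrier := {x | ‖x‖ ≤ r}
  add_mem' {x y} hx hy := (IsUltrametricDist.norm_add_le_max x y).trans (max_le hx hy)
  zero_mem' := by simpa using hr
  neg_mem' {x} hx := by simpa using hx

theorem mem_ballAdd {r : ℝ} {hr : 0 ≤ r} {x : F} : x ∈ ballAdd F r hr ↔ ‖x‖ ≤ r := Iff.rfl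

theorem ballAdd_isOpen (r : ℝ) (hr : 0 < r) : IsOpen (ballAdd F r hr.le : Set F) := by
  have : (ballAdd F r hr.le : Set F) = Metric.closedBall 0 r := by
    ext x; simp [mem_ballAdd]
  rw [this]
  exact IsUltrametricDist.isOpen_closedBall _ hr.ne'

theorem ballAdd_isCompact [ProperSpace F] (r : ℝ) (hr : 0 ≤ r) : IsCompact (ballAdd F r hr : Set F) := by
  have : (ballAdd F r hr : Set F) = Metric.closedBall 0 r := by
    ext x; simp [mem_ballAdd]
  rw [this]
  exact isCompact_closedBall _ _

theorem norm_one_add {x : F} {r : ℝ} (hr1 : r < 1) (hx : ‖x - 1‖ ≤ r) : ‖x‖ = 1 := by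
  have : x = (x - 1) + 1 := by ring
  rw [this, IsUltrametricDist.norm_add_eq_max_of_norm_ne_norm, norm_one, max_eq_right (by linarith)]
  rw [norm_one]; linarith

theorem near_one_mul {x y : F} {r : ℝ} (hr1 : r < 1) (hx : ‖x - 1‖ ≤ r) (hy : ‖y - 1‖ ≤ r) : ‖x * y - 1‖ ≤ r := by
  have : x * y - 1 = x * (y - 1) + (x - 1) := by ring
  rw [this]
  refine (IsUltrametricDist.norm_add_le_max _ _).trans (max_le ?_ hx)
  rw [norm_mul, norm_one_add hr1 hx, one_mul]; exact hy

theorem near_one_pow {x : F} {r : ℝ} (hr0 : 0 ≤ r) (hr1 : r < 1) (hx : ‖x - 1‖ ≤ r) (n : ℕ) : ‖x ^ n - 1‖ ≤ r := by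
  induction n with
  | zero => simpa using hr0
  | succ n ih => rw [pow_succ]; exact near_one_mul hr1 ih hx

/-- multiplicative ball -/
def ballMul (F : Type*) [NormedField F] [IsUltrametricDist F] (r : ℝ) (hr : 0 ≤ r) (hr1 : r < 1) : Subgroup Fˣ where
  carrier := {x | ‖(x : F) - 1‖ ≤ r}
  mul_mem' hx hy := by simpa using near_one_mul hr1 hx hy
  one_mem' := by simpa using hr
  inv_mem' {x} hx := by
    have h1 := norm_one_add hr1 hx
    have : ((x⁻¹ : Fˣ) : F) - 1 = (x⁻¹ : Fˣ) * (1 - x) := by rw [mul_sub]; simp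
    show ‖_‖ ≤ r
    rw [this, norm_mul, Units.val_inv_eq_inv_val, norm_inv, h1, inv_one, one_mul, norm_sub_rev]
    exact hx

theorem mem_ballMul {r : ℝ} {hr : 0 ≤ r} {hr1 : r < 1} {x : Fˣ} : x ∈ ballMul F r hr hr1 ↔ ‖(x : F) - 1‖ ≤ r := Iff.rfl

/-- the unit group -/
def unitMul (F : Type*) [NormedField F] : Subgroup Fˣ where
  carrier := {x | ‖(x : F)‖ = 1}
  mul_mem' hx hy := by
    simp only [Set.mem_setOf_eq] at *
    simp [hx, hy]
  one_mem' := by simp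
  inv_mem' {x} hx := by
    simp only [Set.mem_setOf_eq] at *
    simp [hx]

theorem mem_unitMul {x : Fˣ} : x ∈ unitMul F ↔ ‖(x : F)‖ = 1 := Iff.rfl

/-- key estimate -/
theorem pow_diff (p : ℕ) {x y : F} {r : ℝ} (hr0 : 0 ≤ r) (hr1 : r < 1) (hx : ‖x - 1‖ ≤ r) (hy : ‖y - 1‖ ≤ r) :
    ‖x ^ p - y ^ p - p * (x - y)‖ ≤ r * ‖x - y‖ := by
  have h1 : x ^ p - y ^ p - p * (x - y) = (∑ i ∈ Finset.range p, (x ^ i * y ^ (p - 1 - i) - 1)) * (x - y) := by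
    rw [Finset.sum_sub_distrib, sub_mul, (Commute.all x y).geom_sum₂_mul]
    simp
  rw [h1, norm_mul]
  apply mul_le_mul_of_nonneg_right _ (norm_nonneg _)
  apply IsUltrametricDist.norm_sum_le_of_forall_le_of_nonneg hr0
  intro i _
  exact near_one_mul hr1 (near_one_pow hr0 hr1 hx _) (near_one_pow hr0 hr1 hy _)

theorem pow_diff_norm (p : ℕ) {x y : F} {r : ℝ} (hr0 : 0 ≤ r) (hr1 : r < 1) (hp : r < ‖(p : F)‖) (hx : ‖x - 1‖ ≤ r) (hy : ‖y - 1‖ ≤ r) :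
    ‖x ^ p - y ^ p‖ = ‖(p : F)‖ * ‖x - y‖ := by
  rcases eq_or_ne x y with rfl | hne
  · simp
  have hpos : 0 < ‖x - y‖ := norm_pos_iff.mpr (sub_ne_zero.mpr hne)
  have h := pow_diff p hr0 hr1 hx hy
  have : x ^ p - y ^ p = (x ^ p - y ^ p - p * (x - y)) + p * (x - y) := by ring
  have hlt : ‖x ^ p - y ^ p - p * (x - y)‖ < ‖(p : F) * (x - y)‖ := by
    rw [norm_mul]
    exact h.trans_lt (mul_lt_mul_of_pos_right hp hpos)
  rw [this, IsUltrametricDist.norm_add_eq_max_of_norm_ne_norm hlt.ne, max_eq_right hlt.le, norm_mul]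

theorem pow_surj [CompleteSpace F] (p : ℕ) {r : ℝ} (hr0 : 0 ≤ r) (hr1 : r < 1) (hp : r < ‖(p : F)‖)
    {a : F} (ha : ‖a - 1‖ ≤ ‖(p : F)‖ * r) : ∃ x : F, ‖x - 1‖ ≤ r ∧ x ^ p = a := by
  have hp0 : 0 < ‖(p : F)‖ := hr0.trans_lt hp
  have hpne : (p : F) ≠ 0 := norm_pos_iff.mp hp0
  let T : F → F := fun x => x - (x ^ p - a) / p
  let s : Set F := {x | ‖x - 1‖ ≤ r}
  have hs : IsComplete s := by
    apply IsClosed.isComplete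
    exact isClosed_le (by fun_prop) continuous_const
  have hTd : ∀ x ∈ s, ∀ y ∈ s, ‖T x - T y‖ ≤ r / ‖(p : F)‖ * ‖x - y‖ := by
    intro x hx y hy
    have h := pow_diff p hr0 hr1 hx hy
    have : T x - T y = - (x ^ p - y ^ p - p * (x - y)) / p := by
      simp only [T]; field_simp; ring
    rw [this, norm_div, norm_neg, div_mul_eq_mul_div]
    exact div_le_div_of_nonneg_right h hp0.le
  have h1s : (1 : F) ∈ s := by simpa [s] using hr0
  have hmaps : Set.MapsTo T s s := by
    intro x hx
    have h2 := hTd x hx 1 h1s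
    have h3 : T x - 1 = (T x - T 1) + (T 1 - 1) := by ring
    show ‖T x - 1‖ ≤ r
    rw [h3]
    refine (IsUltrametricDist.norm_add_le_max _ _).trans (max_le (h2.trans ?_) ?_)
    · have : r / ‖(p : F)‖ ≤ 1 := by rw [div_le_one hp0]; exact hp.le
      calc _ ≤ 1 * r := mul_le_mul this hx (norm_nonneg _) zero_le_one
        _ = r := one_mul r
    · have : T 1 - 1 = (a - 1) / p := by simp only [T]; ring
      rw [this, norm_div, div_le_iff₀ hp0, mul_comm]; exact ha
  have hK : r / ‖(p : F)‖ < 1 := by rwa [div_lt_one hp0]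
  have hcontr : ContractingWith ⟨r / ‖(p : F)‖, by positivity⟩ (hmaps.restrict T s s) := by
    refine ⟨by exact_mod_cast hK, ?_⟩
    apply LipschitzWith.of_dist_le_mul
    rintro ⟨x, hx⟩ ⟨y, hy⟩
    rw [Subtype.dist_eq, Subtype.dist_eq, dist_eq_norm, dist_eq_norm]
    exact hTd x hx y hy
  obtain ⟨x, hx, hfix, -⟩ := hcontr.exists_fixedPoint' hs hmaps h1s (edist_ne_top _ _)
  refine ⟨x, hx, ?_⟩
  have h5 : T x = x := hfix
  simp only [T, sub_eq_self, div_eq_zero_iff, hpne, or_false] at h5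
  exact sub_eq_zero.mp h5

end

end ABHN
end FileLoc

section FileLoc2
set_option autoImplicit false

namespace ABHN
section
variable {F : Type*} [NormedField F] [IsUltrametricDist F]

theorem mem_range_pow_ballMul [CompleteSpace F] (p : ℕ) {r : ℝ} (hr0 : 0 ≤ r) (hr1 : r < 1) (hp : r < ‖(p : F)‖)
    (x : ballMul F r hr0 hr1) :
    x ∈ (powMonoidHom p : ballMul F r hr0 hr1 →* ballMul F r hr0 hr1).range ↔ ‖((x : Fˣ) : F) - 1‖ ≤ ‖(p : F)‖ * r := by
  have h1 : ‖(1 : F) - 1‖ ≤ r := by simpa using hr0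
  constructor
  · rintro ⟨y, rfl⟩
    have := pow_diff_norm p hr0 hr1 hp y.2 h1
    simp only [powMonoidHom_apply, SubmonoidClass.coe_pow, Units.val_pow_eq_pow_val]
    rw [one_pow] at this
    rw [this]
    exact mul_le_mul_of_nonneg_left y.2 (norm_nonneg _)
  · intro h
    obtain ⟨y, hy, hyx⟩ := pow_surj p hr0 hr1 hp h
    have hy0 : y ≠ 0 := by
      rintro rfl
      simp at hy; linarith
    exact ⟨⟨Units.mk0 y hy0, hy⟩, Subtype.ext (Units.ext hyx)⟩

theorem ker_pow_ballMul (p : ℕ) {r : ℝ} (hr0 : 0 ≤ r) (hr1 : r < 1) (hp : r < ‖(p : F)‖) :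
    (powMonoidHom p : ballMul F r hr0 hr1 →* ballMul F r hr0 hr1).ker = ⊥ := by
  have h1 : ‖(1 : F) - 1‖ ≤ r := by simpa using hr0
  rw [eq_bot_iff]
  intro y hy
  have h2 : ((y : Fˣ) : F) ^ p = 1 := congrArg (fun z : ballMul F r hr0 hr1 => ((z : Fˣ) : F)) (MonoidHom.mem_ker.mp hy)
  have := pow_diff_norm p hr0 hr1 hp y.2 h1
  rw [one_pow, h2, sub_self, norm_zero] at this
  have hp0 : ‖(p : F)‖ ≠ 0 := (hr0.trans_lt hp).ne'
  have h3 := (mul_eq_zero.mp this.symm).resolve_left hp0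
  rw [norm_eq_zero, sub_eq_zero] at h3
  exact Subtype.ext (Units.ext h3)

theorem mem_range_pow_ballAdd (p : ℕ) {r : ℝ} (hr0 : 0 ≤ r) (hp : (p : F) ≠ 0) (hp1 : ‖(p : F)‖ ≤ 1)
    (x : AddSubgroup.toSubgroup (ballAdd F r hr0)) :
    x ∈ (powMonoidHom p : AddSubgroup.toSubgroup (ballAdd F r hr0) →* AddSubgroup.toSubgroup (ballAdd F r hr0)).range ↔
      ‖(Multiplicative.toAdd (x : Multiplicative F) : F)‖ ≤ ‖(p : F)‖ * r := by
  have hp0 : 0 < ‖(p : F)‖ := norm_pos_iff.mpr hp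
  constructor
  · rintro ⟨y, rfl⟩
    simp only [powMonoidHom_apply, SubmonoidClass.coe_pow, toAdd_pow, nsmul_eq_mul, norm_mul]
    exact mul_le_mul_of_nonneg_left y.2 (norm_nonneg _)
  · intro h
    refine ⟨⟨Multiplicative.ofAdd ((Multiplicative.toAdd (x : Multiplicative F) : F) / p), ?_⟩, ?_⟩
    · show ‖(Multiplicative.toAdd (x : Multiplicative F) : F) / p‖ ≤ r
      rw [norm_div, div_le_iff₀ hp0, mul_comm]; exact h
    · apply Subtype.ext
      apply Multiplicative.toAdd.injective
      simp only [powMonoidHom_apply, SubmonoidClass.coe_pow, toAdd_pow, nsmul_eq_mul, toAdd_ofAdd]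
      field_simp

theorem ker_pow_toSubgroup {V : Type*} [AddCommGroup V] [IsAddTorsionFree V] (p : ℕ) (hp : p ≠ 0) (A : AddSubgroup V) :
    (powMonoidHom p : AddSubgroup.toSubgroup A →* AddSubgroup.toSubgroup A).ker = ⊥ := by
  rw [eq_bot_iff]
  intro y hy
  have h2 : p • (Multiplicative.toAdd (y : Multiplicative V)) = 0 := congrArg Subtype.val (MonoidHom.mem_ker.mp hy)
  rw [smul_eq_zero_iff_right hp] at h2
  exact Subtype.ext h2

theorem index_eq_of_equiv {G G' : Type*} [Group G] [Group G'] (H : Subgroup G) (H' : Subgroup G') (e : G ≃ G')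
    (he : ∀ x y, x⁻¹ * y ∈ H ↔ (e x)⁻¹ * e y ∈ H') : H.index = H'.index := by
  apply Nat.card_congr
  refine Quotient.congr e ?_
  intro a b
  have := he a b
  rw [← QuotientGroup.leftRel_apply, ← QuotientGroup.leftRel_apply] at this
  exact this

theorem hasQ_ballMul [CompleteSpace F] [CharZero F] (p : ℕ) (hpp : p ≠ 0) {r : ℝ} (hr0 : 0 ≤ r) (hr1 : r < 1) (hp : r < ‖(p : F)‖)
    {m : ℚ} (h : HasQ p (AddSubgroup.toSubgroup (ballAdd F r hr0)) m) : HasQ p (ballMul F r hr0 hr1) m := by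
  have hp1 : ‖(p : F)‖ ≤ 1 := IsUltrametricDist.norm_natCast_le_one F p
  have hpF : (p : F) ≠ 0 := Nat.cast_ne_zero.mpr hpp
  have : (powMonoidHom p : ballMul F r hr0 hr1 →* ballMul F r hr0 hr1).range.index =
    (powMonoidHom p : AddSubgroup.toSubgroup (ballAdd F r hr0) →* AddSubgroup.toSubgroup (ballAdd F r hr0)).range.index := by
    let e : ballMul F r hr0 hr1 ≃ AddSubgroup.toSubgroup (ballAdd F r hr0) :=
      { toFun := fun x => ⟨Multiplicative.ofAdd (((x : Fˣ) : F) - 1), x.2⟩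
        invFun := fun y => ⟨Units.mk0 (1 + (Multiplicative.toAdd (y : Multiplicative F) : F)) (by
          intro h0
          have h1 : ‖(Multiplicative.toAdd (y : Multiplicative F) : F)‖ ≤ r := y.2
          rw [← neg_eq_iff_add_eq_zero] at h0
          rw [← h0] at h1
          simp at h1
          linarith), by
            show ‖_‖ ≤ r
            rw [Units.val_mk0, add_sub_cancel_left]
            exact y.2⟩
        left_inv := fun x => by
          apply Subtype.ext; apply Units.ext; exact add_sub_cancel 1 ((x : Fˣ) : F)
        right_inv := fun y => by
          apply Subtype.ext; apply Multiplicative.toAdd.injective; exact add_sub_cancel_left 1 (Multiplicative.toAdd (y : Multiplicative F) : F) }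
    apply index_eq_of_equiv _ _ e
    intro x y
    rw [mem_range_pow_ballMul p hr0 hr1 hp, mem_range_pow_ballAdd p hr0 hpF hp1]
    have hx : ‖((x : Fˣ) : F)‖ = 1 := norm_one_add hr1 x.2
    simp only [e, Equiv.coe_fn_mk, Subgroup.coe_mul, InvMemClass.coe_inv, toAdd_mul, toAdd_inv, toAdd_ofAdd,
      Units.val_mul]
    have : ((x⁻¹ : Fˣ) : F) * ((y : Fˣ) : F) - 1 = ((x⁻¹ : Fˣ) : F) * (-(((x : Fˣ) : F) - 1) + (((y : Fˣ) : F) - 1)) := by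
      have : ((x⁻¹ : Fˣ) : F) * ((x : Fˣ) : F) = 1 := Units.inv_mul _
      linear_combination this
    rw [this, norm_mul, Units.val_inv_eq_inv_val, norm_inv, hx, inv_one, one_mul]
  unfold HasQ HasIx at *
  rw [this, ker_pow_ballMul p hr0 hr1 hp]
  rw [ker_pow_toSubgroup p hpp] at h
  simpa using h

theorem ballMul_finite [ProperSpace F] {r : ℝ} (hr0 : 0 < r) (hr1 : r < 1) :
    (ballMul F r hr0.le hr1).relIndex (unitMul F) ≠ 0 := by
  have h := relIndex_ne_zero_of_compact_open (ballAdd F 1 zero_le_one) (ballAdd F r hr0.le) (ballAdd_isCompact 1 zero_le_one)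
    (ballAdd_isOpen r hr0)
  rw [AddSubgroup.relIndex] at h
  have := Nat.finite_of_card_ne_zero h
  rw [Subgroup.relIndex]
  have : Finite (unitMul F ⧸ (ballMul F r hr0.le hr1).subgroupOf (unitMul F)) := by
    let f : unitMul F → (ballAdd F 1 zero_le_one) ⧸ (ballAdd F r hr0.le).addSubgroupOf (ballAdd F 1 zero_le_one) :=
      fun x => QuotientAddGroup.mk ⟨(x : Fˣ), le_of_eq x.2⟩
    have key : ∀ x y : unitMul F, f x = f y → (x : unitMul F ⧸ (ballMul F r hr0.le hr1).subgroupOf (unitMul F)) = y := by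
      intro x y hxy
      rw [QuotientGroup.eq]
      rw [QuotientAddGroup.eq] at hxy
      have hxy' : ‖-((x : Fˣ) : F) + ((y : Fˣ) : F)‖ ≤ r := hxy
      show ‖((x⁻¹ : Fˣ) : F) * ((y : Fˣ) : F) - 1‖ ≤ r
      have hx : ‖((x : Fˣ) : F)‖ = 1 := x.2
      have : ((x⁻¹ : Fˣ) : F) * ((y : Fˣ) : F) - 1 = ((x⁻¹ : Fˣ) : F) * (-((x : Fˣ) : F)  + ((y : Fˣ) : F)) := by
        have : ((x⁻¹ : Fˣ) : F) * ((x : Fˣ) : F) = 1 := Units.inv_mul _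
        linear_combination this
      rw [this, norm_mul, Units.val_inv_eq_inv_val, norm_inv, hx, inv_one, one_mul]
      exact hxy'
    apply Finite.of_injective (β := (ballAdd F 1 zero_le_one) ⧸ (ballAdd F r hr0.le).addSubgroupOf (ballAdd F 1 zero_le_one))
      (fun q => f q.out)
    intro q q' h
    have := key _ _ h
    rwa [QuotientGroup.out_eq', QuotientGroup.out_eq'] at this
  exact Subgroup.index_ne_zero_of_finite

end

section
variable {F : Type*} [NontriviallyNormedField F] [IsUltrametricDist F] [ProperSpace F]

theorem exists_uniformizer (F : Type*) [NontriviallyNormedField F] [IsUltrametricDist F] [ProperSpace F] :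
    ∃ π : Fˣ, ‖(π : F)‖ < 1 ∧ ∀ x : F, ‖x‖ < 1 → ‖x‖ ≤ ‖(π : F)‖ := by
  have hcl : IsCompact (Metric.ball (0 : F) 1) := by
    apply (isCompact_closedBall (0 : F) 1).of_isClosed_subset (IsUltrametricDist.isClosed_ball _ _) Metric.ball_subset_closedBall
  obtain ⟨π, hπ, hmax⟩ := hcl.exists_isMaxOn ⟨0, by simp⟩ continuous_norm.continuousOn
  obtain ⟨y, hy0, hy1⟩ := NormedField.exists_norm_lt_one F
  have hm : ∀ x : F, ‖x‖ < 1 → ‖x‖ ≤ ‖π‖ := fun x hx => hmax (by simpa using hx)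
  have hπ0 : π ≠ 0 := norm_pos_iff.mp (hy0.trans_le (hm y hy1))
  exact ⟨Units.mk0 π hπ0, by simpa using hπ, hm⟩

theorem unitMul_quot (F : Type*) [NontriviallyNormedField F] [IsUltrametricDist F] [ProperSpace F]  :
    Nonempty (Multiplicative ℤ ≃* Fˣ ⧸ unitMul F) := by
  obtain ⟨π, hπ1, hmax⟩ := exists_uniformizer F
  have hπ0 : 0 < ‖(π : F)‖ := norm_pos_iff.mpr π.ne_zero
  refine ⟨MulEquiv.ofBijective ((QuotientGroup.mk' (unitMul F)).comp (zpowersHom Fˣ π)) ⟨?_, ?_⟩⟩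
  · rw [← MonoidHom.ker_eq_bot_iff, eq_bot_iff]
    intro n hn
    rw [MonoidHom.mem_ker, MonoidHom.comp_apply, QuotientGroup.mk'_apply, QuotientGroup.eq_one_iff, zpowersHom_apply] at hn
    have h1 : ‖(π : F)‖ ^ (Multiplicative.toAdd n) = 1 := by
      have := mem_unitMul.mp hn
      simpa using this
    have h2 := (zpow_eq_one_iff_right₀ hπ0.le hπ1.ne).mp h1
    exact h2
  · intro q
    obtain ⟨x, rfl⟩ := QuotientGroup.mk_surjective q
    have hx0 : 0 < ‖(x : F)‖ := norm_pos_iff.mpr x.ne_zero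
    obtain ⟨n, hn1, hn2⟩ := exists_mem_Ioc_zpow (x := ‖(x : F)‖) (y := ‖(π : F)‖⁻¹) hx0 ((one_lt_inv₀ hπ0).mpr hπ1)
    refine ⟨Multiplicative.ofAdd (-(n+1)), ?_⟩
    rw [MonoidHom.comp_apply, QuotientGroup.mk'_apply, QuotientGroup.eq, zpowersHom_apply, toAdd_ofAdd, mem_unitMul]
    rw [zpow_neg, inv_inv, Units.val_mul, norm_mul, Units.val_zpow_eq_zpow_val, norm_zpow]
    rw [inv_zpow] at hn1 hn2
    set P := ‖(π : F)‖ with hP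
    have hPn : 0 < P ^ n := zpow_pos hπ0 n
    have hPn1 : 0 < P ^ (n+1) := zpow_pos hπ0 (n+1)
    have e : P ^ (n+1) = P ^ n * P := zpow_add_one₀ hπ0.ne' n
    apply le_antisymm
    · calc _ ≤ P ^ (n+1) * (P ^ (n+1))⁻¹ := mul_le_mul_of_nonneg_left hn2 hPn1.le
        _ = 1 := mul_inv_cancel₀ hPn1.ne'
    · by_contra hlt
      push Not at hlt
      have h3 : ‖((π ^ (n+1) * x : Fˣ) : F)‖ < 1 := by
        rw [Units.val_mul, norm_mul, Units.val_zpow_eq_zpow_val, norm_zpow]; exact hlt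
      have h4 := hmax _ h3
      rw [Units.val_mul, norm_mul, Units.val_zpow_eq_zpow_val, norm_zpow, ← hP, e] at h4
      have h5 : P ^ n * ‖(x : F)‖ ≤ 1 := by
        have : P * (P ^ n * ‖(x : F)‖) ≤ P * 1 := by linarith
        exact le_of_mul_le_mul_left this hπ0
      have h6 : 1 < P ^ n * ‖(x : F)‖ := by
        calc (1:ℝ) = P ^ n * (P ^ n)⁻¹ := (mul_inv_cancel₀ hPn.ne').symm
          _ < _ := mul_lt_mul_of_pos_left hn1 hPn
      linarith

theorem hasQ_units [CharZero F] (p : ℕ) (hpp : p ≠ 0) {m : ℚ}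
    (h : HasQ p (AddSubgroup.toSubgroup (ballAdd F 1 zero_le_one)) m) : HasQ p (unitMul F) m := by
  have hpF : (p : F) ≠ 0 := Nat.cast_ne_zero.mpr hpp
  have hp0 : 0 < ‖(p : F)‖ := norm_pos_iff.mpr hpF
  have hp1 : ‖(p : F)‖ ≤ 1 := IsUltrametricDist.norm_natCast_le_one F p
  have hr0 : 0 < ‖(p : F)‖ / 2 := by positivity
  have hr1 : ‖(p : F)‖ / 2 < 1 := by linarith
  have hrp : ‖(p : F)‖ / 2 < ‖(p : F)‖ := by linarith
  have h1 := HasQ.commens_add (p := p) (ballAdd F 1 zero_le_one) (ballAdd F (‖(p : F)‖ / 2) hr0.le) (ballAdd_isCompact 1 zero_le_one) (ballAdd_isOpen 1 zero_lt_one)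
    (ballAdd_isCompact _ hr0.le) (ballAdd_isOpen _ hr0) h
  have h2 := hasQ_ballMul p hpp hr0.le hr1 hrp h1
  refine HasQ.commens (ballMul F (‖(p : F)‖ / 2) hr0.le hr1) (unitMul F) (ballMul_finite hr0 hr1) ?_ h2
  have : (ballMul F (‖(p : F)‖ / 2) hr0.le hr1) ≤ unitMul F := fun x hx => norm_one_add hr1 hx
  rw [Subgroup.relIndex_eq_one.mpr this]; exact one_ne_zero

theorem hasQ_of_sub {p : ℕ} {G : Type*} [CommGroup G] (H : Subgroup G) {r s : ℚ} (hH : HasQ p H r) (hQ : HasQ p (G ⧸ H) s) :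
    HasQ p G (s * r) := by
  have h1 : HasQ p (QuotientGroup.mk' H).ker r := hH.congr (MulEquiv.subgroupCongr (QuotientGroup.ker_mk' _).symm)
  rw [mul_comm]
  exact HasQ.of_ker_quot (QuotientGroup.mk' H) (QuotientGroup.mk'_surjective _) h1 hQ

theorem hasQ_field [CharZero F] (p : ℕ) (hpp : p ≠ 0) {m : ℚ}
    (h : HasQ p (AddSubgroup.toSubgroup (ballAdd F 1 zero_le_one)) m) : HasQ p Fˣ (p * m) := by
  have h1 := hasQ_units p hpp h
  obtain ⟨e⟩ := unitMul_quot F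
  exact hasQ_of_sub (unitMul F) h1 ((HasQ.int hpp).congr e)

/-- local p-th powers are open -/
theorem near_one_is_pow [CharZero F] (p : ℕ) (hpp : p ≠ 0) : ∃ ε > 0, ∀ x : F, ‖x - 1‖ ≤ ε → ∃ y, y ^ p = x := by
  have hpF : (p : F) ≠ 0 := Nat.cast_ne_zero.mpr hpp
  have hp0 : 0 < ‖(p : F)‖ := norm_pos_iff.mpr hpF
  have hp1 : ‖(p : F)‖ ≤ 1 := IsUltrametricDist.norm_natCast_le_one F p
  refine ⟨‖(p : F)‖ * (‖(p : F)‖ / 2), by positivity, fun x hx => ?_⟩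
  obtain ⟨y, -, hy⟩ := pow_surj p (by positivity) (by linarith) (by linarith) hx
  exact ⟨y, hy⟩

end
end ABHN
end FileLoc2

section FileLoc3
set_option autoImplicit false

namespace ABHN
section
variable {p : ℕ} {F L : Type*} [Field F] [Field L] [Algebra F L] {ζ b : F} {θ : L}

theorem it_map_units (σ : L ≃ₐ[F] L) (n : ℕ) (x : Lˣ) : (((Units.map (σ : L →* L))^[n] x : Lˣ) : L) = σ^[n] (x : L) := by
  induction n with
  | zero => rfl
  | succ n ih => rw [Function.iterate_succ_apply', Function.iterate_succ_apply', ← ih]; rfl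

theorem Kum.index_normSub (h : Kum p F ζ b θ) {r s : ℚ} (hr : HasQ p Fˣ r) (hs : HasQ p Lˣ s) :
    (((normSub p h.prime.ne_zero ζ b).index : ℕ) : ℚ) ^ (p - 1) = r ^ p / s := by
  set σ : Lˣ →* Lˣ := Units.map (h.σ : L →* L) with hσ
  let f : Fˣ →* Lˣ := Units.map (algebraMap F L : F →* L)
  have hf : Function.Injective f := Units.map_injective (algebraMap F L).injective
  have hfix : fixG σ = f.range := by
    ext x
    rw [mem_fixG]
    constructor
    · intro hx
      obtain ⟨y, hy⟩ := h.fixed (x : L) (congrArg Units.val hx)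
      have hy0 : y ≠ 0 := by
        rintro rfl
        exact x.ne_zero (by simpa using hy.symm)
      exact ⟨Units.mk0 y hy0, Units.ext hy⟩
    · rintro ⟨y, rfl⟩
      exact Units.ext (h.σ.commutes _)
  have hNval : ∀ x : Lˣ, ((Nhom p σ x : Lˣ) : L) = algebraMap F L (Algebra.norm F (x : L)) := by
    intro x
    rw [h.norm_eq, Nhom_apply, Units.coe_prod]
    apply Finset.prod_congr rfl
    intro i _
    exact it_map_units h.σ i x
  have hN : normSub p h.prime.ne_zero ζ b = (Nhom p σ).range.comap f := by
    ext a
    show NormRes p ζ b (a : F) ↔ f a ∈ (Nhom p σ).range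
    rw [h.normRes_iff]
    constructor
    · rintro ⟨y, hy⟩
      have hy0 : y ≠ 0 := by
        rintro rfl
        have := h.finDim
        rw [Algebra.norm_zero] at hy
        exact a.ne_zero hy.symm
      refine ⟨Units.mk0 y hy0, Units.ext ?_⟩
      rw [hNval, Units.val_mk0, hy]; rfl
    · rintro ⟨y, hy⟩
      refine ⟨y, (algebraMap F L).injective ?_⟩
      rw [← hNval, hy]; rfl
  have hfixQ : HasQ p (fixG σ) r := by
    rw [hfix]
    exact hr.congr (MonoidHom.ofInjective hf)
  have := gamma σ p h.prime (fun x => Units.ext ?_) (fun x hx => ?_) hfixQ hs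
  · rw [hN, Subgroup.index_comap, ← hfix]
    exact this
  · rw [it_map_units, h.σ_pow]
  · have h1 : Algebra.norm F (x : L) = 1 := by
      apply (algebraMap F L).injective
      rw [← hNval, Nhom_apply, hx, Units.val_one, map_one]
    obtain ⟨y, hy⟩ := h.h90 _ h1
    refine ⟨y, Units.ext ?_⟩
    rw [hy, Units.val_div_eq_div_val]; rfl
end

section
variable {F : Type*} [NontriviallyNormedField F] [IsUltrametricDist F] [ProperSpace F] [CharZero F]

theorem exists_hasQ_ball (F : Type*) [NontriviallyNormedField F] [IsUltrametricDist F] [ProperSpace F] [CharZero F] (p : ℕ) (hp : p ≠ 0) :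
    ∃ m : ℕ, m ≠ 0 ∧ HasQ p (AddSubgroup.toSubgroup (ballAdd F 1 zero_le_one)) m ∧
    m = (ballAdd F ‖(p : F)‖ (norm_nonneg _)).relIndex (ballAdd F 1 zero_le_one) := by
  have hpF : (p : F) ≠ 0 := Nat.cast_ne_zero.mpr hp
  have hp1 : ‖(p : F)‖ ≤ 1 := IsUltrametricDist.norm_natCast_le_one F p
  have h0 := relIndex_ne_zero_of_compact_open (ballAdd F 1 zero_le_one) (ballAdd F ‖(p : F)‖ (norm_nonneg _))
    (ballAdd_isCompact _ _) (ballAdd_isOpen _ (norm_pos_iff.mpr hpF))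
  refine ⟨_, h0, ?_, rfl⟩
  have h1 : (powMonoidHom p : AddSubgroup.toSubgroup (ballAdd F 1 zero_le_one) →* AddSubgroup.toSubgroup (ballAdd F 1 zero_le_one)).range.index
     = (ballAdd F ‖(p : F)‖ (norm_nonneg _)).relIndex (ballAdd F 1 zero_le_one) := by
    have : (powMonoidHom p : AddSubgroup.toSubgroup (ballAdd F 1 zero_le_one) →* AddSubgroup.toSubgroup (ballAdd F 1 zero_le_one)).range
      = (AddSubgroup.toSubgroup (ballAdd F ‖(p : F)‖ (norm_nonneg _))).subgroupOf (AddSubgroup.toSubgroup (ballAdd F 1 zero_le_one)) := by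
      ext x
      rw [mem_range_pow_ballAdd p zero_le_one hpF hp1, mul_one]
      rfl
    rw [this]
    rfl
  refine ⟨by rw [h1]; exact h0, ?_, ?_⟩
  · rw [ker_pow_toSubgroup p hp]; simp
  · rw [ker_pow_toSubgroup p hp, h1]; simp

theorem hasQ_finiteDim {L : Type*} [NontriviallyNormedField L] [IsUltrametricDist L] [NormedAlgebra F L] [FiniteDimensional F L] [ProperSpace L]
    (p : ℕ) {m : ℚ} (h : HasQ p (AddSubgroup.toSubgroup (ballAdd F 1 zero_le_one)) m) :
    HasQ p (AddSubgroup.toSubgroup (ballAdd L 1 zero_le_one)) (m ^ Module.finrank F L) := by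
  let n := Module.finrank F L
  let e : L ≃L[F] (Fin n → F) := ContinuousLinearEquiv.ofFinrankEq (by simp [n])
  let B : AddSubgroup (Fin n → F) := AddSubgroup.pi Set.univ (fun _ => ballAdd F 1 zero_le_one)
  have hB : (B : Set (Fin n → F)) = Set.univ.pi (fun _ => (ballAdd F 1 zero_le_one : Set F)) := rfl
  let A : AddSubgroup L := B.comap (e : L →+ (Fin n → F))
  have hA : (A : Set L) = e.toHomeomorph ⁻¹' (B : Set (Fin n → F)) := rfl
  have hAc : IsCompact (A : Set L) := by
    rw [hA, Homeomorph.isCompact_preimage, hB]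
    exact isCompact_univ_pi (fun _ => ballAdd_isCompact _ _)
  have hAo : IsOpen (A : Set L) := by
    rw [hA, Homeomorph.isOpen_preimage, hB]
    exact isOpen_set_pi Set.finite_univ (fun _ _ => ballAdd_isOpen _ zero_lt_one)
  refine HasQ.commens_add (p := p) A (ballAdd L 1 zero_le_one) hAc hAo (ballAdd_isCompact _ _) (ballAdd_isOpen _ zero_lt_one) ?_
  refine (h.pi n).congr (MulEquiv.symm ?_)
  refine
    { toFun := fun x i => ⟨Multiplicative.ofAdd (e (Multiplicative.toAdd (x : Multiplicative L)) i), x.2 i trivial⟩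
      invFun := fun y => ⟨Multiplicative.ofAdd (e.symm (fun i => Multiplicative.toAdd (y i : Multiplicative F))), ?_⟩
      left_inv := ?_
      right_inv := ?_
      map_mul' := ?_ }
  · show e (e.symm (fun i => Multiplicative.toAdd (y i : Multiplicative F))) ∈ B
    rw [ContinuousLinearEquiv.apply_symm_apply]
    exact fun i _ => (y i).2
  · intro x
    apply Subtype.ext
    apply Multiplicative.toAdd.injective
    exact e.symm_apply_apply _
  · intro y
    funext i
    apply Subtype.ext
    apply Multiplicative.toAdd.injective
    exact congrFun (e.apply_symm_apply _) i
  · intro x y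
    funext i
    apply Subtype.ext
    apply Multiplicative.toAdd.injective
    exact congrFun (map_add e (Multiplicative.toAdd (x : Multiplicative L)) (Multiplicative.toAdd (y : Multiplicative L))) i

/-- local norm index -/
theorem local_norm_index {p : ℕ} (hp : p.Prime) {ζ b : F} (hζ : IsPrimitiveRoot ζ p) (hb : ∀ c, c ^ p ≠ b) :
    (normSub p hp.ne_zero ζ b).index = p := by
  have : Fact (Irreducible (Polynomial.X ^ p - Polynomial.C b)) := ⟨X_pow_sub_C_irreducible_of_prime hp hb⟩
  have h := exists_Kum hp hζ hb
  let L := AdjoinRoot (Polynomial.X ^ p - Polynomial.C b)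
  have hfd : FiniteDimensional F L := h.finDim
  letI : NontriviallyNormedField L := spectralNorm.nontriviallyNormedField F L
  letI : NormedAlgebra F L := spectralNorm.normedAlgebra F L
  have : IsUltrametricDist L := IsUltrametricDist.isUltrametricDist_of_isNonarchimedean_norm isNonarchimedean_spectralNorm
  have : ProperSpace L := FiniteDimensional.proper F L
  have : CharZero L := algebraRat.charZero L
  obtain ⟨m, hm0, hm, -⟩ := exists_hasQ_ball F p hp.ne_zero
  have hL := hasQ_finiteDim (L := L) p hm
  rw [h.rank] at hL
  have h1 := hasQ_field p hp.ne_zero hm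
  have h2 := hasQ_field p hp.ne_zero hL
  have h3 := h.index_normSub h1 h2
  have hm0' : (m : ℚ) ≠ 0 := by exact_mod_cast hm0
  have hp0' : (p : ℚ) ≠ 0 := by exact_mod_cast hp.ne_zero
  have h4 : ((p:ℚ) * m) ^ p / (p * m ^ p) = p ^ (p - 1) := by
    rw [mul_pow, mul_div_mul_right _ _ (pow_ne_zero _ hm0'), div_eq_iff hp0', ← pow_succ, Nat.sub_add_cancel hp.one_le]
  rw [h4] at h3
  have h5 : (normSub p hp.ne_zero ζ b).index ^ (p - 1) = p ^ (p - 1) := by exact_mod_cast h3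
  exact Nat.pow_left_injective (Nat.sub_ne_zero_of_lt hp.one_lt) h5

/-- local p-th power index -/
theorem local_pow_index {p : ℕ} (hp : p.Prime) {ζ : F} (hζ : IsPrimitiveRoot ζ p) :
    (powMonoidHom p : Fˣ →* Fˣ).range.index = p ^ 2 * (ballAdd F ‖(p : F)‖ (norm_nonneg _)).relIndex (ballAdd F 1 zero_le_one) := by
  obtain ⟨m, hm0, hm, hmm⟩ := exists_hasQ_ball F p hp.ne_zero
  rw [← hmm]
  have h1 := hasQ_field p hp.ne_zero hm
  have h2 := h1.2.2
  have : Nat.card (powMonoidHom p : Fˣ →* Fˣ).ker = p := by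
    have : NeZero p := ⟨hp.ne_zero⟩
    have e : (powMonoidHom p : Fˣ →* Fˣ).ker = rootsOfUnity p F := by
      ext x; simp [mem_rootsOfUnity]
    rw [e, hζ.card_rootsOfUnity]
  rw [this] at h2
  have h3 : (((powMonoidHom p : Fˣ →* Fˣ).range.index : ℕ) : ℚ) = ((p ^ 2 * m : ℕ) : ℚ) := by
    rw [h2]; push_cast; ring
  exact_mod_cast h3
end
end ABHN
end FileLoc3

section FileLoc4
set_option autoImplicit false
set_option linter.unusedSectionVars false

namespace ABHN
section
open Polynomial
theorem NormRes.self_odd {p : ℕ} {F : Type*} [Field F] {ζ : F} (hp : p.Prime) (hp2 : p ≠ 2) (hζ : IsPrimitiveRoot ζ p) (x : F) :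
    NormRes p ζ x x := by
  refine ⟨X, ?_⟩
  have h : (∏ i ∈ Finset.range p, (X : F[X]).comp (C (ζ ^ i) * X)) = X ^ p := by
    simp only [X_comp, Finset.prod_mul_distrib, Finset.prod_const, Finset.card_range]
    rw [← map_prod, Finset.prod_pow_eq_pow_sum, Finset.sum_range_id]
    obtain ⟨k, hk⟩ := (hp.odd_of_ne_two hp2)
    have : p * (p - 1) / 2 = p * k := by
      rw [hk, Nat.add_sub_cancel, mul_left_comm, Nat.mul_div_cancel_left _ two_pos]
    rw [this, pow_mul, hζ.pow_eq_one, one_pow, map_one, one_mul]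
  rw [h]

theorem NormRes.two {F : Type*} [Field F] (x a b : F) : NormRes 2 (-1) x (a ^ 2 - b ^ 2 * x) := by
  refine ⟨C a + C b * X, -C b ^ 2, ?_⟩
  simp only [Finset.prod_range_succ, Finset.prod_range_zero, add_comp, mul_comp, C_comp, X_comp]
  simp only [pow_zero, pow_one, map_one, map_neg, map_sub, map_mul, map_pow]
  ring
end
section
variable {F : Type*} [NontriviallyNormedField F] [IsUltrametricDist F] [ProperSpace F] [CharZero F]

theorem tame_pow {p : ℕ} (hp1 : ‖(p : F)‖ = 1) {x : F} (hx : ‖x - 1‖ < 1) : ∃ y, y ^ p = x := by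
  obtain ⟨y, -, hy⟩ := pow_surj (F := F) p (norm_nonneg (x - 1)) hx (by rw [hp1]; exact hx) (by rw [hp1, one_mul])
  exact ⟨y, hy⟩

theorem norm_eq_one_of_pow {p : ℕ} (hp : p ≠ 0) {x y : F} (h : y ^ p = x) (hx : ‖x‖ = 1) : ‖y‖ = 1 := by
  rw [← h, norm_pow] at hx
  exact (pow_eq_one_iff_of_nonneg (norm_nonneg _) hp).mp hx

theorem tame_units {p : ℕ} (hp : p.Prime) {ζ : F} (hζ : IsPrimitiveRoot ζ p) (hp1 : ‖(p : F)‖ = 1) {y u : F}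
    (hy : ‖y‖ = 1) (hu : ‖u‖ = 1) (hyp : ∀ c, c ^ p ≠ y) : ∃ (j : ℕ) (w : F), u = y ^ j * w ^ p := by
  obtain ⟨m, hm0, hm, hmm⟩ := exists_hasQ_ball F p hp.ne_zero
  have hm1 : m = 1 := by
    rw [hmm, AddSubgroup.relIndex_eq_one]
    intro x hx
    rw [mem_ballAdd] at *
    rwa [hp1]
  subst hm1
  have h1 := hasQ_units p hp.ne_zero hm
  obtain ⟨h2, h3, h4⟩ := h1
  have hker : Nat.card (powMonoidHom p : unitMul F →* unitMul F).ker ≤ p := by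
    have : NeZero p := ⟨hp.ne_zero⟩
    refine le_trans ?_ (le_of_eq hζ.card_rootsOfUnity)
    have : Finite (rootsOfUnity p F) := inferInstance
    refine Nat.card_le_card_of_injective (fun x => (⟨((x : unitMul F) : Fˣ), ?_⟩ : rootsOfUnity p F)) ?_
    · rw [mem_rootsOfUnity]
      exact congrArg Subtype.val (MonoidHom.mem_ker.mp x.2)
    · intro a b hab
      apply Subtype.ext
      apply Subtype.ext
      exact congrArg (fun z : rootsOfUnity p F => (z : Fˣ)) hab
  set H := (powMonoidHom p : unitMul F →* unitMul F).range with hH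
  have hcard : Nat.card (unitMul F ⧸ H) ≤ p := by
    have : H.index ≤ p := by
      refine le_trans (le_of_eq ?_) hker
      have : ((H.index : ℕ) : ℚ) = Nat.card (powMonoidHom p : unitMul F →* unitMul F).ker := by rw [h4]; simp
      exact_mod_cast this
    exact this
  have hfin : Finite (unitMul F ⧸ H) := Nat.finite_of_card_ne_zero h2
  have hy0 : y ≠ 0 := by rintro rfl; simp at hy
  have hu0 : u ≠ 0 := by rintro rfl; simp at hu
  let Y : unitMul F := ⟨Units.mk0 y hy0, hy⟩
  let U : unitMul F := ⟨Units.mk0 u hu0, hu⟩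
  have hYne : (Y : unitMul F ⧸ H) ≠ 1 := by
    rw [Ne, QuotientGroup.eq_one_iff]
    rintro ⟨c, hc⟩
    exact hyp ((c : Fˣ) : F) (congrArg (fun z : unitMul F => ((z : Fˣ) : F)) hc)
  have hord : orderOf (Y : unitMul F ⧸ H) = p := by
    have : Fact p.Prime := ⟨hp⟩
    apply orderOf_eq_prime _ hYne
    rw [← QuotientGroup.mk_pow, QuotientGroup.eq_one_iff]
    exact ⟨Y, rfl⟩
  have hz : Subgroup.zpowers (Y : unitMul F ⧸ H) = ⊤ := by
    apply Subgroup.eq_top_of_le_card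
    rw [Nat.card_zpowers, hord]
    exact hcard
  have hmem : (U : unitMul F ⧸ H) ∈ Subgroup.zpowers (Y : unitMul F ⧸ H) := by rw [hz]; trivial
  rw [← mem_powers_iff_mem_zpowers, Submonoid.mem_powers_iff] at hmem
  obtain ⟨j, hj⟩ := hmem
  rw [← QuotientGroup.mk_pow, QuotientGroup.eq] at hj
  obtain ⟨w, hw⟩ := hj
  refine ⟨j, ((w : Fˣ) : F), ?_⟩
  have h5 : U = Y ^ j * w ^ p := by
    rw [show w ^ p = (Y ^ j)⁻¹ * U from hw]; simp
  exact congrArg (fun z : unitMul F => ((z : Fˣ) : F)) h5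

theorem exists_nat_small (F : Type*) [NontriviallyNormedField F] [IsUltrametricDist F] [ProperSpace F] : ∃ n : ℕ, ‖(n : F) + 1‖ < 1 := by
  have hc : IsCompact (Metric.closedBall (0 : F) 1) := isCompact_closedBall _ _
  obtain ⟨a, -, φ, hφ, hlim⟩ := hc.tendsto_subseq (x := fun n : ℕ => (n : F)) (fun n => by
    simpa using IsUltrametricDist.norm_natCast_le_one F n)
  have hcau := hlim.cauchySeq
  rw [Metric.cauchySeq_iff'] at hcau
  obtain ⟨N, hN⟩ := hcau 1 one_pos
  have h1 := hN (N+1) (Nat.le_succ N)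
  have h2 : φ N < φ (N+1) := hφ (Nat.lt_succ_self N)
  refine ⟨φ (N+1) - φ N - 1, ?_⟩
  rw [dist_eq_norm] at h1
  have h3 : φ (N+1) = (φ (N+1) - φ N - 1) + 1 + φ N := by omega
  have h4 : ((φ (N+1) : ℕ) : F) = ((φ (N+1) - φ N - 1 : ℕ) : F) + 1 + ((φ N : ℕ) : F) := by
    have := congrArg (Nat.cast : ℕ → F) h3
    simpa only [Nat.cast_add, Nat.cast_one] using this
  have h5 : ((φ (N+1) - φ N - 1 : ℕ) : F) + 1 = ((φ (N+1) : ℕ) : F) - ((φ N : ℕ) : F) := by rw [h4]; ring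
  rw [h5]
  exact h1

theorem tame_norm {p : ℕ} (hp : p.Prime) {ζ : F} (hζ : IsPrimitiveRoot ζ p) (hp1 : ‖(p : F)‖ = 1) {x u : F}
    (hx : ‖x‖ = 1) (hu : ‖u‖ = 1) : NormRes p ζ x u := by
  have hx0 : x ≠ 0 := by rintro rfl; simp at hx
  by_cases hxp : ∃ c, c ^ p = x
  · obtain ⟨c, rfl⟩ := hxp
    exact NormRes.of_pow hp hζ (by rintro rfl; simp [hp.ne_zero] at hx0) u
  push Not at hxp
  suffices ∃ y, ‖y‖ = 1 ∧ (∀ c, c ^ p ≠ y) ∧ NormRes p ζ x y by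
    obtain ⟨y, hy1, hyp, hyN⟩ := this
    obtain ⟨j, w, rfl⟩ := tame_units hp hζ hp1 hy1 hu hyp
    exact (hyN.npow j).mul (NormRes.pow_self w)
  by_cases hp2 : p = 2
  · subst hp2
    have hζ' : ζ = -1 := hζ.eq_neg_one_of_two_right
    subst hζ'
    by_contra! hcon
    have hsq : ∀ a b : F, ‖a ^ 2 - b ^ 2 * x‖ = 1 → ∃ c, c ^ 2 = a ^ 2 - b ^ 2 * x := by
      intro a b hab
      by_contra! h
      exact hcon _ hab h (NormRes.two x a b)
    obtain ⟨c, hc⟩ := hsq 0 1 (by simpa using hx)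
    have hc1 : ‖c‖ = 1 := norm_eq_one_of_pow two_ne_zero hc (by simpa using hx)
    have hc0 : c ≠ 0 := by rintro rfl; simp at hc1
    have hxc : x = - c ^ 2 := by rw [hc]; ring
    -- -1 not a square
    have hm1 : ∀ d : F, d ^ 2 ≠ -1 := by
      intro d hd
      apply hxp (d * c)
      rw [mul_pow, hd, hxc]; ring
    have hsum : ∀ a : F, ‖a ^ 2 + 1‖ = 1 → ∃ d, d ^ 2 = a ^ 2 + 1 := by
      intro a ha
      have e : a ^ 2 - c⁻¹ ^ 2 * x = a ^ 2 + 1 := by rw [hxc]; field_simp; ring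
      rw [← e] at ha ⊢
      exact hsq _ _ ha
    have key : ∀ n : ℕ, ∃ a : F, ‖a‖ ≤ 1 ∧ ‖(n : F) - a ^ 2‖ < 1 := by
      intro n
      induction n with
      | zero => exact ⟨0, by simp, by simp⟩
      | succ n ih =>
        obtain ⟨a, ha1, ha⟩ := ih
        have hle : ‖a ^ 2 + 1‖ ≤ 1 := (IsUltrametricDist.norm_add_le_max _ _).trans (max_le (by rw [norm_pow]; exact pow_le_one₀ (norm_nonneg _) ha1) (by simp))
        rcases hle.lt_or_eq with hlt | heq
        · exfalso
          -- ‖-a² - 1‖ < 1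
          have h1 : ‖(-a ^ 2) - 1‖ < 1 := by
            rw [← norm_neg, neg_sub, sub_neg_eq_add, add_comm]; exact hlt
          obtain ⟨y, hy⟩ := tame_pow hp1 h1
          have ha0 : a ≠ 0 := by rintro rfl; simp at hlt
          apply hm1 (y / a)
          rw [div_pow, hy]; field_simp
        · obtain ⟨d, hd⟩ := hsum a heq
          refine ⟨d, (norm_eq_one_of_pow two_ne_zero hd heq).le, ?_⟩
          rw [hd]; convert ha using 2; push_cast; ring
    obtain ⟨n, hn⟩ := exists_nat_small F
    obtain ⟨a, ha1, ha⟩ := key n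
    have h2 : ‖(-a ^ 2) - 1‖ < 1 := by
      have : (-a ^ 2) - 1 = ((n : F) - a ^ 2) - ((n : F) + 1) := by ring
      rw [this, sub_eq_add_neg]
      rw [← norm_neg] at hn
      exact (IsUltrametricDist.norm_add_le_max _ _).trans_lt (max_lt ha hn)
    obtain ⟨y, hy⟩ := tame_pow hp1 h2
    have ha0 : a ≠ 0 := by
      rintro rfl
      simp at h2
    apply hm1 (y / a)
    rw [div_pow, hy]; field_simp
  · exact ⟨x, hx, hxp, NormRes.self_odd hp hp2 hζ x⟩
end
end ABHN
end FileLoc4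

section FileGlob1
set_option autoImplicit false
set_option linter.unusedSectionVars false
open scoped TensorProduct
open IsDedekindDomain NumberField

namespace ABHN

section Compl
variable {K : Type*} [Field K] [NumberField K] (v : HeightOneSpectrum (𝓞 K))

/-- the embedding into the completion -/
noncomputable def emb : K →+* v.adicCompletion K := FinitePlace.embedding v

lemma emb_eq : (emb v : K →+* v.adicCompletion K) = algebraMap K (v.adicCompletion K) := by
  ext x
  rfl

lemma emb_norm (x : K) : ‖emb v x‖ = HeightOneSpectrum.adicAbv K v x :=
  FinitePlace.norm_embedding v x

lemma emb_dense : DenseRange (emb v : K →+* v.adicCompletion K) := by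
  rw [emb_eq]
  exact v.denseRange_algebraMap K

lemma abv_le_one_iff (x : K) : HeightOneSpectrum.adicAbv K v x ≤ 1 ↔ v.valuation K x ≤ 1 := by
  rw [HeightOneSpectrum.adicAbv_def]
  have := (WithZeroMulInt.toNNReal_strictMono (HeightOneSpectrum.one_lt_absNorm_nnreal v)).le_iff_le
    (a := v.valuation K x) (b := 1)
  rw [← this, map_one]
  norm_cast

lemma abv_lt_one_iff (x : K) : HeightOneSpectrum.adicAbv K v x < 1 ↔ v.valuation K x < 1 := by
  rw [HeightOneSpectrum.adicAbv_def]
  have := (WithZeroMulInt.toNNReal_strictMono (HeightOneSpectrum.one_lt_absNorm_nnreal v)).lt_iff_lt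
    (a := v.valuation K x) (b := 1)
  rw [← this, map_one]
  norm_cast

lemma abv_eq_one_iff (x : K) : HeightOneSpectrum.adicAbv K v x = 1 ↔ v.valuation K x = 1 := by
  rw [le_antisymm_iff, le_antisymm_iff, abv_le_one_iff, ← not_lt (b := (1:ℝ)), abv_lt_one_iff,
    not_lt]

lemma abv_mono {x y : K} : HeightOneSpectrum.adicAbv K v x ≤ HeightOneSpectrum.adicAbv K v y ↔
    v.valuation K x ≤ v.valuation K y := by
  rw [HeightOneSpectrum.adicAbv_def, HeightOneSpectrum.adicAbv_def]
  have := (WithZeroMulInt.toNNReal_strictMono (HeightOneSpectrum.one_lt_absNorm_nnreal v)).le_iff_le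
    (a := v.valuation K x) (b := v.valuation K y)
  rw [← this]
  norm_cast


/-- the completion as a nontrivially normed field -/
@[reducible] noncomputable def nnf : NontriviallyNormedField (v.adicCompletion K) :=
  Valued.toNontriviallyNormedField (v.adicCompletion K) (WithZero (Multiplicative ℤ))

lemma nnf_toNormedField : (nnf v).toNormedField =
    HeightOneSpectrum.instNormedFieldValuedAdicCompletion K v := rfl

lemma emb_ultra : IsUltrametricDist (v.adicCompletion K) :=
  IsUltrametricDist.isUltrametricDist_of_isNonarchimedean_norm
    (Valued.isNonarchimedean_norm (v.adicCompletion K) (WithZero (Multiplicative ℤ)))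

lemma abv_small {ε : ℝ} (hε : 0 < ε) : ∃ n : ℕ, ∀ a : K, v.valuation K a ≤ WithZero.exp (-(n:ℤ)) →
    HeightOneSpectrum.adicAbv K v a < ε := by
  obtain ⟨π, hπ⟩ := v.valuation_exists_uniformizer K
  have h1 : HeightOneSpectrum.adicAbv K v π < 1 := by
    rw [abv_lt_one_iff, hπ]
    decide
  obtain ⟨n, hn⟩ := exists_pow_lt_of_lt_one hε h1
  refine ⟨n, fun a ha => lt_of_le_of_lt ?_ hn⟩
  rw [← map_pow, abv_mono, map_pow, hπ]
  refine ha.trans (le_of_eq ?_)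
  rw [← WithZero.exp_nsmul]
  simp

lemma val_pow_mem {n : ℕ} {a : 𝓞 K} : a ∈ v.asIdeal ^ n ↔
    v.valuation K (a : K) ≤ WithZero.exp (-(n:ℤ)) := by
  rw [← v.intValuation_le_pow_iff_mem, HeightOneSpectrum.valuation_of_algebraMap]

section abs
variable {F : Type*} [NontriviallyNormedField F] [IsUltrametricDist F]
  (i : K →+* F) (hi : ∀ x, ‖i x‖ = HeightOneSpectrum.adicAbv K v x) (hd : DenseRange i)
include hi hd

lemma approx_int (x : F) (hx : ‖x‖ ≤ 1) {ε : ℝ} (hε : 0 < ε) : ∃ a : 𝓞 K, ‖x - i a‖ < ε := by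
  obtain ⟨n, hn⟩ := abv_small v hε
  obtain ⟨y, hy⟩ := Metric.denseRange_iff.1 hd x (min ε 1) (by positivity)
  rw [dist_eq_norm] at hy
  have hy1 : ‖i y‖ ≤ 1 := by
    have : i y = x + -(x - i y) := by ring
    rw [this]
    refine (IsUltrametricDist.norm_add_le_max _ _).trans (max_le hx ?_)
    rw [norm_neg]
    exact (hy.trans_le (min_le_right _ _)).le
  rw [hi, abv_le_one_iff] at hy1
  obtain ⟨a, ha⟩ := v.exists_valuation_sub_lt_of_integer (K := K) hy1
    (γ := Units.mk0 (WithZero.exp (-(n:ℤ))) (by simp))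
  refine ⟨a, ?_⟩
  have h2 : x - i a = (x - i y) + -(i (a - y)) := by rw [map_sub]; ring
  rw [h2]
  refine (IsUltrametricDist.norm_add_le_max _ _).trans_lt (max_lt ?_ ?_)
  · exact hy.trans_le (min_le_left _ _)
  · rw [norm_neg, hi]
    exact hn _ ha.le

lemma proper_of_dense [CompleteSpace F] : ProperSpace F := by
  have hc : IsCompact (Metric.closedBall (0:F) 1) := by
    refine TotallyBounded.isCompact_of_isClosed ?_ Metric.isClosed_closedBall
    rw [Metric.totallyBounded_iff]
    intro ε hε
    obtain ⟨n, hn⟩ := abv_small v hε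
    have : Finite (𝓞 K ⧸ v.asIdeal ^ n) :=
      Ideal.finiteQuotientOfFreeOfNeBot _ (pow_ne_zero _ v.ne_bot)
    refine ⟨Set.range fun q : 𝓞 K ⧸ v.asIdeal ^ n => i (q.out : 𝓞 K), Set.finite_range _, ?_⟩
    intro x hx
    rw [mem_closedBall_zero_iff] at hx
    obtain ⟨a, ha⟩ := approx_int v i hi hd x hx hε
    simp only [Set.mem_iUnion, Set.mem_range, exists_prop, exists_exists_eq_and, Metric.mem_ball]
    refine ⟨Ideal.Quotient.mk _ a, ?_⟩
    rw [dist_eq_norm]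
    set q := (Ideal.Quotient.mk (v.asIdeal ^ n) a).out with hq
    have h2 : x - i q = (x - i a) + i ((a - q : 𝓞 K) : K) := by push_cast; rw [map_sub]; ring
    rw [h2]
    refine (IsUltrametricDist.norm_add_le_max _ _).trans_lt (max_lt ha ?_)
    rw [hi]
    apply hn
    rw [← val_pow_mem, ← Ideal.Quotient.eq, hq]
    exact (Quotient.out_eq _).symm
  have : LocallyCompactSpace F := hc.locallyCompactSpace_of_mem_nhds_of_addGroup
    (Metric.closedBall_mem_nhds (0:F) one_pos)
  exact ProperSpace.of_nontriviallyNormedField_of_weaklyLocallyCompactSpace F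

end abs

lemma emb_proper : ProperSpace (v.adicCompletion K) := by
  let _ := nnf v
  have := emb_ultra v
  exact proper_of_dense v (emb v) (emb_norm v) (emb_dense v)

lemma emb_charZero : CharZero (v.adicCompletion K) := charZero_of_injective_ringHom (emb v).injective

end Compl
end ABHN
end FileGlob1

section FileGlob2
set_option autoImplicit false
set_option linter.unusedSectionVars false
open scoped TensorProduct
open IsDedekindDomain NumberField

namespace ABHN

section PN
variable {K F : Type*} [Field K] [Field F]

/-- elements of `K` which become `p`-th powers in `F` -/
def PP (p : ℕ) (i : K →+* F) : Subgroup Kˣ :=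
  (powMonoidHom p : Fˣ →* Fˣ).range.comap (Units.map (i : K →* F))

/-- elements of `K` which become norms over `F` -/
def NN {p : ℕ} (hp : p.Prime) (i : K →+* F) (ζ b : K) : Subgroup Kˣ :=
  (normSub p hp.ne_zero (i ζ) (i b)).comap (Units.map (i : K →* F))

lemma mem_PP {p : ℕ} (hp : p ≠ 0) {i : K →+* F} {x : Kˣ} : x ∈ PP p i ↔ ∃ y : F, y ^ p = i x := by
  unfold PP
  rw [Subgroup.mem_comap, MonoidHom.mem_range]
  constructor
  · rintro ⟨y, hy⟩
    refine ⟨y, ?_⟩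
    have := congrArg Units.val hy
    simpa using this
  · rintro ⟨y, hy⟩
    have hy0 : y ≠ 0 := by
      rintro rfl
      rw [zero_pow hp] at hy
      exact x.ne_zero ((map_eq_zero i).1 hy.symm)
    refine ⟨Units.mk0 y hy0, ?_⟩
    ext
    simpa using hy

lemma mem_NN {p : ℕ} {hp : p.Prime} {i : K →+* F} {ζ b : K} {x : Kˣ} :
    x ∈ NN hp i ζ b ↔ NormRes p (i ζ) (i b) (i x) := Iff.rfl

lemma PP_le_NN {p : ℕ} (hp : p.Prime) (i : K →+* F) (ζ b : K) : PP p i ≤ NN hp i ζ b := by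
  intro x hx
  obtain ⟨y, hy⟩ := (mem_PP hp.ne_zero).1 hx
  rw [mem_NN, ← hy]
  exact NormRes.pow_self y

lemma pow_mem_PP {p : ℕ} (i : K →+* F) (x : Kˣ) : x ^ p ∈ PP p i := ⟨Units.map (i : K →* F) x, by simp⟩

lemma NN_top {p : ℕ} (hp : p.Prime) (i : K →+* F) {ζ : K} (hζ : IsPrimitiveRoot ζ p) {b : Kˣ}
    (hb : b ∈ PP p i) : NN hp i ζ b = ⊤ := by
  rw [eq_top_iff]
  intro x _
  obtain ⟨y, hy⟩ := (mem_PP hp.ne_zero).1 hb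
  rw [mem_NN, ← hy]
  apply NormRes.of_pow hp (hζ.map_of_injective i.injective)
  rintro rfl
  rw [zero_pow hp.ne_zero] at hy
  exact b.ne_zero ((map_eq_zero i).1 hy.symm)

end PN

section dense
variable {K F : Type*} [Field K] [NormedField F] {p : ℕ} (i : K →+* F) (hd : DenseRange i)
  (hn : ∃ ε > 0, ∀ x : F, ‖x - 1‖ ≤ ε → ∃ y, y ^ p = x)

include hd hn in
lemma exists_approx_pow (hp : p ≠ 0) (y : Fˣ) :
    ∃ x : Kˣ, Units.map (i : K →* F) x * y⁻¹ ∈ (powMonoidHom p : Fˣ →* Fˣ).range := by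
  obtain ⟨ε, hε, h⟩ := hn
  have hy0 : 0 < ‖(y:F)‖ := norm_pos_iff.2 y.ne_zero
  obtain ⟨x, hx⟩ := Metric.denseRange_iff.1 hd (y:F) (min (ε * ‖(y:F)‖) ‖(y:F)‖) (by positivity)
  rw [dist_eq_norm] at hx
  have hx0 : x ≠ 0 := by
    rintro rfl
    simp at hx
  obtain ⟨z, hz⟩ := h (i x * (y:F)⁻¹) (by
    have : i x * (y:F)⁻¹ - 1 = -(((y:F) - i x) * (y:F)⁻¹) := by
      field_simp
      ring
    rw [this, norm_neg, norm_mul, norm_inv, ← div_eq_mul_inv, div_le_iff₀ hy0]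
    exact (hx.trans_le (min_le_left _ _)).le)
  have hz0 : z ≠ 0 := by
    rintro rfl
    rw [zero_pow hp] at hz
    have : i x ≠ 0 := (map_ne_zero i).2 hx0
    exact mul_ne_zero this (inv_ne_zero y.ne_zero) hz.symm
  refine ⟨Units.mk0 x hx0, Units.mk0 z hz0, ?_⟩
  ext
  simpa using hz

include hd hn in
lemma index_comap_of_dense (hp : p ≠ 0) (H : Subgroup Fˣ)
    (hH : (powMonoidHom p : Fˣ →* Fˣ).range ≤ H) :
    (H.comap (Units.map (i : K →* F))).index = H.index := by
  rw [Subgroup.index_comap, ← Subgroup.relIndex_sup_left, ← Subgroup.relIndex_top_right]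
  congr 1
  rw [eq_top_iff]
  intro y _
  obtain ⟨x, hx⟩ := exists_approx_pow i hd hn hp y
  have h1 : y = (Units.map (i : K →* F) x * y⁻¹)⁻¹ * Units.map (i : K →* F) x := by group
  rw [h1]
  exact Subgroup.mul_mem_sup (inv_mem (hH hx)) ⟨x, rfl⟩

lemma powRange_le_normSub {F : Type*} [Field F] (hp : p ≠ 0) (ζ b : F) :
    (powMonoidHom p : Fˣ →* Fˣ).range ≤ normSub p hp ζ b := by
  rintro _ ⟨y, rfl⟩
  change NormRes p ζ b _
  simpa using NormRes.pow_self (p := p) (ζ := ζ) (b := b) (y : F)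

end dense

section fin
variable {K : Type*} [Field K] [NumberField K] (v : HeightOneSpectrum (𝓞 K)) {p : ℕ} (hp : p.Prime)
  {ζ : K} (hζ : IsPrimitiveRoot ζ p)

lemma fin_near (hp : p ≠ 0) :
    ∃ ε > 0, ∀ x : v.adicCompletion K, ‖x - 1‖ ≤ ε → ∃ y, y ^ p = x := by
  let _ := nnf v
  have := emb_ultra v
  have := emb_proper v
  have := emb_charZero v
  exact near_one_is_pow (F := v.adicCompletion K) p hp

include hζ in
lemma fin_NN_index {b : Kˣ} (hb : b ∉ PP p (emb v)) : (NN hp (emb v) ζ b).index = p := by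
  unfold NN
  rw [index_comap_of_dense (emb v) (emb_dense v) (fin_near v hp.ne_zero) hp.ne_zero _
    (powRange_le_normSub _ _ _)]
  let _ := nnf v
  have := emb_ultra v
  have := emb_proper v
  have := emb_charZero v
  exact local_norm_index (F := v.adicCompletion K) hp (hζ.map_of_injective (emb v).injective)
    fun c hc => hb ((mem_PP hp.ne_zero).2 ⟨c, hc⟩)

/-- index of `p` at `v` -/
noncomputable def mv (p : ℕ) : ℕ :=
  let _ := emb_ultra v
  (ballAdd (v.adicCompletion K) ‖(p : v.adicCompletion K)‖ (norm_nonneg _)).relIndex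
    (ballAdd (v.adicCompletion K) 1 zero_le_one)

include hp hζ in
lemma fin_PP_index : (PP p (emb v)).index = p ^ 2 * mv v p := by
  unfold PP
  rw [index_comap_of_dense (emb v) (emb_dense v) (fin_near v hp.ne_zero) hp.ne_zero _ le_rfl]
  let _ := nnf v
  have := emb_ultra v
  have := emb_proper v
  have := emb_charZero v
  exact local_pow_index (F := v.adicCompletion K) hp (hζ.map_of_injective (emb v).injective)

lemma emb_norm_p (hvp : v.valuation K (p : K) = 1) : ‖(p : v.adicCompletion K)‖ = 1 := by
  rw [← map_natCast (emb v), emb_norm, abv_eq_one_iff, hvp]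

include hp hζ in
lemma fin_tame_units (hvp : v.valuation K (p : K) = 1) {y u : Kˣ} (hy : v.valuation K (y:K) = 1)
    (hu : v.valuation K (u:K) = 1) (hyp : y ∉ PP p (emb v)) :
    ∃ j : ℕ, u * (y ^ j)⁻¹ ∈ PP p (emb v) := by
  have hp1 := emb_norm_p v hvp
  have hy' : ‖emb v y‖ = 1 := by rwa [emb_norm, abv_eq_one_iff]
  have hu' : ‖emb v u‖ = 1 := by rwa [emb_norm, abv_eq_one_iff]
  let _ := nnf v
  have := emb_ultra v
  have := emb_proper v
  have := emb_charZero v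
  obtain ⟨j, w, h⟩ := tame_units (F := v.adicCompletion K) hp (hζ.map_of_injective (emb v).injective)
    hp1 hy' hu' fun c hc => hyp ((mem_PP hp.ne_zero).2 ⟨c, hc⟩)
  refine ⟨j, (mem_PP hp.ne_zero).2 ⟨w, ?_⟩⟩
  have h0 : emb v (y:K) ≠ 0 := (map_ne_zero _).2 y.ne_zero
  push_cast
  rw [map_mul, map_inv₀, map_pow, h]
  field_simp

include hζ in
lemma fin_tame_norm (hvp : v.valuation K (p : K) = 1) {x u : Kˣ} (hx : v.valuation K (x:K) = 1)
    (hu : v.valuation K (u:K) = 1) : u ∈ NN hp (emb v) ζ x := by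
  have hp1 := emb_norm_p v hvp
  have hx' : ‖emb v x‖ = 1 := by rwa [emb_norm, abv_eq_one_iff]
  have hu' : ‖emb v u‖ = 1 := by rwa [emb_norm, abv_eq_one_iff]
  let _ := nnf v
  have := emb_ultra v
  have := emb_proper v
  have := emb_charZero v
  exact tame_norm (F := v.adicCompletion K) hp (hζ.map_of_injective (emb v).injective) hp1 hx' hu'

end fin

section real
variable {K : Type*} [Field K] [NumberField K] (τ : K →+* ℝ) {p : ℕ} (hp : p.Prime)
  {ζ : K} (hζ : IsPrimitiveRoot ζ p)

lemma real_pos_pow (hp : p ≠ 0) {x : ℝ} (hx : 0 ≤ x) : ∃ y, y ^ p = x :=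
  ⟨x ^ ((p:ℝ)⁻¹), Real.rpow_inv_natCast_pow hx hp⟩

lemma real_near (hp : p ≠ 0) :
    ∃ ε > 0, ∀ x : ℝ, ‖x - 1‖ ≤ ε → ∃ y, y ^ p = x := by
  refine ⟨1/2, by norm_num, fun x hx => real_pos_pow hp ?_⟩
  rw [Real.norm_eq_abs, abs_le] at hx
  linarith

lemma real_dense : DenseRange τ := by
  have : DenseRange ((↑) : ℚ → ℝ) := Rat.denseRange_cast
  refine this.mono ?_
  rintro _ ⟨q, rfl⟩
  exact ⟨q, by simp⟩

lemma real_pow_index (hp : p.Prime) : (powMonoidHom p : ℝˣ →* ℝˣ).range.index ≤ 2 ∧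
    (powMonoidHom p : ℝˣ →* ℝˣ).range.index ≠ 0 := by
  set H := (powMonoidHom p : ℝˣ →* ℝˣ).range with hH
  have hpos : ∀ x : ℝˣ, 0 ≤ (x:ℝ) → x ∈ H := by
    intro x hx
    obtain ⟨y, hy⟩ := real_pos_pow hp.ne_zero hx
    have hy0 : y ≠ 0 := by
      rintro rfl
      rw [zero_pow hp.ne_zero] at hy
      exact x.ne_zero hy.symm
    refine ⟨Units.mk0 y hy0, ?_⟩
    ext
    simpa using hy
  let f : Bool → ℝˣ ⧸ H := fun c => if c then 1 else ((-1 : ℝˣ) : ℝˣ ⧸ H)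
  have hf : Function.Surjective f := by
    intro q
    obtain ⟨x, rfl⟩ := QuotientGroup.mk_surjective q
    rcases le_total 0 (x:ℝ) with h | h
    · refine ⟨true, ?_⟩
      simp only [f, if_true]
      exact ((QuotientGroup.eq_one_iff x).2 (hpos x h)).symm
    · refine ⟨false, ?_⟩
      simp only [f]
      simp only [Bool.false_eq_true, if_false]
      rw [QuotientGroup.eq]
      apply hpos
      simpa using h
  have : Finite (ℝˣ ⧸ H) := Finite.of_surjective f hf
  refine ⟨?_, ?_⟩
  · have := Nat.card_le_card_of_surjective f hf
    simpa [Subgroup.index] using this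
  · exact Subgroup.index_ne_zero_of_finite

include hp in
lemma real_PP_index : (PP p τ).index ≤ p ∧ (PP p τ).index ≠ 0 := by
  unfold PP
  rw [index_comap_of_dense τ (real_dense τ) (real_near hp.ne_zero) hp.ne_zero _ le_rfl]
  obtain ⟨h1, h2⟩ := real_pow_index hp
  exact ⟨h1.trans hp.two_le, h2⟩

lemma real_not_normRes {b : ℝ} (hb : b ≤ 0) : ¬ NormRes 2 (-1 : ℝ) b (-1) := by
  rintro ⟨f, hf⟩
  let z : ℂ := Complex.I * (Real.sqrt (-b) : ℂ)
  have hz2 : z ^ 2 = (b : ℂ) := by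
    simp only [z]
    rw [mul_pow, Complex.I_sq, ← Complex.ofReal_pow, Real.sq_sqrt (by linarith)]
    simp
  have hzc : (starRingEnd ℂ) z = - z := by
    simp [z]
  have h1 : ∀ g : Polynomial ℝ, (Polynomial.X ^ 2 - Polynomial.C b) ∣ g → Polynomial.aeval z g = 0 := by
    rintro g ⟨q, rfl⟩
    simp [hz2]
  have h2 := h1 _ hf
  simp only [Finset.prod_range_succ, Finset.prod_range_zero, one_mul, pow_zero, pow_one, map_one,
    Polynomial.comp_X, map_sub, map_mul, Polynomial.aeval_C, Polynomial.aeval_comp,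
    Polynomial.aeval_X] at h2
  have h3 : Polynomial.aeval (-z) f = (starRingEnd ℂ) (Polynomial.aeval z f) := by
    rw [← hzc]
    exact Polynomial.aeval_conj f z
  have h4 : (algebraMap ℝ ℂ) (-1) * z = - z := by simp
  rw [h4, h3, Complex.mul_conj] at h2
  have h5 := congrArg Complex.re h2
  simp at h5
  have := Complex.normSq_nonneg ((Polynomial.aeval z) f)
  linarith

include hζ in
lemma real_NN_index {b : Kˣ} (hb : b ∉ PP p τ) : p ≤ (NN hp τ ζ b).index := by
  unfold NN
  rw [index_comap_of_dense τ (real_dense τ) (real_near hp.ne_zero) hp.ne_zero _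
    (powRange_le_normSub _ _ _)]
  have hb' : ∀ y, y ^ p ≠ τ b := fun y hy => hb ((mem_PP hp.ne_zero).2 ⟨y, hy⟩)
  have hneg : τ b < 0 := by
    by_contra h
    push Not at h
    obtain ⟨y, hy⟩ := real_pos_pow hp.ne_zero h
    exact hb' y hy
  have hp2 : p = 2 := by
    by_contra h2
    have hodd := hp.odd_of_ne_two h2
    obtain ⟨y, hy⟩ := real_pos_pow hp.ne_zero (x := - τ b) (by linarith)
    apply hb' (-y)
    rw [hodd.neg_pow, hy, neg_neg]
  subst hp2
  have hζ' : ζ = -1 := hζ.eq_neg_one_of_two_right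
  have h0 : (normSub 2 hp.ne_zero (τ ζ) (τ b)).index ≠ 0 := fun h => (real_pow_index hp).2
    (Nat.eq_zero_of_zero_dvd (h ▸ Subgroup.index_dvd_of_le (powRange_le_normSub hp.ne_zero (τ ζ) (τ b))))
  have h1 : (normSub 2 hp.ne_zero (τ ζ) (τ b)).index ≠ 1 := by
    intro h
    rw [Subgroup.index_eq_one] at h
    have h2 : (-1 : ℝˣ) ∈ normSub 2 hp.ne_zero (τ ζ) (τ b) := h ▸ Subgroup.mem_top _
    have h3 : NormRes 2 (τ ζ) (τ b) (-1) := h2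
    rw [hζ', map_neg, map_one] at h3
    exact real_not_normRes hneg.le h3
  lia

end real

/-- places: finite and real -/
abbrev Pl (K : Type*) [Field K] [NumberField K] := HeightOneSpectrum (𝓞 K) ⊕ (K →+* ℝ)

section pl
variable {K : Type*} [Field K] [NumberField K]

/-- absolute value -/
noncomputable def absv : Pl K → AbsoluteValue K ℝ
  | .inl v => HeightOneSpectrum.adicAbv K v
  | .inr τ => NumberField.place τ

/-- local p-th powers -/
noncomputable def PPl (p : ℕ) : Pl K → Subgroup Kˣ
  | .inl v => PP p (emb v)
  | .inr τ => PP p τ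

/-- local norms -/
noncomputable def NPl {p : ℕ} (hp : p.Prime) (ζ b : K) : Pl K → Subgroup Kˣ
  | .inl v => NN hp (emb v) ζ b
  | .inr τ => NN hp τ ζ b

variable {p : ℕ} (hp : p.Prime) {ζ : K} (hζ : IsPrimitiveRoot ζ p)

lemma PPl_le_NPl (b : K) (v : Pl K) : PPl p v ≤ NPl hp ζ b v := by
  cases v
  · exact PP_le_NN hp _ _ _
  · exact PP_le_NN hp _ _ _

include hζ in
lemma NPl_top {b : Kˣ} {v : Pl K} (hb : b ∈ PPl p v) : NPl hp ζ b v = ⊤ := by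
  cases v
  · exact NN_top hp _ hζ hb
  · exact NN_top hp _ hζ hb

include hζ in
lemma NPl_index {b : Kˣ} {v : Pl K} (hb : b ∉ PPl p v) : p ≤ (NPl hp ζ b v).index := by
  cases v with
  | inl v => exact (fin_NN_index v hp hζ hb).ge
  | inr v => exact real_NN_index v hp hζ hb

lemma PPl_open (hp : p ≠ 0) (v : Pl K) : ∃ ε > 0, ∀ x : Kˣ, absv v (x - 1) ≤ ε → x ∈ PPl p v := by
  cases v with
  | inl v =>
    obtain ⟨ε, hε, h⟩ := fin_near v hp
    refine ⟨ε, hε, fun x hx => (mem_PP hp).2 (h _ ?_)⟩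
    rw [← map_one (emb v), ← map_sub, emb_norm]
    exact hx
  | inr τ =>
    obtain ⟨ε, hε, h⟩ := real_near hp
    refine ⟨ε, hε, fun x hx => (mem_PP hp).2 (h _ ?_)⟩
    rw [← map_one τ, ← map_sub]
    exact hx

lemma absv_nontrivial (v : Pl K) : (absv v).IsNontrivial := by
  cases v with
  | inl v =>
    obtain ⟨π, hπ⟩ := v.valuation_exists_uniformizer K
    refine ⟨π, ?_, ?_⟩
    · rintro rfl
      rw [map_zero] at hπ
      exact WithZero.exp_ne_zero hπ.symm
    · apply ne_of_lt
      change HeightOneSpectrum.adicAbv K v π < 1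
      rw [abv_lt_one_iff, hπ]
      decide
  | inr τ =>
    refine ⟨2, by norm_num, ?_⟩
    change ‖τ 2‖ ≠ 1
    rw [map_ofNat]
    norm_num

lemma absv_inequiv : Pairwise fun v w : Pl K => ¬ (absv v).IsEquiv (absv w) := by
  have h2 : ∀ (v : HeightOneSpectrum (𝓞 K)) (τ : K →+* ℝ),
      ¬ (absv (.inl v : Pl K)).IsEquiv (absv (.inr τ)) := by
    intro v τ h
    have h1 := (h.le_one_iff (x := (2 : K))).1 (by
      exact_mod_cast HeightOneSpectrum.adicAbv_natCast_le_one K v 2)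
    change ‖τ 2‖ ≤ 1 at h1
    rw [map_ofNat] at h1
    norm_num at h1
  rintro (v | v) (w | w) hvw h
  · have h1 : v ≠ w := fun h => hvw (by rw [h])
    apply h1
    apply HeightOneSpectrum.eq_of_valuation_isEquiv_valuation (K := K)
    intro x y
    rw [← abv_mono, ← abv_mono]
    exact h x y
  · exact h2 v w h
  · exact h2 w v h.symm
  · apply hvw
    have h1 : InfinitePlace.mk (Complex.ofRealHom.comp v) = InfinitePlace.mk (Complex.ofRealHom.comp w) := by
      rw [InfinitePlace.eq_iff_isEquiv]
      intro x y
      have := h x y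
      change ‖v x‖ ≤ ‖v y‖ ↔ ‖w x‖ ≤ ‖w y‖ at this
      change ‖(v x : ℂ)‖ ≤ ‖(v y : ℂ)‖ ↔ ‖(w x : ℂ)‖ ≤ ‖(w y : ℂ)‖
      simpa [Complex.norm_real] using this
    rw [InfinitePlace.mk_eq_iff] at h1
    congr 1
    ext x
    rcases h1 with h1 | h1
    · have := congrArg Complex.re (RingHom.congr_fun h1 x)
      simpa using this
    · have := congrArg Complex.re (RingHom.congr_fun h1 x)
      simpa [ComplexEmbedding.conjugate] using this

/-- weak approximation -/
lemma weak_approx (W : Finset (Pl K)) (a : Pl K → K) {ε : ℝ} (hε : 0 < ε) :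
    ∃ x : K, ∀ v ∈ W, absv v (x - a v) < ε := by
  have h := AbsoluteValue.denseRange_algebraMap_pi (v := fun v : W => absv (v : Pl K))
    (fun v => absv_nontrivial _) (fun v w hvw => absv_inequiv (fun h => hvw (Subtype.ext h)))
  obtain ⟨x, hx⟩ := Metric.denseRange_iff.1 h (fun v => WithAbs.toAbs _ (a v)) ε hε
  refine ⟨x, fun v hv => ?_⟩
  rw [dist_pi_lt_iff hε] at hx
  have := hx ⟨v, hv⟩
  rw [dist_comm, dist_eq_norm] at this
  exact this

end pl
end ABHN
end FileGlob2

section FileGlob3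
set_option autoImplicit false
set_option linter.unusedSectionVars false
open scoped TensorProduct
open IsDedekindDomain NumberField

namespace ABHN

section pl
variable {K : Type*} [Field K] [NumberField K] {p : ℕ}

lemma wa_split (hp : p ≠ 0) (W : Finset (Pl K)) (v : Pl K) (hv : v ∉ W) (x : Kˣ) :
    ∃ y : Kˣ, (∀ w ∈ W, y ∈ PPl p w) ∧ x * y⁻¹ ∈ PPl p v := by
  classical
  choose ε hε h using fun v : Pl K => PPl_open (K := K) (p := p) hp v
  have hxv : 0 < absv v (x:K) := (absv v).pos x.ne_zero
  have hεv := hε v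
  obtain ⟨δ, hδ, hδv, hδw⟩ : ∃ δ : ℝ, 0 < δ ∧ δ ≤ min (ε v) (1/2) * absv v (x:K) ∧
      ∀ w ∈ W, δ ≤ ε w := by
    have h1 : ∃ δ : ℝ, 0 < δ ∧ ∀ w ∈ W, δ ≤ ε w := by
      rcases W.eq_empty_or_nonempty with rfl | hW
      · exact ⟨1, one_pos, by simp⟩
      · exact ⟨W.inf' hW ε, (Finset.lt_inf'_iff hW).2 fun w _ => hε w, fun w hw => Finset.inf'_le _ hw⟩
    obtain ⟨δ, hδ, h1⟩ := h1
    refine ⟨min δ (min (ε v) (1/2) * absv v (x:K)), by positivity, ?_, ?_⟩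
    · exact min_le_right _ _
    · exact fun w hw => (min_le_left _ _).trans (h1 w hw)
  obtain ⟨y, hy⟩ := weak_approx (insert v W) (fun w => if w = v then (x:K) else 1) hδ
  have hyv := hy v (Finset.mem_insert_self _ _)
  rw [if_pos rfl] at hyv
  have hyw : ∀ w ∈ W, absv w (y - 1) < δ := by
    intro w hw
    have := hy w (Finset.mem_insert_of_mem hw)
    rwa [if_neg] at this
    rintro rfl
    exact hv hw
  have hy0 : y ≠ 0 := by
    rintro rfl
    rw [zero_sub, AbsoluteValue.map_neg] at hyv
    have := min_le_right (ε v) (1/2)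
    nlinarith
  refine ⟨Units.mk0 y hy0, fun w hw => h w _ ?_, ?_⟩
  · exact (hyw w hw).le.trans (hδw w hw)
  · have : x * (Units.mk0 y hy0)⁻¹ = (Units.mk0 y hy0 * x⁻¹)⁻¹ := by group
    rw [this]
    refine inv_mem (h v _ ?_)
    have h3 : ((Units.mk0 y hy0 * x⁻¹ : Kˣ) : K) - 1 = (y - x) * (x:K)⁻¹ := by
      have := x.ne_zero
      push_cast
      simp only [Units.val_mk0]
      field_simp
    rw [h3, map_mul, map_inv₀, ← div_eq_mul_inv, div_le_iff₀ hxv]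
    refine (hyv.le.trans hδv).trans ?_
    gcongr
    exact min_le_left _ _

lemma index_inf_of_sup {G : Type*} [CommGroup G] (A B : Subgroup G) (h : A ⊔ B = ⊤) :
    (A ⊓ B).index = A.index * B.index := by
  rw [← Subgroup.relIndex_mul_index (inf_le_right : A ⊓ B ≤ B), Subgroup.inf_relIndex_right,
    ← Subgroup.relIndex_sup_left, h, Subgroup.relIndex_top_right]

/-- weak approximation, index form -/
lemma wa_index (hp : p ≠ 0) (H : Pl K → Subgroup Kˣ) (hH : ∀ v, PPl p v ≤ H v) (W : Finset (Pl K)) :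
    (⨅ v ∈ W, H v).index = ∏ v ∈ W, (H v).index := by
  classical
  induction W using Finset.induction_on with
  | empty => simp
  | insert v W hv ih =>
    rw [Finset.iInf_insert, Finset.prod_insert hv, ← ih]
    apply index_inf_of_sup
    rw [eq_top_iff]
    intro x _
    obtain ⟨y, hy, hxy⟩ := wa_split hp W v hv x
    have : x = (x * y⁻¹) * y := by group
    rw [this]
    refine Subgroup.mul_mem_sup (hH v hxy) ?_
    simp only [Subgroup.mem_iInf]
    exact fun w hw => hH w (hy w hw)

noncomputable instance instFintypeReal : Fintype (K →+* ℝ) :=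
  Fintype.ofInjective (fun τ : K →+* ℝ => (Complex.ofRealHom.comp τ : K →+* ℂ)) (by
    intro τ τ' h
    ext x
    have := RingHom.congr_fun h x
    simpa using this)

/-- the finite set of places consisting of S and the real places -/
noncomputable def SR (S : Finset (HeightOneSpectrum (𝓞 K))) : Finset (Pl K) := S.disjSum Finset.univ

lemma mem_SR_inl {S : Finset (HeightOneSpectrum (𝓞 K))} {v} : (Sum.inl v : Pl K) ∈ SR S ↔ v ∈ S := by
  simp [SR]

lemma mem_SR_inr {S : Finset (HeightOneSpectrum (𝓞 K))} {τ} : (Sum.inr τ : Pl K) ∈ SR S := by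
  simp [SR]

/-- S-local p-th powers -/
noncomputable def PS (p : ℕ) (S : Finset (HeightOneSpectrum (𝓞 K))) : Subgroup Kˣ := ⨅ v ∈ SR S, PPl p v
/-- S-local norms -/
noncomputable def NS {p : ℕ} (hp : p.Prime) (ζ b : K) (S : Finset (HeightOneSpectrum (𝓞 K))) : Subgroup Kˣ :=
  ⨅ v ∈ SR S, NPl hp ζ b v

/-- number of nonsplit places -/
noncomputable def nsp (p : ℕ) (b : Kˣ) (S : Finset (HeightOneSpectrum (𝓞 K))) : ℕ :=
  by classical exact ((SR S).filter (fun v => b ∉ PPl p v)).card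

lemma NS_index (hp : p.Prime) {ζ : K} (hζ : IsPrimitiveRoot ζ p) (b : Kˣ) (S) :
    p ^ nsp p b S ≤ (NS hp ζ b S).index := by
  classical
  unfold NS nsp
  rw [wa_index hp.ne_zero _ (PPl_le_NPl hp (ζ := ζ) (b : K))]
  rw [← Finset.prod_filter_mul_prod_filter_not (SR S) (fun v => b ∉ PPl p v)]
  have h1 : ∏ v ∈ (SR S).filter (fun v => ¬ b ∉ PPl p v), (NPl hp ζ b v).index = 1 := by
    apply Finset.prod_eq_one
    intro v hv
    have : b ∈ PPl p v := by simpa using (Finset.mem_filter.1 hv).2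
    rw [NPl_top hp hζ this, Subgroup.index_top]
  rw [h1, mul_one]
  apply Finset.pow_card_le_prod
  intro v hv
  exact NPl_index hp hζ (Finset.mem_filter.1 hv).2

lemma mv_le {p : ℕ} (hp : p ≠ 0) (v : HeightOneSpectrum (𝓞 K)) :
    mv v p ≤ Ideal.absNorm (v.maxPowDividing (Ideal.span {(p : 𝓞 K)})) ∧ mv v p ≠ 0 := by
  have hp0 : (p : 𝓞 K) ≠ 0 := by exact_mod_cast hp
  have := emb_ultra v
  unfold mv HeightOneSpectrum.maxPowDividing
  set e := (Associates.mk v.asIdeal).count (Associates.mk (Ideal.span {(p : 𝓞 K)})).factors with he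
  have hpe : v.valuation K (p : K) = WithZero.exp (-(e:ℤ)) := by
    have := v.intValuation_if_neg hp0
    rw [← he, ← v.valuation_of_algebraMap (K := K)] at this
    simpa using this
  have hnp : ‖(p : v.adicCompletion K)‖ = HeightOneSpectrum.adicAbv K v (p : K) := by
    rw [← map_natCast (emb v), emb_norm]
  have hmem : ∀ a : 𝓞 K, a ∈ v.asIdeal ^ e → ‖emb v (a:K)‖ ≤ ‖(p : v.adicCompletion K)‖ := by
    intro a ha
    rw [hnp, emb_norm, abv_mono, hpe, ← val_pow_mem]
    exact ha
  have hpos : 0 < ‖(p : v.adicCompletion K)‖ := by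
    rw [hnp]
    exact (HeightOneSpectrum.adicAbv K v).pos (by exact_mod_cast hp)
  have hintg : ∀ a : 𝓞 K, emb v (a:K) ∈ ballAdd (v.adicCompletion K) 1 zero_le_one := by
    intro a
    rw [mem_ballAdd, emb_norm, abv_le_one_iff]
    exact v.valuation_le_one a
  have : Finite (𝓞 K ⧸ v.asIdeal ^ e) :=
      Ideal.finiteQuotientOfFreeOfNeBot _ (pow_ne_zero _ v.ne_bot)
  rw [Ideal.absNorm_apply, Submodule.cardQuot_apply]
  unfold AddSubgroup.relIndex AddSubgroup.index
  suffices hsur : Function.Surjective (fun q : 𝓞 K ⧸ v.asIdeal ^ e =>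
    (QuotientAddGroup.mk (⟨emb v (q.out : 𝓞 K), hintg _⟩ : ballAdd (v.adicCompletion K) 1 zero_le_one) :
      _ ⧸ (ballAdd (v.adicCompletion K) ‖(p : v.adicCompletion K)‖ (norm_nonneg _)).addSubgroupOf
        (ballAdd (v.adicCompletion K) 1 zero_le_one))) by
    have := Finite.of_surjective _ hsur
    exact ⟨Nat.card_le_card_of_surjective _ hsur, Nat.card_pos.ne'⟩
  intro q
  obtain ⟨⟨x, hx⟩, rfl⟩ := QuotientAddGroup.mk_surjective q
  obtain ⟨a, ha⟩ : ∃ a : 𝓞 K, ‖x - emb v a‖ < ‖(p : v.adicCompletion K)‖ := by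
    let _ := nnf v
    exact approx_int v (emb v) (emb_norm v) (emb_dense v) x hx hpos
  refine ⟨Ideal.Quotient.mk _ a, ?_⟩
  rw [QuotientAddGroup.eq, AddSubgroup.mem_addSubgroupOf, mem_ballAdd]
  set r := (Ideal.Quotient.mk (v.asIdeal ^ e) a).out with hr
  have h1 : a - r ∈ v.asIdeal ^ e := by
    rw [← Ideal.Quotient.eq, hr]
    exact (Quotient.out_eq _).symm
  have h2 := hmem _ h1
  have h3 : -(emb v (r:K)) + x = (x - emb v a) + emb v ((a - r : 𝓞 K) : K) := by
    push_cast
    rw [map_sub]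
    ring
  change ‖-(emb v (r:K)) + x‖ ≤ _
  rw [h3]
  exact (IsUltrametricDist.norm_add_le_max _ _).trans (max_le ha.le h2)

lemma prod_mv_le (hp : p ≠ 0) (S : Finset (HeightOneSpectrum (𝓞 K))) :
    ∏ v ∈ S, mv v p ≤ p ^ Module.finrank ℚ K := by
  have hp0 : (p : 𝓞 K) ≠ 0 := by exact_mod_cast hp
  have hI : Ideal.span {(p : 𝓞 K)} ≠ 0 := by simpa using hp
  have h1 : ∏ v ∈ S, v.maxPowDividing (Ideal.span {(p : 𝓞 K)}) ∣ Ideal.span {(p : 𝓞 K)} := by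
    classical
    have h2 := Ideal.finprod_heightOneSpectrum_factorization hI
    rw [finprod_eq_prod_of_mulSupport_subset (s := S ∪ (Ideal.hasFiniteMulSupport hI).toFinset) _
      (fun v hv => Finset.mem_coe.2 (Finset.mem_union_right _ ((Set.Finite.mem_toFinset _).2 hv)))] at h2
    conv_rhs => rw [← h2]
    exact Finset.prod_dvd_prod_of_subset _ _ _ Finset.subset_union_left
  calc ∏ v ∈ S, mv v p ≤ ∏ v ∈ S, Ideal.absNorm (v.maxPowDividing (Ideal.span {(p : 𝓞 K)})) :=
        Finset.prod_le_prod' fun v _ => (mv_le hp v).1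
    _ = Ideal.absNorm (∏ v ∈ S, v.maxPowDividing (Ideal.span {(p : 𝓞 K)})) := by rw [map_prod]
    _ ≤ Ideal.absNorm (Ideal.span {(p : 𝓞 K)}) :=
        Nat.le_of_dvd (Nat.pos_of_ne_zero (by simpa using hp)) (map_dvd _ h1)
    _ = p ^ Module.finrank ℚ K := by
        rw [Ideal.absNorm_span_natCast, RingOfIntegers.rank]

/-- the infinite place attached to a real embedding -/
noncomputable def rpl (τ : K →+* ℝ) : InfinitePlace K := InfinitePlace.mk (Complex.ofRealHom.comp τ)

lemma rpl_real (τ : K →+* ℝ) : (rpl τ).IsReal := by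
  rw [InfinitePlace.isReal_iff, rpl]
  have : ComplexEmbedding.IsReal (Complex.ofRealHom.comp τ) := by
    ext x
    simp
  rwa [InfinitePlace.embedding_mk_eq_of_isReal this]

lemma rpl_inj : Function.Injective (rpl (K := K)) := by
  intro τ τ' h
  rw [rpl, rpl, InfinitePlace.mk_eq_iff] at h
  ext x
  rcases h with h | h
  · have := RingHom.congr_fun h x
    simpa using this
  · have := RingHom.congr_fun h x
    simpa using this

lemma rpl_surj (w : InfinitePlace K) (hw : w.IsReal) : ∃ τ, rpl τ = w := by
  refine ⟨InfinitePlace.embedding_of_isReal hw, ?_⟩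
  rw [rpl]
  conv_rhs => rw [← InfinitePlace.mk_embedding w]
  congr 1
  ext x
  simp

lemma card_real_le : Fintype.card (K →+* ℝ) ≤ InfinitePlace.nrRealPlaces K := by
  classical
  exact Fintype.card_le_of_injective (fun τ => (⟨rpl τ, rpl_real τ⟩ : {w : InfinitePlace K // w.IsReal}))
    fun τ τ' h => rpl_inj (congrArg Subtype.val h)

lemma PS_index (hp : p.Prime) {ζ : K} (hζ : IsPrimitiveRoot ζ p) (S) :
    (PS p S).index ≤ p ^ (2 * (S.card + Fintype.card (InfinitePlace K))) ∧ (PS p (K := K) S).index ≠ 0 := by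
  classical
  unfold PS
  rw [wa_index hp.ne_zero _ (fun v => le_rfl)]
  unfold SR
  rw [Finset.prod_disjSum]
  have h1 : ∏ v ∈ S, (PPl p (Sum.inl v : Pl K)).index = p ^ (2 * S.card) * ∏ v ∈ S, mv v p := by
    rw [pow_mul, ← Finset.prod_const, ← Finset.prod_mul_distrib]
    exact Finset.prod_congr rfl fun v _ => fin_PP_index v hp hζ
  have h2 : ∏ τ : K →+* ℝ, (PPl p (Sum.inr τ : Pl K)).index ≤ p ^ InfinitePlace.nrRealPlaces K := by
    refine (Finset.prod_le_pow_card _ _ p fun τ _ => (real_PP_index τ hp).1).trans ?_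
    exact Nat.pow_le_pow_right hp.pos card_real_le
  refine ⟨?_, ?_⟩
  · rw [h1]
    calc _ ≤ p ^ (2 * S.card) * p ^ Module.finrank ℚ K * p ^ InfinitePlace.nrRealPlaces K := by
          gcongr
          exact prod_mv_le hp.ne_zero S
      _ = _ := by
          rw [← pow_add, ← pow_add, ← InfinitePlace.card_add_two_mul_card_eq_rank,
            InfinitePlace.card_eq_nrRealPlaces_add_nrComplexPlaces]
          congr 1
          ring
  · rw [h1]
    refine mul_ne_zero (mul_ne_zero (pow_ne_zero _ hp.ne_zero) ?_) ?_
    · exact Finset.prod_ne_zero_iff.2 fun v _ => (mv_le hp.ne_zero v).2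
    · exact Finset.prod_ne_zero_iff.2 fun τ _ => (real_PP_index τ hp).2

end pl
end ABHN
end FileGlob3

section FileGlob4
set_option autoImplicit false
set_option linter.unusedSectionVars false
open scoped TensorProduct
open IsDedekindDomain NumberField

namespace ABHN

section su
variable {K : Type*} [Field K] [NumberField K] {p : ℕ}

/-- S-units -/
def US (S : Finset (HeightOneSpectrum (𝓞 K))) : Subgroup Kˣ where
  carrier := {x | ∀ v ∉ S, v.valuation K (x : K) = 1}
  mul_mem' := by
    intro x y hx hy v hv
    rw [Units.val_mul, map_mul, hx v hv, hy v hv, one_mul]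
  one_mem' := by
    intro v _
    simp
  inv_mem' := by
    intro x hx v hv
    rw [Units.val_inv_eq_inv_val, map_inv₀, hx v hv, inv_one]

lemma mem_US {S : Finset (HeightOneSpectrum (𝓞 K))} {x : Kˣ} :
    x ∈ US S ↔ ∀ v ∉ S, v.valuation K (x : K) = 1 := Iff.rfl

lemma US_mono {S T : Finset (HeightOneSpectrum (𝓞 K))} (h : S ⊆ T) : US S ≤ US T :=
  fun _ hx v hv => hx v fun hh => hv (h hh)

lemma finite_supp (x : Kˣ) : {v : HeightOneSpectrum (𝓞 K) | v.valuation K (x : K) ≠ 1}.Finite := by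
  refine ((HeightOneSpectrum.Support.finite (𝓞 K) (x:K)).union
    (HeightOneSpectrum.Support.finite (𝓞 K) ((x:K)⁻¹))).subset ?_
  intro v hv
  rcases lt_or_gt_of_ne hv with h | h
  · right
    change 1 < v.valuation K ((x:K)⁻¹)
    rw [map_inv₀]
    exact (one_lt_inv₀ (zero_lt_iff.2 ((Valuation.ne_zero_iff _).2 x.ne_zero))).2 h
  · left
    exact h

lemma vnz_eq_one {v : HeightOneSpectrum (𝓞 K)} {x : Kˣ} :
    v.valuationOfNeZero x = 1 ↔ v.valuation K (x : K) = 1 := by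
  rw [← HeightOneSpectrum.valuationOfNeZero_eq]
  exact WithZero.coe_inj.symm

lemma HasQ_of_basis (hp : p ≠ 0) {G : Type*} [CommGroup G] {n : ℕ} (b : Module.Basis (Fin n) ℤ (Additive G)) :
    HasQ p G ((p : ℚ) ^ n) := by
  let e := b.equivFun.toAddEquiv
  let e1 : G ≃* (Fin n → Multiplicative ℤ) :=
      { toFun := fun x i => Multiplicative.ofAdd (e (Additive.ofMul x) i)
        invFun := fun y => (e.symm (fun i => (y i).toAdd)).toMul
        left_inv := fun x => by
          change (e.symm (e (Additive.ofMul x))).toMul = x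
          rw [e.symm_apply_apply]; rfl
        right_inv := fun y => by
          funext i
          change Multiplicative.ofAdd (e (e.symm (fun i => (y i).toAdd)) i) = y i
          rw [e.apply_symm_apply]; rfl
        map_mul' := fun x y => by
          funext i
          change Multiplicative.ofAdd (e (Additive.ofMul x + Additive.ofMul y) i) = _
          rw [map_add]; rfl }
  exact HasQ.congr e1.symm (HasQ.pi (HasQ.int hp) _)

lemma HasQ_of_quot {G : Type*} [CommGroup G] (H : Subgroup G) [Finite H] {r : ℚ}
    (h : HasQ p (G ⧸ H) r) : HasQ p G r := by
  have h2 : HasQ p (QuotientGroup.mk' H).ker 1 := by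
    rw [QuotientGroup.ker_mk']
    exact HasQ.of_finite p _
  have h3 := HasQ.of_ker_quot _ (QuotientGroup.mk'_surjective H) h2 h
  rwa [one_mul] at h3

lemma HasQ_units (hp : p ≠ 0) :
    HasQ p ((𝓞 K)ˣ) (p ^ (Fintype.card (InfinitePlace K) - 1)) := by
  have h := HasQ_of_basis hp (Units.basisModTorsion K)
  exact HasQ_of_quot (Units.torsion K) h

lemma HasQ_US_empty (hp : p ≠ 0) :
    HasQ p (US (∅ : Finset (HeightOneSpectrum (𝓞 K)))) (p ^ (Fintype.card (InfinitePlace K) - 1)) := by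
  have hu : ∀ u : (𝓞 K)ˣ, Units.map (algebraMap (𝓞 K) K : 𝓞 K →* K) u ∈ US (∅ : Finset (HeightOneSpectrum (𝓞 K))) := by
    intro u v _
    simp only [Units.coe_map, MonoidHom.coe_coe]
    rw [HeightOneSpectrum.valuation_eq_one_iff_notMem]
    intro h
    exact v.isPrime.ne_top (Ideal.eq_top_of_isUnit_mem _ h u.isUnit)
  refine (HasQ_units (K := K) hp).congr (MulEquiv.ofBijective
    ((Units.map (algebraMap (𝓞 K) K : 𝓞 K →* K)).codRestrict _ hu) ⟨?_, ?_⟩)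
  · intro u u' h
    have := congrArg (fun z : US (∅ : Finset (HeightOneSpectrum (𝓞 K))) => ((z : Kˣ) : K)) h
    simp at this
    exact Units.ext this
  · rintro ⟨x, hx⟩
    obtain ⟨a, ha⟩ := HeightOneSpectrum.mem_integers_of_valuation_le_one K (x:K)
      (fun v => (hx v (by simp)).le)
    obtain ⟨b, hb⟩ := HeightOneSpectrum.mem_integers_of_valuation_le_one K ((x⁻¹ : Kˣ):K)
      (fun v => (inv_mem hx v (by simp)).le)
    refine ⟨⟨a, b, ?_, ?_⟩, ?_⟩
    · apply FaithfulSMul.algebraMap_injective (𝓞 K) K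
      rw [map_mul, ha, hb]; simp
    · apply FaithfulSMul.algebraMap_injective (𝓞 K) K
      rw [map_mul, ha, hb]; simp
    · ext
      simpa using ha

lemma ideal_pow_principal (v : HeightOneSpectrum (𝓞 K)) :
    ∃ x : Kˣ, v.valuation K (x:K) ≠ 1 ∧ ∀ w ≠ v, w.valuation K (x:K) = 1 := by
  have hI : v.asIdeal ∈ nonZeroDivisors (Ideal (𝓞 K)) := mem_nonZeroDivisors_of_ne_zero v.ne_bot
  have h1 : ClassGroup.mk0 (⟨v.asIdeal, hI⟩ ^ (Fintype.card (ClassGroup (𝓞 K)))) = 1 := by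
    rw [map_pow, pow_card_eq_one]
  set n := Fintype.card (ClassGroup (𝓞 K)) with hn
  have hn0 : n ≠ 0 := Fintype.card_ne_zero
  have h2 : (v.asIdeal ^ n).IsPrincipal := by
    rw [← ClassGroup.mk0_eq_one_iff (pow_mem hI n)]
    exact h1
  obtain ⟨c, hc⟩ := h2
  change _ = Ideal.span {c} at hc
  have hc0 : c ≠ 0 := by
    rintro rfl
    have : v.asIdeal ^ n ≠ 0 := pow_ne_zero _ v.ne_bot
    apply this
    rw [hc]; simp
  have hc0' : algebraMap (𝓞 K) K c ≠ 0 := by simpa using hc0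
  refine ⟨Units.mk0 _ hc0', ?_, ?_⟩
  · rw [Units.val_mk0, Ne, HeightOneSpectrum.valuation_eq_one_iff_notMem, not_not]
    apply Ideal.pow_le_self hn0
    rw [hc]
    exact Ideal.mem_span_singleton_self c
  · intro w hw
    rw [Units.val_mk0, HeightOneSpectrum.valuation_eq_one_iff_notMem]
    intro h
    have h3 : v.asIdeal ^ n ≤ w.asIdeal := by
      rw [hc, Ideal.span_singleton_le_iff_mem]
      exact h
    have h4 := (Ideal.IsPrime.pow_le_iff (hP := w.isPrime) hn0).1 h3
    apply hw
    ext1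
    exact ((v.isPrime.isMaximal v.ne_bot).eq_of_le w.isPrime.ne_top h4).symm

lemma HasQ_sub_int (hp : p ≠ 0) (H : Subgroup (Multiplicative ℤ)) (hH : H ≠ ⊥) : HasQ p H p := by
  obtain ⟨⟨x, hx⟩, hx1⟩ := Subgroup.ne_bot_iff_exists_ne_one.1 hH
  refine HasQ.finiteIndex H ?_ (HasQ.int hp)
  have h1 : (Subgroup.zpowers x).index ≠ 0 := by
    have h2 : (AddSubgroup.zmultiples x.toAdd).index ≠ 0 := by
      rw [Int.index_zmultiples, Int.natAbs_ne_zero]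
      intro h
      apply hx1
      ext
      exact h
    exact h2
  exact fun h => h1 (Nat.eq_zero_of_zero_dvd (h ▸ Subgroup.index_dvd_of_le (by simpa using hx)))

lemma HasQ_US (hp : p ≠ 0) (S : Finset (HeightOneSpectrum (𝓞 K))) :
    HasQ p (US S) (p ^ (S.card + Fintype.card (InfinitePlace K) - 1)) := by
  classical
  induction S using Finset.induction_on with
  | empty => simpa using HasQ_US_empty (K := K) hp
  | insert v S hv ih =>
    let f : US (insert v S) →* Multiplicative ℤ := (v.valuationOfNeZero (K := K)).comp (US (insert v S)).subtype
    have hr : HasQ p f.range p := by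
      apply HasQ_sub_int hp
      obtain ⟨x, hx, hx'⟩ := ideal_pow_principal v
      intro h
      apply hx
      have : f ⟨x, fun w hw => hx' w fun e => hw (by simp [e])⟩ ∈ f.range := ⟨_, rfl⟩
      rw [h, Subgroup.mem_bot] at this
      exact vnz_eq_one.1 this
    have hle : US S ≤ US (insert v S) := US_mono (Finset.subset_insert _ _)
    have hk : f.rangeRestrict.ker = (US S).subgroupOf (US (insert v S)) := by
      rw [MonoidHom.ker_rangeRestrict]
      ext ⟨x, hx⟩
      rw [MonoidHom.mem_ker, Subgroup.mem_subgroupOf]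
      change v.valuationOfNeZero x = 1 ↔ x ∈ US S
      rw [vnz_eq_one]
      constructor
      · intro h w hw
        by_cases hwv : w = v
        · rwa [hwv]
        · exact hx w (by simp [hw, hwv])
      · intro h
        exact h v hv
    have h1 : HasQ p f.rangeRestrict.ker (p ^ (S.card + Fintype.card (InfinitePlace K) - 1)) := by
      rw [hk]
      exact ih.congr (Subgroup.subgroupOfEquivOfLe hle).symm
    have h2 := HasQ.of_ker_quot f.rangeRestrict f.rangeRestrict_surjective h1 hr
    rw [← pow_succ] at h2
    rw [Finset.card_insert_of_notMem hv]
    have hpos : 0 < Fintype.card (InfinitePlace K) := Fintype.card_pos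
    have h3 : S.card + 1 + Fintype.card (InfinitePlace K) - 1 = S.card + Fintype.card (InfinitePlace K) - 1 + 1 := by omega
    rw [h3]
    exact h2

lemma val_eq_one (v : HeightOneSpectrum (𝓞 K)) {c : 𝓞 K} (hc0 : c ≠ 0) (a1 : c ∈ v.asIdeal ^ 1)
    (a2 : c ∉ v.asIdeal ^ 2) : v.valuation K (algebraMap (𝓞 K) K c) = WithZero.exp (-1) := by
  have hc0' : algebraMap (𝓞 K) K c ≠ 0 := by simpa using hc0
  rw [val_pow_mem] at a1 a2
  refine le_antisymm (by simpa using a1) ?_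
  push Not at a2
  have h0 : v.valuation K (algebraMap (𝓞 K) K c) ≠ 0 := (Valuation.ne_zero_iff _).2 hc0'
  obtain ⟨m, hm⟩ : ∃ m : ℤ, v.valuation K (algebraMap (𝓞 K) K c) = WithZero.exp m :=
    ⟨WithZero.log (v.valuation K (algebraMap (𝓞 K) K c)), (WithZero.exp_log h0).symm⟩
  change _ < v.valuation K (algebraMap (𝓞 K) K c) at a2
  rw [hm] at a2 ⊢
  rw [WithZero.exp_lt_exp] at a2
  rw [WithZero.exp_le_exp]
  push_cast at a2
  omega

lemma dvd_of_mul_dvd_mul_left' {I J : Ideal (𝓞 K)} (hI : I ≠ ⊥) (h : I * I ∣ I * J) : I ∣ J :=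
  (mul_dvd_mul_iff_left (a := I) hI).1 h

lemma cl_aux (v : HeightOneSpectrum (𝓞 K)) (J : Ideal (𝓞 K)) (hJ0 : J ≠ 0) (hvJ : ¬ v.asIdeal ∣ J) {c : 𝓞 K}
    (hc : v.asIdeal * J = Ideal.span {c}) : ∃ c : Kˣ,
    v.valuation K (c:K) = WithZero.exp (-1) ∧ ∀ w : HeightOneSpectrum (𝓞 K), ¬ w.asIdeal ∣ J →
      w ≠ v → w.valuation K (c:K) = 1 := by
  have hc0 : c ≠ 0 := by
    rintro rfl
    have : v.asIdeal * J ≠ 0 := mul_ne_zero v.ne_bot hJ0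
    apply this
    rw [hc]; simp
  have hc0' : algebraMap (𝓞 K) K c ≠ 0 := by simpa using hc0
  have hcm : c ∈ v.asIdeal * J := by
    rw [hc]
    exact Ideal.mem_span_singleton_self c
  refine ⟨Units.mk0 _ hc0', ?_, ?_⟩
  · rw [Units.val_mk0]
    have a1 : c ∈ v.asIdeal ^ 1 := by
      rw [pow_one]
      exact Ideal.mul_le_left hcm
    have a2 : c ∉ v.asIdeal ^ 2 := by
      intro h
      have h3 : v.asIdeal ^ 2 ∣ v.asIdeal * J := by
        rw [Ideal.dvd_iff_le, hc, Ideal.span_singleton_le_iff_mem]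
        exact h
      rw [sq] at h3
      exact hvJ (dvd_of_mul_dvd_mul_left' v.ne_bot h3)
    exact val_eq_one v hc0 a1 a2
  · intro w hw hwv
    rw [Units.val_mk0, HeightOneSpectrum.valuation_eq_one_iff_notMem]
    intro h
    have h3 : w.asIdeal ∣ v.asIdeal * J := by
      rw [Ideal.dvd_iff_le, hc, Ideal.span_singleton_le_iff_mem]
      exact h
    rcases (w.prime.dvd_or_dvd h3) with h4 | h4
    · apply hwv
      ext1
      exact ((v.isPrime.isMaximal v.ne_bot).eq_of_le w.isPrime.ne_top (Ideal.dvd_iff_le.1 h4)).symm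
    · exact hw h4

/-- Finiteness of the class group -/
lemma cl_one (K : Type*) [Field K] [NumberField K] : ∃ S1 : Finset (HeightOneSpectrum (𝓞 K)), ∀ v ∉ S1, ∃ c : Kˣ,
    v.valuation K (c:K) = WithZero.exp (-1) ∧ ∀ w ∉ S1, w ≠ v → w.valuation K (c:K) = 1 := by
  classical
  choose J hJ using ClassGroup.mk0_surjective (R := 𝓞 K)
  have hJ0 : ∀ C, (J C : Ideal (𝓞 K)) ≠ 0 := fun C => nonZeroDivisors.ne_zero (J C).2
  refine ⟨Finset.univ.biUnion fun C => (Ideal.finite_factors (hJ0 C)).toFinset, ?_⟩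
  intro v hv
  have hn : ∀ w : HeightOneSpectrum (𝓞 K),
      w ∉ (Finset.univ.biUnion fun C => (Ideal.finite_factors (hJ0 C)).toFinset) →
      ∀ C, ¬ w.asIdeal ∣ J C := by
    intro w hw C h
    apply hw
    rw [Finset.mem_biUnion]
    exact ⟨C, Finset.mem_univ _, by simpa using h⟩
  have hI : v.asIdeal ∈ nonZeroDivisors (Ideal (𝓞 K)) := mem_nonZeroDivisors_of_ne_zero v.ne_bot
  set C := (ClassGroup.mk0 ⟨v.asIdeal, hI⟩)⁻¹ with hC
  have h1 : ClassGroup.mk0 (⟨v.asIdeal, hI⟩ * J C) = 1 := by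
    rw [map_mul, hJ, hC, mul_inv_cancel]
  have h2 : (v.asIdeal * J C).IsPrincipal := by
    rw [← ClassGroup.mk0_eq_one_iff (mul_mem hI (J C).2)]
    exact h1
  obtain ⟨c, hc⟩ := h2
  exact cl_aux v (J C) (hJ0 C) (hn v hv C) hc |>.imp fun d hd => ⟨hd.1, fun w hw hwv => hd.2 w (hn w hw C) hwv⟩

/-- S contains generators of the class group -/
def ClOK (S : Finset (HeightOneSpectrum (𝓞 K))) : Prop := ∀ v ∉ S, ∃ c : Kˣ,
    v.valuation K (c:K) = WithZero.exp (-1) ∧ ∀ w ∉ S, w ≠ v → w.valuation K (c:K) = 1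

lemma ClOK.mono {S T : Finset (HeightOneSpectrum (𝓞 K))} (h : ClOK S) (hST : S ⊆ T) : ClOK T := by
  intro v hv
  obtain ⟨c, h1, h2⟩ := h v fun hh => hv (hST hh)
  exact ⟨c, h1, fun w hw => h2 w fun hh => hw (hST hh)⟩

/-- elements with prescribed valuations outside S -/
lemma ClOK.exists_val {S : Finset (HeightOneSpectrum (𝓞 K))} (h : ClOK S) (n : HeightOneSpectrum (𝓞 K) → ℤ)
    (T : Finset (HeightOneSpectrum (𝓞 K))) (hT : ∀ v ∉ S, v ∉ T → n v = 0) :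
    ∃ c : Kˣ, ∀ v ∉ S, v.valuation K (c:K) = WithZero.exp (n v) := by
  classical
  have key : ∀ T : Finset (HeightOneSpectrum (𝓞 K)), Disjoint S T → ∃ c : Kˣ, ∀ v ∉ S,
      v.valuation K (c:K) = if v ∈ T then WithZero.exp (n v) else 1 := by
    intro T
    induction T using Finset.induction_on with
    | empty => exact fun _ => ⟨1, by simp⟩
    | insert u T hu ih =>
      intro hd
      rw [Finset.disjoint_insert_right] at hd
      obtain ⟨c, hc⟩ := ih hd.2
      obtain ⟨d, hd1, hd2⟩ := h u hd.1
      refine ⟨c * d ^ (-(n u)), fun v hv => ?_⟩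
      rw [Units.val_mul, map_mul, hc v hv, Units.val_zpow_eq_zpow_val, map_zpow₀]
      by_cases hvu : v = u
      · rw [hvu, hd1, if_neg hu, if_pos (Finset.mem_insert_self _ _), one_mul, ← WithZero.exp_zsmul]
        simp
      · rw [hd2 v hv hvu, one_zpow, mul_one]
        simp [hvu]
  obtain ⟨c, hc⟩ := key (T \ S) Finset.disjoint_sdiff
  refine ⟨c, fun v hv => ?_⟩
  rw [hc v hv]
  split_ifs with hvT
  · rfl
  · rw [hT v hv (by simpa [hv] using hvT), WithZero.exp_zero]

end su
end ABHN
end FileGlob4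

section FileGlob5
set_option autoImplicit false
set_option linter.unusedSectionVars false
open scoped TensorProduct
open IsDedekindDomain NumberField WithZero

namespace ABHN

section ext
variable {K L : Type*} [Field K] [NumberField K] [Field L] [NumberField L]

lemma exists_prime_of_val (V : Valuation L (ℤᵐ⁰)) (h1 : ∀ a : 𝓞 L, V (a : L) ≤ 1)
    (h3 : ∃ x, V x = exp (-1)) : ∃ w : HeightOneSpectrum (𝓞 L), ∀ x, w.valuation L x = V x := by
  let I : Ideal (𝓞 L) :=
    { carrier := {a | V (a : L) < 1}
      add_mem' := fun {a b} ha hb => by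
        change V ((a + b : 𝓞 L) : L) < 1
        push_cast
        exact (V.map_add _ _).trans_lt (max_lt ha hb)
      zero_mem' := by
        change V ((0 : 𝓞 L) : L) < 1
        simp
      smul_mem' := fun c a ha => by
        change V ((c * a : 𝓞 L) : L) < 1
        push_cast
        rw [map_mul]
        exact (mul_le_of_le_one_left' (h1 c)).trans_lt ha }
  have hI : ∀ a : 𝓞 L, a ∈ I ↔ V (a : L) < 1 := fun a => Iff.rfl
  have hnI : ∀ a : 𝓞 L, a ∉ I → V (a : L) = 1 := fun a ha => le_antisymm (h1 a) (not_lt.1 ha)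
  have hprime : I.IsPrime := by
    refine ⟨?_, ?_⟩
    · rw [Ne, Ideal.eq_top_iff_one, hI]
      simp
    · intro a b hab
      by_contra hc
      push Not at hc
      rw [hI] at hab
      push_cast at hab
      rw [map_mul, hnI a hc.1, hnI b hc.2] at hab
      simp at hab
  have hbot : I ≠ ⊥ := by
    intro hb
    obtain ⟨x, hx⟩ := h3
    obtain ⟨a, d, hd, rfl⟩ := IsFractionRing.div_surjective (A := 𝓞 L) x
    have hd0 : d ≠ 0 := nonZeroDivisors.ne_zero hd
    have ha0 : a ≠ 0 := by
      rintro rfl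
      rw [map_zero, zero_div, map_zero] at hx
      exact exp_ne_zero hx.symm
    have h1 : ∀ a : 𝓞 L, a ≠ 0 → V (algebraMap (𝓞 L) L a) = 1 := by
      intro a ha
      apply hnI
      rwa [hb, Ideal.mem_bot]
    rw [map_div₀, h1 a ha0, h1 d hd0, div_one, ← exp_zero, exp_inj] at hx
    omega
  let w : HeightOneSpectrum (𝓞 L) := ⟨I, hprime, hbot⟩
  refine ⟨w, ?_⟩
  have hunit : ∀ x : L, w.valuation L x = 1 → V x = 1 := by
    intro x hx
    obtain ⟨n, ⟨d, hd⟩, hnd⟩ := w.exists_primeCompl_mul_eq_of_integer x hx.le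
    have hd1 : V (algebraMap (𝓞 L) L d) = 1 := hnI d hd
    have hd2 : w.valuation L (algebraMap (𝓞 L) L d) = 1 := by
      rw [HeightOneSpectrum.valuation_eq_one_iff_notMem]
      exact hd
    have hn : w.valuation L (algebraMap (𝓞 L) L n) = 1 := by
      rw [← hnd, map_mul, hx, hd2, one_mul]
    rw [HeightOneSpectrum.valuation_eq_one_iff_notMem] at hn
    have hn1 : V (algebraMap (𝓞 L) L n) = 1 := hnI n hn
    rw [← hnd, map_mul, hd1, mul_one] at hn1
    exact hn1
  obtain ⟨π, hπ⟩ := w.valuation_exists_uniformizer L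
  have hπ0 : π ≠ 0 := by
    rintro rfl
    rw [map_zero] at hπ
    exact exp_ne_zero hπ.symm
  obtain ⟨k, hk⟩ : ∃ k : ℤ, V π = exp k :=
    ⟨log (V π), (exp_log ((Valuation.ne_zero_iff _).2 hπ0)).symm⟩
  have hV : ∀ x m, w.valuation L x = exp m → V x = exp (-m * k) := by
    intro x m hm
    have : w.valuation L (x * π ^ m) = 1 := by
      rw [map_mul, map_zpow₀, hm, hπ, ← exp_zsmul, ← exp_add, ← exp_zero]
      congr 1
      simp
    have := hunit _ this
    rw [map_mul, map_zpow₀, hk, ← exp_zsmul] at this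
    rw [eq_inv_of_mul_eq_one_left this, ← exp_neg]
    congr 1
    simp
  have hlog : ∀ x ≠ 0, ∃ m, w.valuation L x = exp m := fun x hx =>
    ⟨log (w.valuation L x), (exp_log ((Valuation.ne_zero_iff _).2 hx)).symm⟩
  have hk1 : k = -1 := by
    have hkneg : k ≤ 0 := by
      have hle : w.valuation L π ≤ 1 := by
        rw [hπ, ← exp_zero, exp_le_exp]; omega
      obtain ⟨n, ⟨d, hd⟩, hnd⟩ := w.exists_primeCompl_mul_eq_of_integer π hle
      have hd1 : V (algebraMap (𝓞 L) L d) = 1 := hnI d hd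
      have hn1 : V (algebraMap (𝓞 L) L n) ≤ 1 := h1 n
      rw [← hnd, map_mul, hd1, mul_one, hk, ← exp_zero, exp_le_exp] at hn1
      exact hn1
    obtain ⟨x, hx⟩ := h3
    have hx0 : x ≠ 0 := by
      rintro rfl
      rw [map_zero] at hx
      exact exp_ne_zero hx.symm
    obtain ⟨m, hm⟩ := hlog x hx0
    rw [hV x m hm, exp_inj] at hx
    have hdvd : k ∣ 1 := ⟨m, by linarith⟩
    rcases Int.isUnit_iff.1 (isUnit_of_dvd_one hdvd) with h | h
    · omega
    · exact h
  intro x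
  rcases eq_or_ne x 0 with rfl | hx
  · simp
  · obtain ⟨m, hm⟩ := hlog x hx
    rw [hm, hV x m hm, hk1]
    congr 1
    ring

variable [Algebra K L]

/-- the prime below -/
noncomputable def resP (w : HeightOneSpectrum (𝓞 L)) : HeightOneSpectrum (𝓞 K) :=
  ⟨w.asIdeal.under (𝓞 K), inferInstance, by
    have := w.isPrime.isMaximal w.ne_bot
    exact Ideal.under_ne_bot _ w.ne_bot⟩

lemma mem_resP {w : HeightOneSpectrum (𝓞 L)} {a : 𝓞 K} :
    a ∈ (resP (K := K) w).asIdeal ↔ algebraMap (𝓞 K) (𝓞 L) a ∈ w.asIdeal := Iff.rfl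

instance instLO (w : HeightOneSpectrum (𝓞 L)) : w.asIdeal.LiesOver (resP (K := K) w).asIdeal := ⟨rfl⟩

lemma resP_val (w : HeightOneSpectrum (𝓞 L)) : ∃ e : ℕ, e ≠ 0 ∧ ∀ x : K,
    w.valuation L (algebraMap K L x) = (resP (K := K) w).valuation K x ^ e :=
  ⟨_, Ideal.IsDedekindDomain.ramificationIdx'_ne_zero_of_liesOver w.asIdeal (resP (K := K) w).ne_bot,
    fun x => ((resP (K := K) w).valuation_liesOver L w x).symm⟩

lemma resP_lt_one {w : HeightOneSpectrum (𝓞 L)} {x : K} :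
    w.valuation L (algebraMap K L x) < 1 ↔ (resP (K := K) w).valuation K x < 1 := by
  obtain ⟨e, he, h⟩ := resP_val (K := K) w
  rw [h, pow_lt_one_iff he]

lemma resP_eq_one {w : HeightOneSpectrum (𝓞 L)} {x : K} :
    w.valuation L (algebraMap K L x) = 1 ↔ (resP (K := K) w).valuation K x = 1 := by
  obtain ⟨e, he, h⟩ := resP_val (K := K) w
  rw [h, pow_eq_one_iff]
  simp [he]

lemma resP_eq_of {w : HeightOneSpectrum (𝓞 L)} {v : HeightOneSpectrum (𝓞 K)}
    (h : ∀ x : K, v.valuation K x < 1 → w.valuation L (algebraMap K L x) < 1) : resP w = v := by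
  ext1
  symm
  refine (v.isPrime.isMaximal v.ne_bot).eq_of_le (resP (K := K) w).isPrime.ne_top ?_
  intro a ha
  rw [← HeightOneSpectrum.valuation_lt_one_iff_mem (K := K)] at ha ⊢
  exact resP_lt_one.1 (h _ ha)

lemma resP_surj (v : HeightOneSpectrum (𝓞 K)) : ∃ w : HeightOneSpectrum (𝓞 L), resP w = v := by
  have := v.isPrime.isMaximal v.ne_bot
  obtain ⟨P, hP, hPv⟩ := Ideal.exists_maximal_ideal_liesOver_of_isIntegral (S := 𝓞 L) v.asIdeal
  refine ⟨⟨P, hP.isPrime, ?_⟩, ?_⟩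
  · exact Ideal.ne_bot_of_liesOver_of_ne_bot v.ne_bot P
  · ext1
    exact hPv.over.symm

lemma resP_finite (v : HeightOneSpectrum (𝓞 K)) : {w : HeightOneSpectrum (𝓞 L) | resP w = v}.Finite := by
  have h0 : v.asIdeal.map (algebraMap (𝓞 K) (𝓞 L)) ≠ 0 := by
    rw [Ne, Ideal.zero_eq_bot, Ideal.map_eq_bot_iff_of_injective (FaithfulSMul.algebraMap_injective _ _)]
    exact v.ne_bot
  refine (Ideal.finite_factors h0).subset ?_
  rintro w rfl
  change w.asIdeal ∣ _
  rw [Ideal.dvd_iff_le, Ideal.map_le_iff_le_comap]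
  exact le_rfl

/-- primes of L above S -/
noncomputable def SL (L : Type*) [Field L] [NumberField L] [Algebra K L]
    (S : Finset (HeightOneSpectrum (𝓞 K))) : Finset (HeightOneSpectrum (𝓞 L)) :=
  (Set.Finite.preimage' S.finite_toSet (f := resP (K := K) (L := L)) fun v _ => resP_finite v).toFinset

lemma mem_SL {S : Finset (HeightOneSpectrum (𝓞 K))} {w : HeightOneSpectrum (𝓞 L)} :
    w ∈ SL L S ↔ resP w ∈ S := by
  simp [SL]

lemma SL_mono {S T : Finset (HeightOneSpectrum (𝓞 K))} (h : S ⊆ T) : SL L S ⊆ SL L T := by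
  intro w hw
  rw [mem_SL] at hw ⊢
  exact h hw

/-- S-units of K in L -/
lemma mem_US_SL {S : Finset (HeightOneSpectrum (𝓞 K))} {x : Kˣ} :
    Units.map (algebraMap K L : K →* L) x ∈ US (SL L S) ↔ x ∈ US S := by
  constructor
  · intro h v hv
    obtain ⟨w, rfl⟩ := resP_surj (L := L) v
    exact resP_eq_one.1 (h w (by rwa [mem_SL]))
  · intro h w hw
    exact resP_eq_one.2 (h _ (by rwa [mem_SL] at hw))

lemma exists_conj (σ : L ≃ₐ[K] L) (w : HeightOneSpectrum (𝓞 L)) :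
    ∃ w' : HeightOneSpectrum (𝓞 L), resP (K := K) w' = resP w ∧ ∀ y, w.valuation L (σ y) = w'.valuation L y := by
  obtain ⟨w', hw'⟩ := exists_prime_of_val ((w.valuation L).comap (σ : L →+* L)) (fun a => by
      change w.valuation L (σ a) ≤ 1
      exact w.valuation_le_one (RingOfIntegers.mapRingEquiv (σ : L ≃+* L) a)) (by
      obtain ⟨π, hπ⟩ := w.valuation_exists_uniformizer L
      refine ⟨σ.symm π, ?_⟩
      change w.valuation L (σ (σ.symm π)) = _
      rw [σ.apply_symm_apply]
      exact hπ)
  refine ⟨w', resP_eq_of fun x hx => ?_, fun y => (hw' y).symm⟩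
  rw [hw']
  change w.valuation L (σ (algebraMap K L x)) < 1
  rw [σ.commutes, resP_lt_one]
  exact hx

lemma conj_US {S : Finset (HeightOneSpectrum (𝓞 K))} (σ : L ≃ₐ[K] L) {x : Lˣ} (hx : x ∈ US (SL L S)) :
    Units.map (σ : L →* L) x ∈ US (SL L S) := by
  intro w hw
  obtain ⟨w', h1, h2⟩ := exists_conj σ w
  change w.valuation L (σ x) = 1
  rw [h2]
  apply hx
  rwa [mem_SL, h1, ← mem_SL (L := L)]

end ext
end ABHN
end FileGlob5

section FileGlob6
set_option autoImplicit false
set_option linter.unusedSectionVars false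
open scoped TensorProduct
open IsDedekindDomain NumberField WithZero

namespace ABHN

section fi
variable {K L : Type*} [Field K] [NumberField K] [Field L] [NumberField L] [Algebra K L]
  {p : ℕ} {ζ b : K} {θ : L}

lemma sum_pow_root {F : Type*} [Field F] {ζ : F} {p : ℕ} (hζ : IsPrimitiveRoot ζ p) (k : ℕ) (hk : k < p) :
    ∑ i ∈ Finset.range p, ((ζ⁻¹) ^ i) ^ k = if k = 0 then (p : F) else 0 := by
  split_ifs with h
  · simp [h]
  · have h1 : IsPrimitiveRoot (ζ⁻¹) p := hζ.inv
    have h2 : (ζ⁻¹) ^ k ≠ 1 := h1.pow_ne_one_of_pos_of_lt h hk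
    have h3 : ∑ i ∈ Finset.range p, ((ζ⁻¹) ^ k) ^ i = 0 := by
      rw [geom_sum_eq h2, ← pow_mul, mul_comm, pow_mul, h1.pow_eq_one]
      simp
    rw [← h3]
    refine Finset.sum_congr rfl fun i _ => ?_
    rw [← pow_mul, ← pow_mul, mul_comm]

/-- Lagrange resolvents -/
lemma Kum.resolvent (h : Kum p K ζ b θ) (z : L) : ∃ c : ℕ → K,
    (∀ i, algebraMap K L (c i) * θ ^ i = ∑ k ∈ Finset.range p, algebraMap K L (((ζ⁻¹) ^ i) ^ k) * h.σ^[k] z) ∧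
    ∑ i ∈ Finset.range p, algebraMap K L (c i) * θ ^ i = p * z := by
  have hζ0 : ζ ≠ 0 := h.prim.ne_zero h.prime.ne_zero
  have key : ∀ i, ∃ c : K, algebraMap K L c * θ ^ i =
      ∑ k ∈ Finset.range p, algebraMap K L (((ζ⁻¹) ^ i) ^ k) * h.σ^[k] z := by
    intro i
    set r := ∑ k ∈ Finset.range p, algebraMap K L (((ζ⁻¹) ^ i) ^ k) * h.σ^[k] z with hr
    have h1 : h.σ r = algebraMap K L (ζ ^ i) * r := by
      have h2 : ∀ k, algebraMap K L (((ζ⁻¹) ^ i) ^ k) * h.σ (h.σ^[k] z) =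
          algebraMap K L (ζ ^ i) * (algebraMap K L (((ζ⁻¹) ^ i) ^ (k+1)) * h.σ^[k+1] z) := by
        intro k
        rw [Function.iterate_succ_apply', ← mul_assoc, ← map_mul, pow_succ ((ζ⁻¹) ^ i)]
        have h0 : ζ ^ i * (((ζ⁻¹) ^ i) ^ k * (ζ⁻¹) ^ i) = ((ζ⁻¹) ^ i) ^ k := by
          rw [mul_comm, mul_assoc, ← mul_pow, inv_mul_cancel₀ hζ0, one_pow, mul_one]
        rw [h0]
      have h3 := Finset.sum_range_succ (fun k => algebraMap K L (((ζ⁻¹) ^ i) ^ k) * h.σ^[k] z) p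
      have h4 := Finset.sum_range_succ' (fun k => algebraMap K L (((ζ⁻¹) ^ i) ^ k) * h.σ^[k] z) p
      have h5 : algebraMap K L (((ζ⁻¹) ^ i) ^ p) * h.σ^[p] z =
          algebraMap K L (((ζ⁻¹) ^ i) ^ 0) * h.σ^[0] z := by
        rw [h.σ_pow, ← pow_mul, mul_comm i p, pow_mul, h.prim.inv.pow_eq_one]
        simp
      rw [h3, h5] at h4
      have h6 := add_right_cancel h4
      rw [hr, map_sum]
      simp only [map_mul, AlgEquiv.commutes]
      rw [Finset.sum_congr rfl fun k _ => h2 k, ← Finset.mul_sum, ← h6]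
    have h7 : h.σ (r / θ ^ i) = r / θ ^ i := by
      have := h.θ_ne_zero
      have : algebraMap K L ζ ≠ 0 := by simpa using hζ0
      rw [map_div₀, h1, map_pow h.σ θ i, h.σ_θ, map_pow (algebraMap K L) ζ i, mul_pow]
      field_simp
    obtain ⟨c, hc⟩ := h.fixed _ h7
    refine ⟨c, ?_⟩
    rw [hc, div_mul_cancel₀ _ (pow_ne_zero _ h.θ_ne_zero)]
  choose c hc using key
  refine ⟨c, hc, ?_⟩
  rw [Finset.sum_congr rfl fun i _ => hc i, Finset.sum_comm]
  have h8 : ∀ k ∈ Finset.range p, ∑ i ∈ Finset.range p, algebraMap K L (((ζ⁻¹) ^ i) ^ k) * h.σ^[k] z =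
      if k = 0 then p * z else 0 := by
    intro k hk
    rw [← Finset.sum_mul, ← map_sum, sum_pow_root h.prim k (Finset.mem_range.1 hk)]
    split_ifs with hk0
    · simp [hk0]
    · simp
  rw [Finset.sum_congr rfl h8, Finset.sum_ite_eq']
  simp [h.prime.pos]

lemma val_root_of_unity {w : HeightOneSpectrum (𝓞 L)} {x : L} {n : ℕ} (hn : n ≠ 0) (hx : w.valuation L (x ^ n) = 1) :
    w.valuation L x = 1 := by
  rw [map_pow] at hx
  rcases pow_eq_one_iff.1 hx with h | h
  · exact h
  · exact absurd h hn

/-- S is large enough for b -/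
structure Good (p : ℕ) (b : K) (S : Finset (HeightOneSpectrum (𝓞 K))) : Prop where
  cl : ClOK S
  hp : ∀ v ∉ S, v.valuation K (p : K) = 1
  hb : ∀ v ∉ S, v.valuation K b = 1

lemma Good.mono {S T : Finset (HeightOneSpectrum (𝓞 K))} (h : Good p b S) (hST : S ⊆ T) : Good p b T :=
  ⟨h.cl.mono hST, fun v hv => h.hp v fun hh => hv (hST hh), fun v hv => h.hb v fun hh => hv (hST hh)⟩

lemma exists_Good (hp : p ≠ 0) (hb : b ≠ 0) : ∃ S : Finset (HeightOneSpectrum (𝓞 K)), Good p b S := by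
  classical
  obtain ⟨S1, hS1⟩ := cl_one K
  have hp0 : (p : K) ≠ 0 := by exact_mod_cast hp
  refine ⟨S1 ∪ (finite_supp (Units.mk0 _ hp0)).toFinset ∪ (finite_supp (Units.mk0 _ hb)).toFinset,
    ClOK.mono (S := S1) hS1 (by intro v hv; simp [hv]), ?_, ?_⟩
  · intro v hv
    by_contra hc
    apply hv
    simp [hc]
  · intro v hv
    by_contra hc
    apply hv
    simp [hc]

lemma Kum.same_val (h : Kum p K ζ b θ) {S : Finset (HeightOneSpectrum (𝓞 K))} (hS : Good p b S) (z : Lˣ)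
    (hz : ∀ w ∉ SL L S, ∀ k, w.valuation L (h.σ^[k] z) = w.valuation L (z : L)) :
    ∃ c : Kˣ, ∀ w ∉ SL L S, w.valuation L (algebraMap K L c) = w.valuation L (z : L) := by
  classical
  obtain ⟨c, hc1, hc2⟩ := h.resolvent (z : L)
  have hne : (Finset.range p).Nonempty := ⟨0, Finset.mem_range.2 h.prime.pos⟩
  choose i hi hmax using fun v : HeightOneSpectrum (𝓞 K) =>
    Finset.exists_max_image (Finset.range p) (fun i => v.valuation K (c i)) hne
  have hζ : ∀ w : HeightOneSpectrum (𝓞 L), ∀ j k, w.valuation L (algebraMap K L (((ζ⁻¹) ^ j) ^ k)) = 1 := by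
    intro w j k
    apply val_root_of_unity (n := p) h.prime.ne_zero
    rw [← map_pow, ← pow_mul, ← pow_mul, ← mul_assoc, mul_comm (j * k) p, pow_mul, h.prim.inv.pow_eq_one]
    simp
  have hval : ∀ w ∉ SL L S, w.valuation L (algebraMap K L (c (i (resP w)))) = w.valuation L (z : L) := by
    intro w hw
    have hw' : resP (K := K) w ∉ S := by rwa [mem_SL] at hw
    have hp1 : w.valuation L (p : L) = 1 := by
      have := resP_eq_one.2 (hS.hp _ hw')
      simpa using this
    have hθ : w.valuation L θ = 1 := by
      apply val_root_of_unity (n := p) h.prime.ne_zero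
      rw [h.pow]
      exact resP_eq_one.2 (hS.hb _ hw')
    have hθi : ∀ j, w.valuation L (algebraMap K L (c j) * θ ^ j) = w.valuation L (algebraMap K L (c j)) := by
      intro j
      rw [map_mul, map_pow, hθ, one_pow, mul_one]
    obtain ⟨e, he, hre⟩ := resP_val (K := K) w
    apply le_antisymm
    · rw [← hθi, hc1]
      apply Valuation.map_sum_le
      intro k _
      rw [map_mul, hζ, one_mul, hz w hw]
    · have : w.valuation L (z : L) = w.valuation L (p * z) := by rw [map_mul, hp1, one_mul]
      rw [this, ← hc2]
      apply Valuation.map_sum_le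
      intro j hj
      rw [hθi, hre, hre]
      exact pow_le_pow_left' (hmax (resP w) j hj) e
  have hc0 : ∀ v ∉ S, c (i v) ≠ 0 := by
    intro v hv h0
    obtain ⟨w, rfl⟩ := resP_surj (L := L) v
    have := hval w (by rwa [mem_SL])
    rw [h0, map_zero, map_zero] at this
    exact (Valuation.ne_zero_iff _).2 z.ne_zero this.symm
  let T : Finset (HeightOneSpectrum (𝓞 K)) := (Finset.range p).biUnion fun j =>
    if hj : c j = 0 then ∅ else (finite_supp (Units.mk0 (c j) hj)).toFinset
  obtain ⟨d, hd⟩ := hS.cl.exists_val (fun v => log (v.valuation K (c (i v)))) T (by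
    intro v hv hvT
    have : v.valuation K (c (i v)) = 1 := by
      by_contra hne
      apply hvT
      rw [Finset.mem_biUnion]
      refine ⟨i v, hi v, ?_⟩
      rw [dif_neg (hc0 v hv)]
      simpa using hne
    rw [this, log_one])
  refine ⟨d, fun w hw => ?_⟩
  have hw' : resP (K := K) w ∉ S := by rwa [mem_SL] at hw
  obtain ⟨e, he, hre⟩ := resP_val (K := K) w
  rw [← hval w hw, hre, hre, hd _ hw', exp_log]
  exact (Valuation.ne_zero_iff _).2 (hc0 _ hw')

/-- action on S-units -/
noncomputable def Kum.σU (h : Kum p K ζ b θ) (S : Finset (HeightOneSpectrum (𝓞 K))) :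
    US (SL L S) →* US (SL L S) :=
  ((Units.map (h.σ : L →* L)).comp (US (SL L S)).subtype).codRestrict _ fun x => conj_US h.σ x.2

lemma Kum.σU_it (h : Kum p K ζ b θ) (S : Finset (HeightOneSpectrum (𝓞 K))) (x : US (SL L S)) (k : ℕ) :
    (((h.σU S)^[k] x : Lˣ) : L) = h.σ^[k] ((x : Lˣ) : L) := by
  induction k with
  | zero => rfl
  | succ k ih =>
    rw [Function.iterate_succ_apply', Function.iterate_succ_apply', ← ih]
    rfl

lemma iter_div (f : L ≃ₐ[K] L) (k : ℕ) (x y : L) : f^[k] (x / y) = f^[k] x / f^[k] y := by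
  induction k with
  | zero => rfl
  | succ k ih => rw [Function.iterate_succ_apply', ih, map_div₀, Function.iterate_succ_apply', Function.iterate_succ_apply']

lemma iter_ne_zero (f : L ≃ₐ[K] L) (k : ℕ) {x : L} (hx : x ≠ 0) : f^[k] x ≠ 0 := by
  induction k with
  | zero => exact hx
  | succ k ih =>
    rw [Function.iterate_succ_apply']
    simpa using ih

lemma Kum.h90U (h : Kum p K ζ b θ) {S : Finset (HeightOneSpectrum (𝓞 K))} (hS : Good p b S) (x : US (SL L S))
    (hx : ∏ i ∈ Finset.range p, (h.σU S)^[i] x = 1) : ∃ y, x = y / h.σU S y := by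
  have hn : Algebra.norm K ((x : Lˣ) : L) = 1 := by
    apply FaithfulSMul.algebraMap_injective K L
    rw [h.norm_eq, map_one]
    have := congrArg (fun z : US (SL L S) => ((z : Lˣ) : L)) hx
    simp only [Subgroup.val_finsetProd, Units.coe_prod, h.σU_it] at this
    simpa using this
  obtain ⟨z, hz⟩ := h.h90 _ hn
  have hinv : ∀ w ∉ SL L S, ∀ k, w.valuation L (h.σ^[k] (z : L)) = w.valuation L (z : L) := by
    intro w hw k
    induction k with
    | zero => rfl
    | succ k ih =>
      rw [← ih]
      have h1 := ((h.σU S)^[k] x).2 w hw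
      rw [h.σU_it, hz] at h1
      have h2 : h.σ^[k] ((z : L) / h.σ z) = h.σ^[k] (z : L) / h.σ^[k+1] (z:L) := by
        rw [Function.iterate_succ_apply]
        exact iter_div h.σ k _ _
      rw [h2, map_div₀, div_eq_one_iff_eq] at h1
      · exact h1.symm
      · rw [Valuation.ne_zero_iff]
        exact iter_ne_zero h.σ _ z.ne_zero
  obtain ⟨c, hc⟩ := h.same_val hS z hinv
  have hc0 : algebraMap K L c ≠ 0 := by simp
  refine ⟨⟨z * (Units.map (algebraMap K L : K →* L) c)⁻¹, ?_⟩, ?_⟩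
  · intro w hw
    have := hc w hw
    rw [Units.val_mul, Units.val_inv_eq_inv_val, map_mul, map_inv₀]
    change _ * (w.valuation L (algebraMap K L c))⁻¹ = 1
    rw [this, mul_inv_cancel₀ ((Valuation.ne_zero_iff _).2 z.ne_zero)]
  · ext
    rw [hz]
    have hu : ((z * (Units.map (algebraMap K L : K →* L) c)⁻¹ : Lˣ) : L) = (z:L) * (algebraMap K L c)⁻¹ := by
      rw [Units.val_mul, Units.val_inv_eq_inv_val]
      rfl
    have hu2 : ∀ y : US (SL L S), ((y / h.σU S y : US (SL L S)) : Lˣ) = (y : Lˣ) / Units.map (h.σ : L →* L) (y : Lˣ) :=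
      fun y => rfl
    rw [hu2, Units.val_div_eq_div_val]
    change _ = ((z * (Units.map (algebraMap K L : K →* L) c)⁻¹ : Lˣ) : L) /
      (h.σ ((z * (Units.map (algebraMap K L : K →* L) c)⁻¹ : Lˣ) : L))
    rw [hu]
    rw [map_mul, map_inv₀, h.σ.commutes]
    have := z.ne_zero
    have : h.σ z ≠ 0 := by simp
    field_simp

/-- global norms -/
noncomputable def Nb {p : ℕ} (hp : p.Prime) (ζ b : K) : Subgroup Kˣ := NN hp (RingHom.id K) ζ b

lemma Kum.FI_gamma (h : Kum p K ζ b θ) {S : Finset (HeightOneSpectrum (𝓞 K))} (hS : Good p b S) :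
    ((Nb h.prime ζ b).relIndex (US S)) ^ (p-1) * p ^ ((SL L S).card + Fintype.card (InfinitePlace L) - 1)
      ≤ p ^ (p * (S.card + Fintype.card (InfinitePlace K) - 1)) ∧ (Nb h.prime ζ b).relIndex (US S) ≠ 0 := by
  have hp0 : (p : ℚ) ≠ 0 := by exact_mod_cast h.prime.ne_zero
  let j : US S →* US (SL L S) :=
    ((Units.map (algebraMap K L : K →* L)).comp (US S).subtype).codRestrict _ fun x => mem_US_SL.2 x.2
  have hj : Function.Injective j := by
    intro x y hxy
    have := congrArg (fun z : US (SL L S) => ((z : Lˣ) : L)) hxy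
    exact Subtype.ext (Units.ext ((algebraMap K L).injective this))
  have hjr : j.range = fixG (h.σU S) := by
    ext x
    rw [mem_fixG]
    constructor
    · rintro ⟨y, rfl⟩
      ext
      exact h.σ.commutes _
    · intro hx
      obtain ⟨y, hy⟩ := h.fixed ((x : Lˣ) : L) (congrArg (fun z : US (SL L S) => ((z : Lˣ) : L)) hx)
      have hy0 : y ≠ 0 := by
        rintro rfl
        rw [map_zero] at hy
        exact (x : Lˣ).ne_zero hy.symm
      have hyx : Units.map (algebraMap K L : K →* L) (Units.mk0 y hy0) = (x : Lˣ) := Units.ext hy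
      refine ⟨⟨Units.mk0 y hy0, ?_⟩, Subtype.ext hyx⟩
      rw [← mem_US_SL (L := L), hyx]
      exact x.2
  have hr : HasQ p (fixG (h.σU S)) (p ^ (S.card + Fintype.card (InfinitePlace K) - 1)) := by
    rw [← hjr]
    exact (HasQ_US h.prime.ne_zero S).congr (MonoidHom.ofInjective hj)
  have hg := gamma (h.σU S) p h.prime (fun x => by
    ext
    rw [h.σU_it, h.σ_pow]) (h.h90U hS) hr (HasQ_US h.prime.ne_zero _)
  rw [← hjr, ← Subgroup.index_comap] at hg
  have hle : (Nhom p (h.σU S)).range.comap j ≤ (Nb h.prime ζ b).subgroupOf (US S) := by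
    rintro x ⟨y, hy⟩
    rw [Subgroup.mem_subgroupOf]
    change NormRes p ζ b ((x : Kˣ) : K)
    rw [h.normRes_iff]
    refine ⟨((y : Lˣ) : L), ?_⟩
    apply (algebraMap K L).injective
    rw [h.norm_eq]
    have := congrArg (fun z : US (SL L S) => ((z : Lˣ) : L)) hy
    simp only [Nhom_apply, Subgroup.val_finsetProd, Units.coe_prod, h.σU_it] at this
    rw [this]
    rfl
  have hdvd := Subgroup.index_dvd_of_le hle
  set I := ((Nhom p (h.σU S)).range.comap j).index with hI
  change (Nb h.prime ζ b).relIndex (US S) ∣ I at hdvd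
  have hp1 : p - 1 ≠ 0 := by have := h.prime.one_lt; omega
  have hI0 : I ≠ 0 := by
    intro h0
    rw [h0, Nat.cast_zero, zero_pow hp1] at hg
    have := div_ne_zero (pow_ne_zero p (pow_ne_zero (S.card + Fintype.card (InfinitePlace K) - 1) hp0))
      (pow_ne_zero ((SL L S).card + Fintype.card (InfinitePlace L) - 1) hp0)
    exact this hg.symm
  refine ⟨?_, fun h0 => hI0 (Nat.eq_zero_of_zero_dvd (h0 ▸ hdvd))⟩
  have h2 : I ^ (p-1) * p ^ ((SL L S).card + Fintype.card (InfinitePlace L) - 1)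
      = p ^ (p * (S.card + Fintype.card (InfinitePlace K) - 1)) := by
    have : ((I ^ (p-1) * p ^ ((SL L S).card + Fintype.card (InfinitePlace L) - 1) : ℕ) : ℚ)
      = (p ^ (p * (S.card + Fintype.card (InfinitePlace K) - 1)) : ℕ) := by
      push_cast
      rw [hg, div_mul_cancel₀ _ (pow_ne_zero _ hp0), ← pow_mul, mul_comm p]
    exact_mod_cast this
  rw [← h2]
  gcongr
  exact Nat.le_of_dvd (Nat.pos_of_ne_zero hI0) hdvd

end fi
end ABHN
end FileGlob6

section FileGlob7
set_option autoImplicit false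
set_option linter.unusedSectionVars false
open scoped TensorProduct
open IsDedekindDomain NumberField WithZero

namespace ABHN

theorem Kum.exists_hom {p : ℕ} {F L E : Type*} [Field F] [Field L] [Field E] [Algebra F L] [Algebra F E]
    {ζ b : F} {θ : L} (h : Kum p F ζ b θ) {β : E} (hβ : β ^ p = algebraMap F E b) :
    ∃ ρ : L →ₐ[F] E, ρ θ = β := by
  have := h.finDim
  have hintg : IsIntegral F θ := Algebra.IsIntegral.isIntegral θ
  have hroot : β ∈ (_root_.minpoly F θ).aroots E := by
    rw [h.minpoly, Polynomial.mem_aroots]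
    refine ⟨(Polynomial.monic_X_pow_sub_C _ h.prime.ne_zero).ne_zero, ?_⟩
    simp [hβ]
  let ψ : IntermediateField.adjoin F {θ} →ₐ[F] E := (IntermediateField.algHomAdjoinIntegralEquiv F hintg).symm ⟨_, hroot⟩
  have hψ : ψ (IntermediateField.AdjoinSimple.gen F θ) = β :=
    IntermediateField.algHomAdjoinIntegralEquiv_symm_apply_gen F hintg ⟨_, hroot⟩
  let e : L →ₐ[F] IntermediateField.adjoin F {θ} := ((IntermediateField.equivOfEq h.adj).trans IntermediateField.topEquiv).symm.toAlgHom
  have he : e θ = IntermediateField.AdjoinSimple.gen F θ := by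
    apply ((IntermediateField.equivOfEq h.adj).trans IntermediateField.topEquiv).injective
    simp only [e]
    erw [AlgEquiv.apply_symm_apply]
  refine ⟨ψ.comp e, ?_⟩
  rw [AlgHom.comp_apply, he, hψ]

section split
variable {K L : Type*} [Field K] [NumberField K] [Field L] [NumberField L] [Algebra K L]

lemma emb_val (v : HeightOneSpectrum (𝓞 K)) (x : K) : Valued.v (emb v x) = v.valuation K x :=
  HeightOneSpectrum.valuedAdicCompletion_eq_valuation' v x

lemma prime_of_hom (v : HeightOneSpectrum (𝓞 K)) (ρ : L →+* v.adicCompletion K)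
    (hρ : ∀ x : K, ρ (algebraMap K L x) = emb v x) :
    ∃ w : HeightOneSpectrum (𝓞 L), resP w = v ∧ ∀ y, w.valuation L y = Valued.v (ρ y) := by
  obtain ⟨w, hw⟩ := exists_prime_of_val ((Valued.v : Valuation (v.adicCompletion K) ℤᵐ⁰).comap ρ) (by
    intro a
    rw [Valuation.comap_apply]
    have h2 : IsIntegral (Valued.v : Valuation (v.adicCompletion K) ℤᵐ⁰).integer (ρ (a : L)) := by
      obtain ⟨f, hf, hf0⟩ := a.2
      refine ⟨f.map (Int.castRingHom _), hf.map _, ?_⟩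
      rw [Polynomial.eval₂_map]
      have := congrArg ρ hf0
      rw [Polynomial.hom_eval₂, map_zero] at this
      rw [← this]
      congr 1
      exact RingHom.ext_int _ _
    exact (Valuation.integer.integers (Valued.v : Valuation (v.adicCompletion K) ℤᵐ⁰)).mem_of_integral h2) (by
    obtain ⟨π, hπ⟩ := v.valuation_exists_uniformizer K
    refine ⟨algebraMap K L π, ?_⟩
    rw [Valuation.comap_apply, hρ, emb_val, hπ])
  refine ⟨w, resP_eq_of ?_, fun y => hw y⟩
  intro x hx
  rw [hw, Valuation.comap_apply, hρ, emb_val]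
  exact hx

/-- split primes -/
lemma Kum.split {p : ℕ} {ζ : K} {b : Kˣ} {θ : L} (h : Kum p K ζ (b : K) θ) (v : HeightOneSpectrum (𝓞 K))
    (hb : b ∈ PP p (emb v)) : ∃ P : ℕ → HeightOneSpectrum (𝓞 L), Set.InjOn P (Finset.range p : Set ℕ) ∧
      (∀ i, resP (P i) = v) ∧
      ∀ y, v.valuation K (Algebra.norm K y) = ∏ i ∈ Finset.range p, (P i).valuation L y := by
  obtain ⟨β, hβ⟩ := (mem_PP h.prime.ne_zero).1 hb
  obtain ⟨ρ, hρ⟩ := h.exists_hom (E := v.adicCompletion K) (β := β) (by rw [hβ, emb_eq])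
  have hβ0 : β ≠ 0 := by
    rintro rfl
    rw [zero_pow h.prime.ne_zero] at hβ
    exact b.ne_zero ((map_eq_zero _).1 hβ.symm)
  choose P hP1 hP2 using fun i : ℕ => prime_of_hom v (ρ.toRingHom.comp (h.σ ^ i : L ≃ₐ[K] L).toRingEquiv.toRingHom) (by
    intro x
    change ρ ((h.σ ^ i : L ≃ₐ[K] L) (algebraMap K L x)) = _
    rw [AlgEquiv.commutes, AlgHom.commutes, emb_eq])
  have hP3 : ∀ i y, (P i).valuation L y = Valued.v (ρ (h.σ^[i] y)) := by
    intro i y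
    rw [hP2, ← AlgEquiv.coe_pow]
    rfl
  refine ⟨P, ?_, hP1, ?_⟩
  · intro i hi j hj hij
    by_contra hne
    have hi' : i < p := by simpa using hi
    have hj' : j < p := by simpa using hj
    have hδ : emb v (ζ ^ j) * β - emb v (ζ ^ i) * β ≠ 0 := by
      rw [← sub_mul, ← map_sub]
      refine mul_ne_zero ?_ hβ0
      rw [map_ne_zero, sub_ne_zero]
      intro hh
      exact hne (h.prim.pow_inj hj' hi' hh).symm
    obtain ⟨c, hc⟩ := Metric.denseRange_iff.1 (emb_dense v) (emb v (ζ ^ i) * β) _ (norm_pos_iff.2 hδ)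
    rw [dist_eq_norm] at hc
    have hc' : Valued.v (emb v (ζ ^ i) * β - emb v c) < Valued.v (emb v (ζ ^ j) * β - emb v (ζ ^ i) * β) :=
      Valued.toNormedField.norm_lt_iff.1 hc
    have key : ∀ k, ρ (h.σ^[k] (θ - algebraMap K L c)) = emb v (ζ ^ k) * β - emb v c := by
      intro k
      rw [← AlgEquiv.coe_pow, map_sub, AlgEquiv.commutes, AlgEquiv.coe_pow, h.σ_it_θ, map_sub, map_mul,
        AlgHom.commutes, AlgHom.commutes, hρ, emb_eq]
    have h1 := hP3 i (θ - algebraMap K L c)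
    rw [hij, hP3, key, key] at h1
    have h2 : emb v (ζ ^ j) * β - emb v c = (emb v (ζ ^ j) * β - emb v (ζ ^ i) * β) + (emb v (ζ ^ i) * β - emb v c) := by
      ring
    rw [h2, Valuation.map_add_eq_of_lt_left _ hc'] at h1
    exact hc'.ne h1.symm
  · intro y
    rw [Finset.prod_congr rfl fun i _ => hP3 i y, ← map_prod, ← map_prod, ← h.norm_eq, AlgHom.commutes, ← emb_eq,
      emb_val]

/-- completion map -/
lemma exists_cmap (w : HeightOneSpectrum (𝓞 L)) : ∃ g : (resP (K := K) w).adicCompletion K →+* w.adicCompletion L,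
    ∀ x, g (emb _ x) = emb w (algebraMap K L x) := by
  have hu := HeightOneSpectrum.uniformContinuous_algebraMap_liesOver K L (resP (K := K) w) w
  let f := UniformSpace.Completion.mapRingHom (algebraMap (WithVal ((resP (K := K) w).valuation K)) (WithVal (w.valuation L)))
    hu.continuous
  refine ⟨((HeightOneSpectrum.adicCompletion.equiv L w).symm.toRingHom.comp f).comp
    (HeightOneSpectrum.adicCompletion.equiv K _).toRingHom, fun x => ?_⟩
  apply HeightOneSpectrum.adicCompletion.ext
  change f ((WithVal.toVal _ x : WithVal ((resP (K := K) w).valuation K)) : UniformSpace.Completion _) = _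
  rw [UniformSpace.Completion.mapRingHom_coe]
  rfl

end split
end ABHN
end FileGlob7

section FileGlob8
set_option autoImplicit false
set_option linter.unusedSectionVars false
open scoped TensorProduct
open IsDedekindDomain NumberField WithZero

namespace ABHN

section cnt
variable {K L : Type*} [Field K] [NumberField K] [Field L] [NumberField L] [Algebra K L]

lemma Kum.real_unram {p : ℕ} {ζ : K} {b : Kˣ} {θ : L} (h : Kum p K ζ (b : K) θ) (w : InfinitePlace L)
    (τ : K →+* ℝ) (hw : w.comap (algebraMap K L) = rpl τ) (hb : b ∈ PP p τ) : w.IsReal := by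
  obtain ⟨y, hy⟩ := (mem_PP h.prime.ne_zero).1 hb
  set φ := w.embedding with hφ
  have hφK : φ.comp (algebraMap K L) = Complex.ofRealHom.comp τ := by
    have h1 := InfinitePlace.comap_embedding_of_isReal (w := w) (algebraMap K L) (by rw [hw]; exact rpl_real τ)
    rw [hφ, ← h1, hw, rpl, InfinitePlace.embedding_mk_eq_of_isReal]
    ext x
    simp
  have hφK' : ∀ x, φ (algebraMap K L x) = (τ x : ℂ) := fun x => RingHom.congr_fun hφK x
  have hprim : IsPrimitiveRoot ((τ ζ : ℝ) : ℂ) p :=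
    (h.prim.map_of_injective τ.injective).map_of_injective Complex.ofRealHom.injective
  have hy0 : (y : ℂ) ≠ 0 := by
    intro h0
    have : y = 0 := by exact_mod_cast h0
    rw [this, zero_pow h.prime.ne_zero] at hy
    exact b.ne_zero ((map_eq_zero _).1 hy.symm)
  have h2 : (φ θ / y) ^ p = 1 := by
    rw [div_pow, ← map_pow, h.pow, hφK', ← hy]
    push_cast
    exact div_self (pow_ne_zero _ hy0)
  have : NeZero p := ⟨h.prime.ne_zero⟩
  obtain ⟨i, -, hi⟩ := hprim.eq_pow_of_pow_eq_one h2
  rw [eq_div_iff hy0] at hi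
  have hθ : (starRingEnd ℂ) (φ θ) = φ θ := by
    rw [← hi]
    simp
  rw [InfinitePlace.isReal_iff]
  ext z
  obtain ⟨f, rfl⟩ := h.exists_aeval z
  change (starRingEnd ℂ) (φ _) = φ _
  rw [Polynomial.aeval_def, Polynomial.hom_eval₂, Polynomial.hom_eval₂, hθ]
  congr 1
  rw [hφK]
  ext x
  simp

lemma Kum.count_inf {p : ℕ} {ζ : K} {b : Kˣ} {θ : L} (h : Kum p K ζ (b : K) θ) (U : Finset (K →+* ℝ))
    (hU : ∀ τ, b ∉ PP p τ → τ ∈ U) :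
    p * Fintype.card (InfinitePlace K) ≤ Fintype.card (InfinitePlace L) + (p-1) * U.card := by
  classical
  have := h.galois
  have h1 := InfinitePlace.card_eq_card_isUnramifiedIn (k := K) (K := L)
  rw [h.rank] at h1
  set A : Finset (InfinitePlace K) := {w : InfinitePlace K | w.IsUnramifiedIn L} with hA
  have h2 := Finset.card_add_card_compl A
  have h3 : Aᶜ.card ≤ U.card := by
    refine le_trans (Finset.card_le_card ?_) (Finset.card_image_le (s := U) (f := rpl))
    intro v hv
    have hv' : ¬ v.IsUnramifiedIn L := by simpa [hA] using hv
    obtain ⟨w, rfl⟩ := InfinitePlace.comap_surjective (K := L) v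
    rw [InfinitePlace.isUnramifiedIn_comap, InfinitePlace.not_isUnramified_iff] at hv'
    obtain ⟨τ, hτ⟩ := rpl_surj _ hv'.2
    rw [Finset.mem_image]
    refine ⟨τ, hU τ fun hb => ?_, hτ⟩
    exact InfinitePlace.not_isReal_iff_isComplex.2 hv'.1 (h.real_unram w τ hτ.symm hb)
  have h4 : 1 ≤ p / 2 := by have := h.prime.two_le; omega
  obtain ⟨q, rfl⟩ : ∃ q, p = q + 1 := ⟨p - 1, by have := h.prime.two_le; omega⟩
  rw [h1, ← h2]
  simp only [add_tsub_cancel_right]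
  nlinarith [Nat.mul_le_mul_left Aᶜ.card h4, Nat.mul_le_mul_left q h3]

lemma Kum.count_fin {p : ℕ} {ζ : K} {b : Kˣ} {θ : L} (h : Kum p K ζ (b : K) θ) (S U : Finset (HeightOneSpectrum (𝓞 K)))
    (hU : ∀ v ∈ S, b ∉ PP p (emb v) → v ∈ U) :
    p * S.card ≤ (SL L S).card + (p-1) * U.card := by
  classical
  have h1 : ∀ v ∈ S, p ≤ ((SL L S).filter (fun w => resP w = v)).card + if v ∈ U then p - 1 else 0 := by
    intro v hv
    split_ifs with hvU
    · obtain ⟨w, hw⟩ := resP_surj (L := L) v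
      have : 0 < ((SL L S).filter (fun w => resP w = v)).card := by
        rw [Finset.card_pos]
        exact ⟨w, by rw [Finset.mem_filter, mem_SL, hw]; exact ⟨hv, rfl⟩⟩
      omega
    · have hb : b ∈ PP p (emb v) := by
        by_contra hb
        exact hvU (hU v hv hb)
      obtain ⟨P, hP1, hP2, -⟩ := h.split v hb
      rw [add_zero]
      calc p = (Finset.range p).card := by simp
        _ = ((Finset.range p).image P).card := (Finset.card_image_of_injOn hP1).symm
        _ ≤ _ := by
          apply Finset.card_le_card
          intro w hw
          obtain ⟨i, -, rfl⟩ := Finset.mem_image.1 hw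
          rw [Finset.mem_filter, mem_SL, hP2]
          exact ⟨hv, rfl⟩
  have h2 := Finset.sum_le_sum h1
  rw [Finset.sum_const, smul_eq_mul, Finset.sum_add_distrib, mul_comm] at h2
  refine h2.trans (add_le_add ?_ ?_)
  · rw [Finset.card_eq_sum_card_fiberwise (f := fun w => resP (K := K) w) (t := S)]
    intro w hw
    exact mem_SL.1 hw
  · rw [← Finset.sum_filter, Finset.sum_const, smul_eq_mul, mul_comm]
    gcongr
    intro v hv
    exact (Finset.mem_filter.1 hv).2

lemma Kum.count {p : ℕ} {ζ : K} {b : Kˣ} {θ : L} (h : Kum p K ζ (b : K) θ) (S : Finset (HeightOneSpectrum (𝓞 K))) :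
    p * (S.card + Fintype.card (InfinitePlace K)) ≤
      (SL L S).card + Fintype.card (InfinitePlace L) + (p-1) * nsp p b S := by
  classical
  have h1 := h.count_fin S (S.filter fun v => b ∉ PP p (emb v)) (fun v hv hb => Finset.mem_filter.2 ⟨hv, hb⟩)
  have h2 := h.count_inf (Finset.univ.filter fun τ => b ∉ PP p τ) (fun τ hb => Finset.mem_filter.2 ⟨Finset.mem_univ _, hb⟩)
  have h3 : nsp p b S = (S.filter fun v => b ∉ PP p (emb v)).card +
      (Finset.univ.filter fun τ : K →+* ℝ => b ∉ PP p τ).card := by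
    unfold nsp SR
    rw [← Finset.card_disjSum]
    congr 1
    ext v
    rcases v with v | τ
    · rw [Finset.mem_filter, Finset.inl_mem_disjSum, Finset.inl_mem_disjSum, Finset.mem_filter]
      rfl
    · rw [Finset.mem_filter, Finset.inr_mem_disjSum, Finset.inr_mem_disjSum, Finset.mem_filter]
      rfl
  rw [h3, mul_add, mul_add]
  omega

/-- first inequality -/
theorem Kum.FI {p : ℕ} {ζ : K} {b : Kˣ} {θ : L} (h : Kum p K ζ (b : K) θ) {S : Finset (HeightOneSpectrum (𝓞 K))}
    (hS : Good p (b : K) S) :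
    (Nb h.prime ζ (b : K)).relIndex (US S) * p ≤ p ^ nsp p b S ∧ (Nb h.prime ζ (b : K)).relIndex (US S) ≠ 0 := by
  obtain ⟨h1, h2⟩ := h.FI_gamma hS
  refine ⟨?_, h2⟩
  have h3 := h.count S
  set R := (Nb h.prime ζ (b : K)).relIndex (US S)
  have hK : 0 < Fintype.card (InfinitePlace K) := Fintype.card_pos
  have hL : 0 < Fintype.card (InfinitePlace L) := Fintype.card_pos
  set A := S.card + Fintype.card (InfinitePlace K) with hA
  set B := (SL L S).card + Fintype.card (InfinitePlace L) with hB
  have hp := h.prime.two_le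
  obtain ⟨q, rfl⟩ : ∃ q, p = q + 1 := ⟨p - 1, by omega⟩
  simp only [add_tsub_cancel_right] at *
  have hq : q ≠ 0 := by omega
  refine le_of_pow_le_pow_left₀ hq (Nat.zero_le _) ?_
  have h4 : 0 < (q+1) ^ (B - 1) := by positivity
  refine Nat.le_of_mul_le_mul_right ?_ h4
  calc (R * (q+1)) ^ q * (q+1) ^ (B-1) = (R ^ q * (q+1) ^ (B-1)) * (q+1) ^ q := by rw [mul_pow]; ring
    _ ≤ (q+1) ^ ((q+1) * (A - 1)) * (q+1)^q := Nat.mul_le_mul_right _ h1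
    _ = (q+1) ^ ((q+1) * (A - 1) + q) := by rw [pow_add]
    _ ≤ (q+1) ^ (nsp (q+1) b S * q + (B-1)) := by
      apply Nat.pow_le_pow_right (by omega)
      obtain ⟨A', hA'⟩ : ∃ A', A = A' + 1 := ⟨A - 1, by omega⟩
      obtain ⟨B', hB'⟩ : ∃ B', B = B' + 1 := ⟨B - 1, by omega⟩
      rw [hA', hB'] at h3 ⊢
      simp only [add_tsub_cancel_right]
      rw [mul_comm (nsp _ _ _) q]
      nlinarith
    _ = _ := by rw [pow_add, pow_mul]

/-- general consequence -/
lemma FI_abstract {G : Type*} [CommGroup G] (U N M : Subgroup G) (hM : M ≤ N) {p k : ℕ} (hp : 1 < p)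
    (h1 : M.relIndex U * p ≤ p ^ k) (h0 : M.relIndex U ≠ 0) (h2 : p ^ k ≤ N.index) :
    U ⊔ N ≠ ⊤ ∧ ((U ⊔ N).index ≤ p → (U ⊔ N).index ≠ 0 → ∀ x ∈ U, x ∈ N → x ∈ M) := by
  have hr : N.relIndex U * (U ⊔ N).index = N.index := by
    rw [← Subgroup.relIndex_sup_right, sup_comm, Subgroup.relIndex_mul_index le_sup_left]
  have hdvd : N.relIndex U ∣ M.relIndex U := Subgroup.relIndex_dvd_of_le_left U hM
  have hle : N.relIndex U ≤ M.relIndex U := Nat.le_of_dvd (Nat.pos_of_ne_zero h0) hdvd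
  have hpos : 0 < M.relIndex U := Nat.pos_of_ne_zero h0
  constructor
  · intro ht
    rw [ht, Subgroup.index_top, mul_one] at hr
    nlinarith
  · intro h3 h4 x hxU hxN
    have h5 : M.relIndex U = N.relIndex U := by
      apply le_antisymm _ hle
      have : M.relIndex U * p ≤ N.relIndex U * p :=
        calc _ ≤ N.index := h1.trans h2
          _ = N.relIndex U * (U ⊔ N).index := hr.symm
          _ ≤ _ := Nat.mul_le_mul_left _ h3
      exact Nat.le_of_mul_le_mul_right this (by omega)
    have h6 : M.subgroupOf U ≤ N.subgroupOf U := fun y hy => hM hy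
    have h7 := Subgroup.relIndex_mul_index h6
    change _ * N.relIndex U = M.relIndex U at h7
    rw [h5] at h7
    have h8 : (M.subgroupOf U).relIndex (N.subgroupOf U) = 1 := by
      have : 0 < N.relIndex U := by rw [← h5]; exact hpos
      exact Nat.eq_of_mul_eq_mul_right this (by rw [h7, one_mul])
    rw [Subgroup.relIndex_eq_one] at h8
    exact h8 (show (⟨x, hxU⟩ : U) ∈ N.subgroupOf U from hxN)

lemma Nb_le_NS {p : ℕ} (hp : p.Prime) (ζ b : K) (S : Finset (HeightOneSpectrum (𝓞 K))) : Nb hp ζ b ≤ NS hp ζ b S := by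
  unfold NS
  refine le_iInf₂ fun v _ => ?_
  intro x hx
  have hx' : NormRes p ζ b (x : K) := hx
  cases v with
  | inl v => exact hx'.map (emb v)
  | inr τ => exact hx'.map τ

end cnt

section abs
universe u
variable {K : Type u} [Field K] [NumberField K]

theorem exists_Kum' {p : ℕ} (hp : p.Prime) {ζ : K} (hζ : IsPrimitiveRoot ζ p) {b : Kˣ} (hb : ∀ y : Kˣ, y ^ p ≠ b) :
    ∃ (L : Type u) (_ : Field L) (_ : NumberField L) (_ : Algebra K L) (θ : L), Kum p K ζ (b : K) θ := by
  have hb' : ∀ y : K, y ^ p ≠ b := by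
    intro y hy
    have hy0 : y ≠ 0 := by
      rintro rfl
      rw [zero_pow hp.ne_zero] at hy
      exact b.ne_zero hy.symm
    exact hb (Units.mk0 y hy0) (by ext; simpa using hy)
  have hirr : Irreducible (Polynomial.X ^ p - Polynomial.C (b : K)) :=
    X_pow_sub_C_irreducible_of_prime hp hb'
  have : Fact (Irreducible (Polynomial.X ^ p - Polynomial.C (b : K))) := ⟨hirr⟩
  have hK := exists_Kum hp hζ hb'
  have := hK.finDim
  have hn : NumberField (AdjoinRoot (Polynomial.X ^ p - Polynomial.C (b : K))) := NumberField.of_module_finite K _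
  exact ⟨_, _, hn, _, _, hK⟩

theorem FI_ne_top {p : ℕ} (hp : p.Prime) {ζ : K} (hζ : IsPrimitiveRoot ζ p) {b : Kˣ} (hb : ∀ y : Kˣ, y ^ p ≠ b)
    {S : Finset (HeightOneSpectrum (𝓞 K))} (hS : Good p (b : K) S) : US S ⊔ NS hp ζ b S ≠ ⊤ := by
  obtain ⟨L, _, _, _, θ, h⟩ := exists_Kum' hp hζ hb
  obtain ⟨h1, h2⟩ := h.FI hS
  exact (FI_abstract (US S) (NS hp ζ b S) (Nb hp ζ b) (Nb_le_NS hp ζ b S) hp.one_lt h1 h2 (NS_index hp hζ b S)).1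

theorem FI_norm {p : ℕ} (hp : p.Prime) {ζ : K} (hζ : IsPrimitiveRoot ζ p) {b : Kˣ} (hb : ∀ y : Kˣ, y ^ p ≠ b)
    {S : Finset (HeightOneSpectrum (𝓞 K))} (hS : Good p (b : K) S) (h3 : (US S ⊔ NS hp ζ b S).index ≤ p)
    (h4 : (US S ⊔ NS hp ζ b S).index ≠ 0) : ∀ x ∈ US S, x ∈ NS hp ζ b S → x ∈ Nb hp ζ b := by
  obtain ⟨L, _, _, _, θ, h⟩ := exists_Kum' hp hζ hb
  obtain ⟨h1, h2⟩ := h.FI hS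
  exact (FI_abstract (US S) (NS hp ζ b S) (Nb hp ζ b) (Nb_le_NS hp ζ b S) hp.one_lt h1 h2 (NS_index hp hζ b S)).2 h3 h4

end abs
end ABHN
end FileGlob8

section FileGlob9
set_option autoImplicit false
set_option linter.unusedSectionVars false
open scoped TensorProduct
open IsDedekindDomain NumberField WithZero

namespace ABHN

section five
universe u
variable {K : Type u} [Field K] [NumberField K]

lemma Kum.norm_val {L : Type*} [Field L] [NumberField L] [Algebra K L] {p : ℕ} {ζ : K} {x : Kˣ} {θ : L}
    (h : Kum p K ζ (x : K) θ) {T : Finset (HeightOneSpectrum (𝓞 K))} (hT : ClOK (SL L T))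
    (hx : ∀ v ∉ T, x ∈ PP p (emb v)) (α : Kˣ) :
    ∃ y : Lˣ, ∀ v ∉ T, v.valuation K (Algebra.norm K (y : L)) = v.valuation K (α : K) := by
  classical
  have hP : ∀ v : HeightOneSpectrum (𝓞 K), ∃ P : ℕ → HeightOneSpectrum (𝓞 L), v ∉ T →
      Set.InjOn P (Finset.range p : Set ℕ) ∧ (∀ i, resP (P i) = v) ∧
      ∀ y, v.valuation K (Algebra.norm K y) = ∏ i ∈ Finset.range p, (P i).valuation L y := by
    intro v
    by_cases hv : v ∈ T
    · exact ⟨fun _ => (resP_surj (L := L) v).choose, fun hh => absurd hv hh⟩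
    · obtain ⟨P, hP⟩ := h.split v (hx v hv)
      exact ⟨P, fun _ => hP⟩
  choose P hP using hP
  obtain ⟨y, hy⟩ := hT.exists_val (fun w => if w = P (resP w) 0 then log ((resP (K := K) w).valuation K (α : K)) else 0)
    (SL L (finite_supp α).toFinset) (by
      intro w hw hw2
      have hw3 : (resP (K := K) w).valuation K (α : K) = 1 := by
        by_contra hne
        apply hw2
        rw [mem_SL]
        simpa using hne
      rw [hw3, log_one, ite_self])
  refine ⟨y, fun v hv => ?_⟩
  obtain ⟨h1, h2, h3⟩ := hP v hv
  have hr0 : 0 ∈ Finset.range p := Finset.mem_range.2 h.prime.pos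
  rw [h3, Finset.prod_eq_single_of_mem 0 hr0]
  · rw [hy _ (by rw [mem_SL, h2]; exact hv), h2, if_pos rfl, exp_log]
    exact (Valuation.ne_zero_iff _).2 α.ne_zero
  · intro i hi hi0
    rw [hy _ (by rw [mem_SL, h2]; exact hv), h2, if_neg, exp_zero]
    intro hh
    exact hi0 (h1 (by simpa using hi) (by simpa using hr0) hh)

/-- a non-p-th power is a local non-p-th power at infinitely many primes -/
theorem exists_nonsplit {p : ℕ} (hp : p.Prime) {ζ : K} (hζ : IsPrimitiveRoot ζ p) {x : Kˣ} (hx : ∀ y : Kˣ, y ^ p ≠ x)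
    (S : Finset (HeightOneSpectrum (𝓞 K))) : ∃ v ∉ S, x ∉ PP p (emb v) := by
  classical
  by_contra! hc
  obtain ⟨L, _, _, _, θ, h⟩ := exists_Kum' hp hζ hx
  obtain ⟨S0, hS0⟩ := exists_Good (K := K) hp.ne_zero x.ne_zero
  obtain ⟨S1, hS1⟩ := cl_one L
  let T := S ∪ S0 ∪ S1.image (fun w => resP (K := K) w)
  have hT1 : Good p (x : K) T := hS0.mono (by intro v hv; simp [T, hv])
  have hT2 : ClOK (SL L T) := ClOK.mono (S := S1) hS1 (by
    intro w hw
    rw [mem_SL]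
    refine Finset.mem_union_right _ (Finset.mem_image_of_mem _ hw))
  apply FI_ne_top hp hζ hx hT1
  rw [eq_top_iff]
  intro α _
  obtain ⟨y, hy⟩ := h.norm_val hT2 (fun v hv => hc v fun hh => hv (by simp [T, hh])) α
  have hn0 : Algebra.norm K (y : L) ≠ 0 := by
    have := h.finDim
    exact Algebra.norm_ne_zero_iff.2 y.ne_zero
  have hα : α = (α * (Units.mk0 _ hn0)⁻¹) * Units.mk0 _ hn0 := by simp
  rw [hα]
  refine Subgroup.mul_mem_sup ?_ ?_
  · intro v hv
    rw [Units.val_mul, map_mul, Units.val_inv_eq_inv_val, map_inv₀, Units.val_mk0, hy v hv, mul_inv_cancel₀]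
    exact (Valuation.ne_zero_iff _).2 α.ne_zero
  · apply Nb_le_NS
    change NormRes p ζ x _
    rw [h.normRes_iff]
    exact ⟨y, rfl⟩

lemma Kum.pow_of_pow {F L : Type*} [Field F] [Field L] [Algebra F L] {p : ℕ} {ζ b : F} {θ : L} (h : Kum p F ζ b θ)
    {x : F} {z : L} (hz : z ^ p = algebraMap F L x) : ∃ (j : ℕ) (c : F), x = b ^ j * c ^ p := by
  by_cases hz0 : z = 0
  · refine ⟨0, 0, ?_⟩
    rw [hz0, zero_pow h.prime.ne_zero, ← map_zero (algebraMap F L)] at hz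
    rw [zero_pow h.prime.ne_zero, mul_zero]
    exact ((algebraMap F L).injective hz).symm
  have : NeZero p := ⟨h.prime.ne_zero⟩
  have h1 : (h.σ z / z) ^ p = 1 := by
    rw [div_pow, ← map_pow, hz, AlgEquiv.commutes, div_self]
    rw [← hz]
    exact pow_ne_zero _ hz0
  obtain ⟨i, hi, hi2⟩ := (h.prim.map_of_injective (algebraMap F L).injective).eq_pow_of_pow_eq_one h1
  rw [eq_div_iff hz0] at hi2
  have hζ0 : algebraMap F L ζ ≠ 0 := by
    rw [map_ne_zero]
    exact h.prim.ne_zero h.prime.ne_zero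
  have hθ0 := h.θ_ne_zero
  obtain ⟨c, hc⟩ := h.fixed (z / θ ^ i) (by
    rw [map_div₀, map_pow, h.σ_θ, ← hi2, mul_pow]
    field_simp)
  refine ⟨i, c, ?_⟩
  apply (algebraMap F L).injective
  rw [map_mul, map_pow, map_pow, hc, ← hz, ← h.pow, div_pow]
  field_simp
  ring

/-- step (5) -/
theorem exists_sep {p : ℕ} (hp : p.Prime) {ζ : K} (hζ : IsPrimitiveRoot ζ p) {b : Kˣ} (hb : ∀ y : Kˣ, y ^ p ≠ b)
    {S : Finset (HeightOneSpectrum (𝓞 K))} (hS : Good p (b : K) S) {x : Kˣ} (hxS : x ∈ US S)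
    (hx : ∀ (j : ℕ) (c : Kˣ), x ≠ b ^ j * c ^ p) : ∃ v ∉ S, b ∈ PP p (emb v) ∧ x ∉ PP p (emb v) := by
  classical
  by_contra! hc
  obtain ⟨L, _, _, _, θ, h⟩ := exists_Kum' hp hζ hb
  obtain ⟨w, hw, hxw⟩ := exists_nonsplit (K := L) hp (hζ.map_of_injective (algebraMap K L).injective)
    (x := Units.map (algebraMap K L : K →* L) x) (by
      intro y hy
      have hy' : (y : L) ^ p = algebraMap K L x := by
        rw [← Units.val_pow_eq_pow_val, hy]
        rfl
      obtain ⟨j, c, hjc⟩ := h.pow_of_pow hy'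
      have hc0 : c ≠ 0 := by
        rintro rfl
        rw [zero_pow hp.ne_zero, mul_zero] at hjc
        exact x.ne_zero hjc
      exact hx j (Units.mk0 c hc0) (by ext; simpa using hjc)) (SL L S)
  apply hxw
  rw [mem_SL] at hw
  obtain ⟨g, hg⟩ := exists_cmap (K := K) w
  have hmap : ∀ z : Kˣ, z ∈ PP p (emb (resP (K := K) w)) → Units.map (algebraMap K L : K →* L) z ∈ PP p (emb w) := by
    intro z hz
    obtain ⟨y, hy⟩ := (mem_PP hp.ne_zero).1 hz
    refine (mem_PP hp.ne_zero).2 ⟨g y, ?_⟩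
    rw [← map_pow, hy, hg]
    rfl
  by_cases hbv : b ∈ PP p (emb (resP (K := K) w))
  · exact hmap _ (hc _ hw hbv)
  · obtain ⟨j, hj⟩ := fin_tame_units (resP (K := K) w) hp hζ (hS.hp _ hw) (hS.hb _ hw) (hxS _ hw) hbv
    have h1 := hmap _ hj
    have h2 : Units.map (algebraMap K L : K →* L) b ∈ PP p (emb w) := by
      refine (mem_PP hp.ne_zero).2 ⟨emb w θ, ?_⟩
      rw [← map_pow, h.pow]
      rfl
    have h3 := mul_mem h1 (pow_mem h2 j)
    rw [← map_pow, ← map_mul, inv_mul_cancel_right] at h3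
    exact h3

end five
end ABHN
end FileGlob9

section FileGlob10
set_option autoImplicit false
set_option linter.unusedSectionVars false
open scoped TensorProduct
open IsDedekindDomain NumberField WithZero

namespace ABHN

lemma relIndex_le_of_cyc {G : Type*} [CommGroup G] (P A : Subgroup G) (x : G) (hx : x ∈ A) {p : ℕ} (hp : 0 < p)
    (hxp : x ^ p ∈ P) (h : ∀ u ∈ A, ∃ j : ℕ, u * (x ^ j)⁻¹ ∈ P) : P.relIndex A ≤ p ∧ P.relIndex A ≠ 0 := by
  have hs : Function.Surjective (fun j : Fin p => (QuotientGroup.mk (⟨x ^ (j:ℕ), pow_mem hx _⟩ : A) : A ⧸ P.subgroupOf A)) := by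
    intro q
    induction q using QuotientGroup.induction_on with
    | H u =>
      obtain ⟨j, hj⟩ := h u u.2
      refine ⟨⟨j % p, Nat.mod_lt _ hp⟩, ?_⟩
      rw [QuotientGroup.eq, Subgroup.mem_subgroupOf]
      change (x ^ (j % p))⁻¹ * (u : G) ∈ P
      have h1 : (x ^ (j % p))⁻¹ * (u : G) = (u * (x ^ j)⁻¹) * (x ^ p) ^ (j / p) := by
        conv_rhs => rw [← Nat.mod_add_div j p, pow_add, pow_mul]
        rw [Nat.add_mul_div_left _ _ hp, Nat.mod_div_self, zero_add, mul_inv]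
        group
        rw [mul_comm]
      rw [h1]
      exact mul_mem hj (pow_mem hxp _)
  have : Finite (A ⧸ P.subgroupOf A) := Finite.of_surjective _ hs
  constructor
  · have := Nat.card_le_card_of_surjective _ hs
    rw [Nat.card_fin] at this
    exact this
  · exact Subgroup.index_ne_zero_of_finite

section three
universe u
variable {K : Type u} [Field K] [NumberField K]

/-- p-th powers -/
def RR (K : Type*) [Field K] (p : ℕ) : Subgroup Kˣ := (powMonoidHom p : Kˣ →* Kˣ).range

lemma US_pow_index {p : ℕ} (hp : p.Prime) {ζ : K} (hζ : IsPrimitiveRoot ζ p) (S : Finset (HeightOneSpectrum (𝓞 K))) :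
    (RR K p).relIndex (US S) = p ^ (S.card + Fintype.card (InfinitePlace K)) := by
  obtain ⟨h1, h2, h3⟩ := HasQ_US hp.ne_zero S
  have hr : (powMonoidHom p : US S →* US S).range = (RR K p).subgroupOf (US S) := by
    ext x
    rw [Subgroup.mem_subgroupOf]
    constructor
    · rintro ⟨y, rfl⟩
      exact ⟨y, rfl⟩
    · rintro ⟨y, hy⟩
      refine ⟨⟨y, fun v hv => ?_⟩, Subtype.ext hy⟩
      have := x.2 v hv
      rw [← hy] at this
      exact val_root_of_unity (n := p) hp.ne_zero (by simpa using this)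
  have hζu : ∀ z : Kˣ, z ^ p = 1 → z ∈ US S := by
    intro z hz v hv
    apply val_root_of_unity (n := p) hp.ne_zero
    rw [← Units.val_pow_eq_pow_val, hz]
    simp
  have hk : Nat.card (powMonoidHom p : US S →* US S).ker = p := by
    have : NeZero p := ⟨hp.ne_zero⟩
    refine Eq.trans (b := Nat.card (rootsOfUnity p K)) ?_ hζ.card_rootsOfUnity
    refine Nat.card_congr ⟨fun x => ⟨((x : US S) : Kˣ), ?_⟩, fun z => ⟨⟨(z : Kˣ), hζu _ ((mem_rootsOfUnity _ _).1 z.2)⟩, ?_⟩, fun x => rfl, fun x => rfl⟩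
    · rw [mem_rootsOfUnity]
      exact congrArg Subtype.val (MonoidHom.mem_ker.1 x.2)
    · rw [MonoidHom.mem_ker]
      exact Subtype.ext ((mem_rootsOfUnity _ _).1 z.2)
  rw [Subgroup.relIndex, ← hr]
  rw [hk] at h3
  have h4 : 0 < Fintype.card (InfinitePlace K) := Fintype.card_pos
  have h5 : S.card + Fintype.card (InfinitePlace K) = S.card + Fintype.card (InfinitePlace K) - 1 + 1 := by omega
  rw [h5, pow_succ]
  exact_mod_cast h3

/-- local p-th powers at T -/
noncomputable def PT (p : ℕ) (T : Finset (HeightOneSpectrum (𝓞 K))) : Subgroup Kˣ := ⨅ v ∈ T, PP p (emb v)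

lemma mem_PT {p : ℕ} {T : Finset (HeightOneSpectrum (𝓞 K))} {x : Kˣ} : x ∈ PT p T ↔ ∀ v ∈ T, x ∈ PP p (emb v) := by
  simp [PT, Subgroup.mem_iInf]

theorem exists_T {p : ℕ} (hp : p.Prime) {ζ : K} (hζ : IsPrimitiveRoot ζ p) {b : Kˣ} (hb : ∀ y : Kˣ, y ^ p ≠ b)
    {S : Finset (HeightOneSpectrum (𝓞 K))} (hS : Good p (b : K) S) (k : ℕ)
    (hk : k + 1 ≤ S.card + Fintype.card (InfinitePlace K)) :
    ∃ T : Finset (HeightOneSpectrum (𝓞 K)), T.card = k ∧ Disjoint S T ∧ (∀ v ∈ T, b ∈ PP p (emb v)) ∧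
      ((PT p T).relIndex (US S) ≤ p ^ k ∧ (PT p T).relIndex (US S) ≠ 0) ∧
      ∀ α : Kˣ, (∀ v ∈ T, v.valuation K (α : K) = 1) → ∃ u ∈ US S, ∀ v ∈ T, α * u⁻¹ ∈ PP p (emb v) := by
  classical
  induction k with
  | zero =>
    refine ⟨∅, rfl, Finset.disjoint_empty_right _, by simp, ?_, fun α _ => ⟨1, one_mem _, by simp⟩⟩
    have : PT (K := K) p ∅ = ⊤ := by simp [PT]
    rw [this]
    simp
  | succ k ih =>
    obtain ⟨T, hT1, hT2, hT3, ⟨hT4, hT5⟩, hT6⟩ := ih (by omega)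
    have hbS : b ∈ US S := hS.hb
    obtain ⟨x, hx1, hx2, hx3⟩ : ∃ x ∈ US S, x ∈ PT p T ∧ ∀ (j : ℕ) (c : Kˣ), x ≠ b ^ j * c ^ p := by
      by_contra! hc
      have h1 := relIndex_le_of_cyc (RR K p) (US S ⊓ PT p T) b ⟨hbS, mem_PT.2 hT3⟩ hp.pos ⟨b, rfl⟩ (by
        rintro u ⟨hu1, hu2⟩
        obtain ⟨j, c, hjc⟩ := hc u hu1 hu2
        refine ⟨j, c, ?_⟩
        rw [hjc, mul_comm, inv_mul_cancel_left]
        rfl)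
      have h2 : (RR K p ⊓ (US S ⊓ PT p T)).relIndex (US S ⊓ PT p T) * (US S ⊓ PT p T).relIndex (US S) =
          (RR K p ⊓ (US S ⊓ PT p T)).relIndex (US S) :=
        Subgroup.relIndex_mul_relIndex _ _ _ inf_le_right inf_le_left
      rw [Subgroup.inf_relIndex_right, Subgroup.inf_relIndex_left] at h2
      have h3 : (RR K p).relIndex (US S) ≤ (RR K p ⊓ (US S ⊓ PT p T)).relIndex (US S) := by
        refine Nat.le_of_dvd (Nat.pos_of_ne_zero ?_) (Subgroup.relIndex_dvd_of_le_left _ inf_le_left)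
        rw [← h2]
        exact mul_ne_zero h1.2 hT5
      rw [US_pow_index hp hζ, ← h2] at h3
      have h4 : p ^ (S.card + Fintype.card (InfinitePlace K)) ≤ p ^ (k+1) := by
        refine h3.trans ?_
        rw [pow_succ, mul_comm]
        exact Nat.mul_le_mul hT4 h1.1
      have := (Nat.pow_le_pow_iff_right hp.one_lt).1 h4
      omega
    obtain ⟨v, hvS, hbv, hxv⟩ := exists_sep hp hζ hb hS hx1 hx3
    have hvT : v ∉ T := fun hh => hxv (mem_PT.1 hx2 v hh)
    have htame : ∀ u : Kˣ, v.valuation K (u : K) = 1 → ∃ j : ℕ, u * (x ^ j)⁻¹ ∈ PP p (emb v) := fun u hu =>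
      fin_tame_units v hp hζ (hS.hp v hvS) (hx1 v hvS) hu hxv
    refine ⟨insert v T, ?_, ?_, ?_, ?_, ?_⟩
    · rw [Finset.card_insert_of_notMem hvT, hT1]
    · rw [Finset.disjoint_insert_right]
      exact ⟨hvS, hT2⟩
    · intro v' hv'
      rcases Finset.mem_insert.1 hv' with rfl | hv'
      · exact hbv
      · exact hT3 v' hv'
    · have h1 := relIndex_le_of_cyc (PP p (emb v)) (US S ⊓ PT p T) x ⟨hx1, hx2⟩ hp.pos (pow_mem_PP _ _) (by
        rintro u ⟨hu1, hu2⟩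
        exact htame u (hu1 v hvS))
      have h2 : (PP p (emb v) ⊓ (US S ⊓ PT p T)).relIndex (US S ⊓ PT p T) * (US S ⊓ PT p T).relIndex (US S) =
          (PP p (emb v) ⊓ (US S ⊓ PT p T)).relIndex (US S) :=
        Subgroup.relIndex_mul_relIndex _ _ _ inf_le_right inf_le_left
      have h3 : PP p (emb v) ⊓ (US S ⊓ PT p T) = US S ⊓ PT p (insert v T) := by
        ext z
        simp only [Subgroup.mem_inf, mem_PT, Finset.mem_insert, forall_eq_or_imp]
        tauto
      rw [Subgroup.inf_relIndex_right, h3, Subgroup.inf_relIndex_left, Subgroup.inf_relIndex_left] at h2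
      rw [← h2]
      refine ⟨?_, mul_ne_zero h1.2 hT5⟩
      rw [pow_succ, mul_comm]
      exact Nat.mul_le_mul hT4 h1.1
    · intro α hα
      obtain ⟨u, hu, huT⟩ := hT6 α fun v' hv' => hα v' (Finset.mem_insert_of_mem hv')
      obtain ⟨j, hj⟩ := htame (α * u⁻¹) (by
        rw [Units.val_mul, map_mul, Units.val_inv_eq_inv_val, map_inv₀, hα v (Finset.mem_insert_self _ _), hu v hvS,
          inv_one, one_mul])
      refine ⟨u * x ^ j, mul_mem hu (pow_mem hx1 j), ?_⟩
      have h1 : α * (u * x ^ j)⁻¹ = α * u⁻¹ * (x ^ j)⁻¹ := by rw [mul_inv, mul_assoc]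
      intro v' hv'
      rw [h1]
      rcases Finset.mem_insert.1 hv' with rfl | hv'
      · exact hj
      · exact mul_mem (huT v' hv') (inv_mem (pow_mem (mem_PT.1 hx2 v' hv') j))

lemma mem_NS {p : ℕ} {hp : p.Prime} {ζ b : K} {S : Finset (HeightOneSpectrum (𝓞 K))} {x : Kˣ} :
    x ∈ NS hp ζ b S ↔ (∀ v ∈ S, x ∈ NN hp (emb v) ζ b) ∧ ∀ τ : K →+* ℝ, x ∈ NN hp τ ζ b := by
  rw [NS]
  simp only [Subgroup.mem_iInf]
  constructor
  · intro h
    exact ⟨fun v hv => h (.inl v) (mem_SR_inl.2 hv), fun τ => h (.inr τ) mem_SR_inr⟩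
  · rintro ⟨h1, h2⟩ (v | τ) hv
    · exact h1 v (mem_SR_inl.1 hv)
    · exact h2 τ

lemma mem_PS {p : ℕ} {S : Finset (HeightOneSpectrum (𝓞 K))} {x : Kˣ} :
    x ∈ PS p S ↔ (∀ v ∈ S, x ∈ PP p (emb v)) ∧ ∀ τ : K →+* ℝ, x ∈ PP p τ := by
  rw [PS]
  simp only [Subgroup.mem_iInf]
  constructor
  · intro h
    exact ⟨fun v hv => h (.inl v) (mem_SR_inl.2 hv), fun τ => h (.inr τ) mem_SR_inr⟩
  · rintro ⟨h1, h2⟩ (v | τ) hv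
    · exact h1 v (mem_SR_inl.1 hv)
    · exact h2 τ

theorem PS_inf_le {p : ℕ} (hp : p.Prime) {ζ : K} (hζ : IsPrimitiveRoot ζ p) {b : Kˣ}
    {S T : Finset (HeightOneSpectrum (𝓞 K))} [DecidableEq (HeightOneSpectrum (𝓞 K))]
    (hS : Good p (b : K) S) (hST : Disjoint S T)
    (hT : ∀ α : Kˣ, (∀ v ∈ T, v.valuation K (α : K) = 1) → ∃ u ∈ US S, ∀ v ∈ T, α * u⁻¹ ∈ PP p (emb v))
    {x : Kˣ} (hx1 : x ∈ US (S ∪ T)) (hx2 : x ∈ PS p S) : x ∈ RR K p := by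
  by_contra hx
  have hx' : ∀ y : Kˣ, y ^ p ≠ x := fun y hy => hx ⟨y, hy⟩
  obtain ⟨S0, hS0⟩ := exists_Good (K := K) hp.ne_zero x.ne_zero
  rw [mem_PS] at hx2
  let S2 := S ∪ T ∪ S0
  have hS2 : Good p (x : K) S2 := hS0.mono Finset.subset_union_right
  have hSS2 : S ⊆ S2 := fun v hv => by simp [S2, hv]
  apply FI_ne_top hp hζ hx' hS2
  rw [eq_top_iff]
  intro α _
  obtain ⟨c, hc⟩ := hS.cl.exists_val (fun v => if v ∈ S2 then log (v.valuation K (α : K)) else 0) S2 (by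
    intro v _ hv
    rw [if_neg hv])
  have hα0 : ∀ v : HeightOneSpectrum (𝓞 K), v.valuation K (α : K) ≠ 0 := fun v => (Valuation.ne_zero_iff _).2 α.ne_zero
  have hc1 : ∀ v ∈ S2, v ∉ S → v.valuation K ((α * c⁻¹ : Kˣ) : K) = 1 := by
    intro v hv hvS
    rw [Units.val_mul, map_mul, Units.val_inv_eq_inv_val, map_inv₀, hc v hvS, if_pos hv, exp_log (hα0 v),
      mul_inv_cancel₀ (hα0 v)]
  have hc2 : c ∈ US S2 := by
    intro v hv
    rw [hc v fun hh => hv (hSS2 hh), if_neg hv, exp_zero]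
  obtain ⟨u, hu, huT⟩ := hT (α * c⁻¹) fun v hv => hc1 v (by simp [S2, hv]) fun hh => Finset.disjoint_left.1 hST hh hv
  have hα : α = (c * u) * (α * c⁻¹ * u⁻¹) := by
    rw [mul_comm, mul_assoc, mul_comm c u, inv_mul_cancel_left, inv_mul_cancel_right]
  rw [hα]
  refine Subgroup.mul_mem_sup (mul_mem hc2 (US_mono hSS2 hu)) ?_
  rw [mem_NS]
  constructor
  · intro v hv
    by_cases hvS : v ∈ S
    · rw [NN_top hp (emb v) hζ (hx2.1 v hvS)]
      trivial
    by_cases hvT : v ∈ T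
    · exact PP_le_NN hp _ _ _ (huT v hvT)
    · refine fin_tame_norm v hp hζ (hS.hp v hvS) (hx1 v (by simp [hvS, hvT])) ?_
      rw [Units.val_mul, map_mul, Units.val_inv_eq_inv_val, map_inv₀, hc1 v hv hvS, hu v hvS, inv_one, one_mul]
  · intro τ
    rw [NN_top hp τ hζ (hx2.2 τ)]
    trivial

theorem hasse_norm {p : ℕ} (hp : p.Prime) {ζ : K} (hζ : IsPrimitiveRoot ζ p) (a b : Kˣ)
    (h1 : ∀ v : HeightOneSpectrum (𝓞 K), NormRes p (emb v ζ) (emb v b) (emb v a))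
    (h2 : ∀ τ : K →+* ℝ, NormRes p (τ ζ) (τ b) (τ a)) : NormRes p ζ (b : K) (a : K) := by
  classical
  by_cases hb : ∃ y : Kˣ, y ^ p = b
  · obtain ⟨y, rfl⟩ := hb
    rw [Units.val_pow_eq_pow_val]
    exact NormRes.of_pow hp hζ y.ne_zero _
  push Not at hb
  obtain ⟨S0, hS0⟩ := exists_Good (K := K) hp.ne_zero b.ne_zero
  let S := S0 ∪ (finite_supp a).toFinset
  have hS : Good p (b : K) S := hS0.mono Finset.subset_union_left
  have haS : a ∈ US S := by
    intro v hv
    by_contra hne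
    exact hv (Finset.mem_union_right _ (by simpa using hne))
  have hinf : 0 < Fintype.card (InfinitePlace K) := Fintype.card_pos
  obtain ⟨T, hT1, hT2, hT3, -, hT4⟩ := exists_T hp hζ hb hS (S.card + Fintype.card (InfinitePlace K) - 1) (by omega)
  have hle : PS p S ≤ NS hp ζ (b : K) (S ∪ T) := by
    intro x hx
    rw [mem_PS] at hx
    rw [mem_NS]
    refine ⟨fun v hv => ?_, fun τ => PP_le_NN hp _ _ _ (hx.2 τ)⟩
    rcases Finset.mem_union.1 hv with hv | hv
    · exact PP_le_NN hp _ _ _ (hx.1 v hv)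
    · rw [NN_top hp (emb v) hζ (hT3 v hv)]
      trivial
  obtain ⟨hi1, hi2⟩ := PS_index hp hζ S
  have hi3 : (PS p S).relIndex (US (S ∪ T)) * (US (S ∪ T) ⊔ PS p S).index = (PS p S).index := by
    rw [← Subgroup.relIndex_sup_right, sup_comm, Subgroup.relIndex_mul_index le_sup_left]
  have hi4 : (RR K p).relIndex (US (S ∪ T)) ≤ (PS p S).relIndex (US (S ∪ T)) := by
    have h0 : (PS p S).relIndex (US (S ∪ T)) ≠ 0 := by
      intro h0
      rw [h0, zero_mul] at hi3
      exact hi2 hi3.symm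
    rw [← Subgroup.inf_relIndex_right (PS p S)] at h0 ⊢
    exact Nat.le_of_dvd (Nat.pos_of_ne_zero h0) (Subgroup.relIndex_dvd_of_le_left _
      fun x hx => PS_inf_le hp hζ hS hT2 hT4 hx.2 hx.1)
  rw [US_pow_index hp hζ, Finset.card_union_of_disjoint hT2, hT1] at hi4
  have hi5 : (US (S ∪ T) ⊔ PS p S).index ≤ p ∧ (US (S ∪ T) ⊔ PS p S).index ≠ 0 := by
    constructor
    · set s := S.card + Fintype.card (InfinitePlace K) with hs
      have e1 : S.card + (s - 1) + Fintype.card (InfinitePlace K) = 2 * s - 1 := by omega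
      rw [e1] at hi4
      have e2 : p ^ (2 * s) = p ^ (2 * s - 1) * p := by
        rw [← pow_succ]
        congr 1
        omega
      rw [e2] at hi1
      refine Nat.le_of_mul_le_mul_left ?_ (pow_pos hp.pos (2 * s - 1))
      exact (Nat.mul_le_mul_right _ hi4).trans (hi3.le.trans hi1)
    · intro h0
      rw [h0, mul_zero] at hi3
      exact hi2 hi3.symm
  have hd := Subgroup.index_dvd_of_le (sup_le_sup_left hle (US (S ∪ T)))
  refine FI_norm (S := S ∪ T) hp hζ hb (hS.mono Finset.subset_union_left) ?_ ?_ a (US_mono (T := S ∪ T) Finset.subset_union_left haS) ?_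
  · exact (Nat.le_of_dvd (Nat.pos_of_ne_zero hi5.2) hd).trans hi5.1
  · intro h0
    exact hi5.2 (Nat.eq_zero_of_zero_dvd (h0 ▸ hd))
  · rw [mem_NS]
    exact ⟨fun v _ => h1 v, h2⟩

end three
end ABHN
end FileGlob10

section FileAlg1
set_option autoImplicit false
set_option linter.unusedSectionVars false
open scoped TensorProduct

namespace ABHN

section simple
variable {K E A : Type*} [Field K] [Field E] [Algebra K E] [Ring A] [Algebra K A] [Algebra.IsCentral K A] [IsSimpleRing A]

lemma tens_rel (I : TwoSidedIdeal (E ⊗[K] A)) (hI : (1 : E ⊗[K] A) ∉ I) {ι : Type*} (e : ι → E) (he : LinearIndependent K e)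
    (s : Finset ι) : ∀ a : ι → A, ∑ i ∈ s, e i ⊗ₜ[K] a i ∈ I → ∀ i ∈ s, a i = 0 := by
  classical
  induction s using Finset.induction_on with
  | empty => simp
  | insert i0 s hi0 ih =>
    intro a ha
    have hml : ∀ (x : A) (t : Finset ι) (a : ι → A), ∑ i ∈ t, e i ⊗ₜ[K] (x * a i) = (1 ⊗ₜ[K] x) * ∑ i ∈ t, e i ⊗ₜ[K] a i := by
      intro x t a
      rw [Finset.mul_sum]
      simp
    have hmr : ∀ (x : A) (t : Finset ι) (a : ι → A), ∑ i ∈ t, e i ⊗ₜ[K] (a i * x) = (∑ i ∈ t, e i ⊗ₜ[K] a i) * (1 ⊗ₜ[K] x) := by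
      intro x t a
      rw [Finset.sum_mul]
      simp
    let J : TwoSidedIdeal A := TwoSidedIdeal.mk' {z | ∃ c : ι → A, c i0 = z ∧ ∑ i ∈ insert i0 s, e i ⊗ₜ[K] c i ∈ I}
      ⟨0, rfl, by simp⟩
      (by
        rintro x y ⟨c, rfl, hc⟩ ⟨d, rfl, hd⟩
        refine ⟨c + d, rfl, ?_⟩
        have := I.add_mem hc hd
        rw [← Finset.sum_add_distrib] at this
        simpa [TensorProduct.tmul_add] using this)
      (by
        rintro x ⟨c, rfl, hc⟩
        refine ⟨-c, rfl, ?_⟩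
        have := I.neg_mem hc
        rw [← Finset.sum_neg_distrib] at this
        simpa [TensorProduct.tmul_neg] using this)
      (by
        rintro x y ⟨c, rfl, hc⟩
        refine ⟨fun i => x * c i, rfl, ?_⟩
        rw [hml]
        exact I.mul_mem_left _ _ hc)
      (by
        rintro x y ⟨c, rfl, hc⟩
        refine ⟨fun i => c i * y, rfl, ?_⟩
        rw [hmr]
        exact I.mul_mem_right _ _ hc)
    have hJ : ∀ z, z ∈ J ↔ ∃ c : ι → A, c i0 = z ∧ ∑ i ∈ insert i0 s, e i ⊗ₜ[K] c i ∈ I := by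
      intro z
      simp only [J, TwoSidedIdeal.mem_mk']
      rfl
    have h0 : a i0 = 0 := by
      by_contra hne
      have h1 := IsSimpleRing.one_mem_of_ne_zero_mem J hne ((hJ _).2 ⟨a, rfl, ha⟩)
      obtain ⟨c, hc0, hc⟩ := (hJ _).1 h1
      have h2 : ∀ x : A, ∀ i ∈ s, x * c i - c i * x = 0 := by
        intro x
        apply ih
        have h3 := I.sub_mem (I.mul_mem_left (1 ⊗ₜ[K] x) _ hc) (I.mul_mem_right _ (1 ⊗ₜ[K] x) hc)
        rw [← hml, ← hmr, ← Finset.sum_sub_distrib, Finset.sum_insert hi0, hc0, mul_one, one_mul, sub_self, zero_add] at h3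
        simpa [TensorProduct.tmul_sub] using h3
      have h4 : ∀ i ∈ insert i0 s, ∃ k : K, algebraMap K A k = c i := by
        intro i hi
        rcases Finset.mem_insert.1 hi with rfl | hi
        · exact ⟨1, by rw [hc0, map_one]⟩
        · have : c i ∈ Subalgebra.center K A := by
            rw [Subalgebra.mem_center_iff]
            intro x
            exact sub_eq_zero.1 (h2 x i hi)
          rw [Algebra.IsCentral.center_eq_bot] at this
          exact Algebra.mem_bot.1 this
      choose! k hk using h4
      have h5 : ∑ i ∈ insert i0 s, e i ⊗ₜ[K] c i = (∑ i ∈ insert i0 s, k i • e i) ⊗ₜ[K] 1 := by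
        rw [TensorProduct.sum_tmul]
        refine Finset.sum_congr rfl fun i hi => ?_
        rw [← hk i hi, Algebra.algebraMap_eq_smul_one, TensorProduct.tmul_smul, TensorProduct.smul_tmul']
      rw [h5] at hc
      have h6 : ∑ i ∈ insert i0 s, k i • e i = 0 := by
        by_contra hu
        apply hI
        have := I.mul_mem_left ((∑ i ∈ insert i0 s, k i • e i)⁻¹ ⊗ₜ[K] 1) _ hc
        rwa [Algebra.TensorProduct.tmul_mul_tmul, inv_mul_cancel₀ hu, one_mul, ← Algebra.TensorProduct.one_def] at this
      have h7 := (linearIndependent_iff'.1 he) _ k h6 i0 (Finset.mem_insert_self _ _)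
      have h8 := hk i0 (Finset.mem_insert_self _ _)
      rw [h7, map_zero, hc0] at h8
      exact zero_ne_one h8
    rw [Finset.sum_insert hi0, h0, TensorProduct.tmul_zero, zero_add] at ha
    intro i hi
    rcases Finset.mem_insert.1 hi with rfl | hi
    · exact h0
    · exact ih a ha i hi

theorem tens_simple : IsSimpleRing (E ⊗[K] A) := by
  classical
  have : Nontrivial (E ⊗[K] A) := by
    have hinj := Algebra.TensorProduct.includeLeft_injective (R := K) (S := K) (A := E) (B := A) (algebraMap K A).injective
    exact hinj.nontrivial
  refine IsSimpleRing.of_eq_bot_or_eq_top fun I => ?_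
  rw [or_iff_not_imp_right, ← I.one_mem_iff]
  intro hI
  rw [eq_bot_iff]
  intro x hx
  let B := Module.Basis.ofVectorSpace K E
  let y := TensorProduct.equivFinsuppOfBasisLeft (N := A) B x
  have hy : x = ∑ i ∈ y.support, B i ⊗ₜ[K] y i := by
    have : x = (TensorProduct.equivFinsuppOfBasisLeft (N := A) B).symm y := by simp [y]
    rw [this, TensorProduct.equivFinsuppOfBasisLeft_symm_apply]
    rfl
  rw [hy] at hx
  have h0 := tens_rel I hI B B.linearIndependent y.support y hx
  rw [hy, Finset.sum_eq_zero]
  · exact TwoSidedIdeal.zero_mem _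
  · intro i hi
    rw [h0 i hi, TensorProduct.tmul_zero]

end simple

section SN
variable {K E A : Type*} [Field K] [Field E] [Algebra K E] [Ring A] [Algebra K A] [Algebra.IsCentral K A] [IsSimpleRing A]
  [FiniteDimensional K A] {n : ℕ}

theorem exists_equiv (hn : n * n = Module.finrank K A) (φ : A →ₐ[K] Matrix (Fin n) (Fin n) E) :
    ∃ f : (E ⊗[K] A) ≃ₐ[E] Matrix (Fin n) (Fin n) E, ∀ a, f (1 ⊗ₜ a) = φ a := by
  have h0 : 0 < n := by
    rcases Nat.eq_zero_or_pos n with rfl | h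
    · have : 0 < Module.finrank K A := Module.finrank_pos
      omega
    · exact h
  have : NeZero n := ⟨h0.ne'⟩
  have := tens_simple (K := K) (E := E) (A := A)
  let f : (E ⊗[K] A) →ₐ[E] Matrix (Fin n) (Fin n) E := Algebra.TensorProduct.lift (Algebra.ofId E _) φ fun x y => Algebra.commutes _ _
  have hinj : Function.Injective f := f.toRingHom.injective
  have hd : Module.finrank E (E ⊗[K] A) = Module.finrank E (Matrix (Fin n) (Fin n) E) := by
    rw [Module.finrank_baseChange, Module.finrank_matrix, ← hn]
    simp
  have hsurj : Function.Surjective f := (LinearMap.injective_iff_surjective_of_finrank_eq_finrank (f := f.toLinearMap) hd).1 hinj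
  refine ⟨AlgEquiv.ofBijective f ⟨hinj, hsurj⟩, fun a => ?_⟩
  change f (1 ⊗ₜ a) = φ a
  refine (Algebra.TensorProduct.lift_tmul (Algebra.ofId E _) φ (fun x y => Algebra.commutes _ _) 1 a).trans ?_
  rw [map_one, one_mul]

theorem skolem_noether' (hn : n * n = Module.finrank K A) (φ ψ : A →ₐ[K] Matrix (Fin n) (Fin n) E) :
    ∃ g : (Matrix (Fin n) (Fin n) E)ˣ, ∀ a, φ a * g = g * ψ a := by
  obtain ⟨f1, h1⟩ := exists_equiv hn φ
  obtain ⟨f2, h2⟩ := exists_equiv hn ψ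
  let t : Matrix (Fin n) (Fin n) E ≃ₐ[E] Module.End E (Fin n → E) := Matrix.toLinAlgEquiv'
  obtain ⟨T, hT⟩ := (((t.symm.trans f2.symm).trans f1).trans t).eq_linearEquivConjAlgEquiv
  let g : Matrix (Fin n) (Fin n) E := t.symm T.toLinearMap
  let g' : Matrix (Fin n) (Fin n) E := t.symm T.symm.toLinearMap
  refine ⟨⟨g, g', ?_, ?_⟩, fun a => ?_⟩
  · simp only [g, g']
    rw [← map_mul, ← map_one t.symm]
    congr 1
    ext; simp
  · simp only [g, g']
    rw [← map_mul, ← map_one t.symm]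
    congr 1
    ext; simp
  · change φ a * g = g * ψ a
    have h3 : t (φ a) = T.conjAlgEquiv E (t (ψ a)) := by
      rw [← hT]
      simp only [AlgEquiv.trans_apply, AlgEquiv.symm_apply_apply, ← h2, ← h1]
    apply t.injective
    rw [map_mul, map_mul, h3]
    simp only [g, AlgEquiv.apply_symm_apply]
    ext; simp

theorem commutant' (hn : n * n = Module.finrank K A) (φ : A →ₐ[K] Matrix (Fin n) (Fin n) E)
    (g : Matrix (Fin n) (Fin n) E) (hg : ∀ a, φ a * g = g * φ a) : ∃ c : E, g = algebraMap E _ c := by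
  obtain ⟨f, h⟩ := exists_equiv hn φ
  have hc : g ∈ Subalgebra.center E (Matrix (Fin n) (Fin n) E) := by
    rw [Subalgebra.mem_center_iff]
    intro x
    obtain ⟨y, rfl⟩ := f.surjective x
    induction y with
    | zero => simp
    | add x y hx hy => rw [map_add, add_mul, mul_add, hx, hy]
    | tmul e a =>
      have : e ⊗ₜ[K] a = e • (1 ⊗ₜ[K] a) := by rw [TensorProduct.smul_tmul', smul_eq_mul, mul_one]
      rw [this, map_smul, h, smul_mul_assoc, mul_smul_comm, hg]
  rw [Algebra.IsCentral.center_eq_bot] at hc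
  obtain ⟨c, hc⟩ := Algebra.mem_bot.1 hc
  exact ⟨c, hc.symm⟩

end SN

/-- `φ` is an `i`-algebra map. -/
def Ov {K A E : Type*} [Field K] [Ring A] [Algebra K A] [Field E] {n : ℕ} (i : K →+* E) (φ : A →+* Matrix (Fin n) (Fin n) E) : Prop :=
  ∀ k, φ (algebraMap K A k) = algebraMap E _ (i k)

section Ov
variable {K E A : Type*} [Field K] [Field E] [Ring A] [Algebra K A] {n : ℕ}

lemma Ov.map {E' : Type*} [Field E'] {i : K →+* E} {φ : A →+* Matrix (Fin n) (Fin n) E} (h : Ov i φ) (g : E →+* E') :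
    Ov (g.comp i) (g.mapMatrix.comp φ) := by
  intro k
  rw [RingHom.comp_apply, h k]
  ext x y
  simp [Matrix.algebraMap_matrix_apply, apply_ite g]

variable [Algebra.IsCentral K A] [IsSimpleRing A] [FiniteDimensional K A]

theorem skolem_noether (hn : n * n = Module.finrank K A) {i : K →+* E} {φ ψ : A →+* Matrix (Fin n) (Fin n) E}
    (h1 : Ov i φ) (h2 : Ov i ψ) : ∃ g : (Matrix (Fin n) (Fin n) E)ˣ, ∀ a, φ a * g = g * ψ a := by
  let _ : Algebra K E := i.toAlgebra
  let φ' : A →ₐ[K] Matrix (Fin n) (Fin n) E := ⟨φ, h1⟩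
  let ψ' : A →ₐ[K] Matrix (Fin n) (Fin n) E := ⟨ψ, h2⟩
  exact skolem_noether' hn φ' ψ'

theorem commutant (hn : n * n = Module.finrank K A) {i : K →+* E} {φ : A →+* Matrix (Fin n) (Fin n) E}
    (h1 : Ov i φ) (g : Matrix (Fin n) (Fin n) E) (hg : ∀ a, φ a * g = g * φ a) : ∃ c : E, g = algebraMap E _ c := by
  let _ : Algebra K E := i.toAlgebra
  let φ' : A →ₐ[K] Matrix (Fin n) (Fin n) E := ⟨φ, h1⟩
  exact commutant' hn φ' g hg

end Ov
end ABHN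
end FileAlg1

section FileAlg2
set_option autoImplicit false
set_option linter.unusedSectionVars false
open scoped TensorProduct
open IsDedekindDomain NumberField

namespace ABHN

/-- the twisted product `g s(g) ... s^{k-1}(g)` -/
def GG {M : Type*} [Monoid M] (s : M → M) (g : M) : ℕ → M
  | 0 => 1
  | k + 1 => GG s g k * s^[k] g

section GG
variable {M : Type*} [Monoid M]

lemma GG_succ' (s : M →* M) (g : M) (k : ℕ) : GG s g (k + 1) = g * s (GG s g k) := by
  induction k with
  | zero => simp [GG]
  | succ k ih =>
    have h1 : GG s g (k+1) = GG s g k * s^[k] g := rfl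
    have h2 : GG s g (k+1+1) = GG s g (k+1) * s^[k+1] g := rfl
    rw [h2]
    conv_rhs => rw [h1, map_mul, ← mul_assoc, ← ih]
    rw [Function.iterate_succ_apply']

lemma GG_map {N : Type*} [Monoid N] (s : M → M) (t : N → N) (ρ : M →* N) (h : ∀ x, ρ (s x) = t (ρ x)) (g : M) (k : ℕ) :
    ρ (GG s g k) = GG t (ρ g) k := by
  have h' : ∀ k x, ρ (s^[k] x) = t^[k] (ρ x) := by
    intro k x
    induction k with
    | zero => rfl
    | succ k ih => rw [Function.iterate_succ_apply', Function.iterate_succ_apply', h, ih]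
  induction k with
  | zero => simp [GG]
  | succ k ih => rw [GG, map_mul, ih, h', GG]

lemma it_mul (s : M →* M) (k : ℕ) (x y : M) : s^[k] (x * y) = s^[k] x * s^[k] y := by
  induction k with
  | zero => rfl
  | succ k ih => rw [Function.iterate_succ_apply', Function.iterate_succ_apply', Function.iterate_succ_apply', ih, map_mul]

lemma GG_comm (s : M →* M) (g x : M) (h : ∀ k, s^[k] x * s^[k] g = s^[k] g * s^[k+1] x) (k : ℕ) :
    x * GG s g k = GG s g k * s^[k] x := by
  induction k with
  | zero => simp [GG]
  | succ k ih => rw [GG, ← mul_assoc, ih, mul_assoc, h, mul_assoc]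

end GG

section key
variable {p n : ℕ} {E E' : Type*} [Field E] [Field E'] [Algebra E E'] {ζ b : E} {θ : E'}

lemma mm_it (f : E →+* E) (k : ℕ) (x : Matrix (Fin n) (Fin n) E) (i j : Fin n) : f.mapMatrix^[k] x i j = f^[k] (x i j) := by
  induction k with
  | zero => rfl
  | succ k ih => rw [Function.iterate_succ_apply', Function.iterate_succ_apply', ← ih]; rfl

lemma mm_alg {F : Type*} [Field F] (f : E →+* F) (c : E) : f.mapMatrix (algebraMap E (Matrix (Fin n) (Fin n) E) c) = algebraMap F _ (f c) := by
  ext x y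
  simp [Matrix.algebraMap_matrix_apply, apply_ite f]

lemma mm_it_alg (f : E →+* E) (k : ℕ) (c : E) : f.mapMatrix^[k] (algebraMap E (Matrix (Fin n) (Fin n) E) c) = algebraMap E _ (f^[k] c) := by
  induction k with
  | zero => rfl
  | succ k ih => rw [Function.iterate_succ_apply', Function.iterate_succ_apply', ih, mm_alg]

/-- the matrix action of σ -/
noncomputable def Kum.s (h : Kum p E ζ b θ) (n : ℕ) : Matrix (Fin n) (Fin n) E' →+* Matrix (Fin n) (Fin n) E' :=
  RingHom.mapMatrix (h.σ : E' →+* E')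

lemma Kum.s_pow (h : Kum p E ζ b θ) (x : Matrix (Fin n) (Fin n) E') : (h.s n)^[p] x = x := by
  ext i j
  rw [Kum.s, mm_it]
  exact h.σ_pow _

/-- Hilbert 90 for GL_n -/
theorem Kum.h90GL (h : Kum p E ζ b θ) (g : Matrix (Fin n) (Fin n) E') (hg : GG (h.s n) g p = 1) :
    ∃ u : (Matrix (Fin n) (Fin n) E')ˣ, g * h.s n u = u := by
  classical
  let σv : ℕ → (Fin n → E') → (Fin n → E') := fun k x i => h.σ^[k] (x i)
  let B : (Fin n → E') → (Fin n → E') := fun x => ∑ k ∈ Finset.range p, (GG (h.s n) g k).mulVec (σv k x)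
  have hspan : Submodule.span E' (Set.range B) = ⊤ := by
    by_contra hne
    obtain ⟨f, hf0, hf⟩ := Submodule.exists_dual_map_eq_bot_of_lt_top (lt_top_iff_ne_top.2 hne) inferInstance
    apply hf0
    refine LinearMap.ext fun x => ?_
    have hfB : ∀ x, f (B x) = 0 := by
      intro x
      have : f (B x) ∈ (Submodule.span E' (Set.range B)).map f := ⟨_, Submodule.subset_span ⟨x, rfl⟩, rfl⟩
      rw [hf] at this
      exact (Submodule.mem_bot E').1 this
    have := h.indep (fun k => f ((GG (h.s n) g k).mulVec (σv k x))) (fun c => by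
      have := hfB (c • x)
      simp only [B, map_sum] at this
      rw [← this]
      refine Finset.sum_congr rfl fun k _ => ?_
      have h1 : σv k (c • x) = h.σ^[k] c • σv k x := by
        ext i
        simp only [σv, Pi.smul_apply, smul_eq_mul]
        exact it_mul (h.σ : E' →* E') k c (x i)
      rw [h1, Matrix.mulVec_smul, map_smul, smul_eq_mul, mul_comm]) 0 h.prime.pos
    simpa [GG, σv] using this
  obtain ⟨κ, a, ha1, ha2, ha3⟩ := exists_linearIndependent' E' B
  have hb : ⊤ ≤ Submodule.span E' (Set.range (B ∘ a)) := by rw [ha2, hspan]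
  let bas := Module.Basis.mk ha3 hb
  have : Finite κ := Module.Finite.finite_basis bas
  have : Fintype κ := Fintype.ofFinite κ
  have hcard : Fintype.card κ = n := by
    rw [← Module.finrank_eq_card_basis bas, Module.finrank_fintype_fun_eq_card, Fintype.card_fin]
  let ee : Fin n ≃ κ := (finCongr hcard.symm).trans (Fintype.equivFin κ).symm
  let X : Matrix (Fin n) (Fin n) E' := Matrix.of fun i j => a (ee j) i
  let U : Matrix (Fin n) (Fin n) E' := ∑ k ∈ Finset.range p, GG (h.s n) g k * (h.s n)^[k] X
  have hU : ∀ i j, U i j = B (a (ee j)) i := by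
    intro i j
    simp only [U, B, Matrix.sum_apply, Finset.sum_apply]
    refine Finset.sum_congr rfl fun k _ => ?_
    rw [Matrix.mul_apply, Matrix.mulVec, dotProduct]
    refine Finset.sum_congr rfl fun l _ => ?_
    rw [Kum.s, mm_it]
    rfl
  have hunit : IsUnit U := by
    rw [← Matrix.linearIndependent_cols_iff_isUnit]
    have : U.col = (B ∘ a) ∘ ee := by
      ext j i
      exact hU i j
    rw [this]
    exact ha3.comp _ ee.injective
  refine ⟨hunit.unit, ?_⟩
  rw [IsUnit.unit_spec]
  have h1 : g * h.s n U = ∑ k ∈ Finset.range p, GG (h.s n) g (k+1) * (h.s n)^[k+1] X := by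
    simp only [U]
    rw [map_sum, Finset.mul_sum]
    refine Finset.sum_congr rfl fun k _ => ?_
    rw [map_mul, ← mul_assoc, Function.iterate_succ_apply']
    congr 1
    exact (GG_succ' (h.s n : _ →* _) g k).symm
  rw [h1]
  have e1 := Finset.sum_range_succ (fun i => GG (h.s n) g i * (h.s n)^[i] X) p
  rw [Finset.sum_range_succ'] at e1
  have e2 : GG (h.s n) g p * (h.s n)^[p] X = GG (h.s n) g 0 * (h.s n)^[0] X := by
    rw [h.s_pow, hg]
    simp [GG]
  rw [e2] at e1
  exact add_right_cancel e1

end key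
end ABHN
end FileAlg2

section FileAlg3
set_option autoImplicit false
set_option linter.unusedSectionVars false
open scoped TensorProduct
open IsDedekindDomain NumberField

namespace ABHN

lemma exists_factor {A B C : Type*} [Ring A] [Ring B] [Ring C] (u : A →+* B) (m : C →+* B) (hm : Function.Injective m)
    (h : ∀ a, ∃ c, m c = u a) : ∃ w : A →+* C, ∀ a, m (w a) = u a := by
  choose w hw using h
  exact ⟨{ toFun := w
           map_one' := hm (by rw [hw, map_one, map_one])
           map_mul' := fun x y => hm (by rw [map_mul, hw, hw, hw, map_mul])
           map_zero' := hm (by rw [hw, map_zero, map_zero])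
           map_add' := fun x y => hm (by rw [map_add, hw, hw, hw, map_add]) }, hw⟩

section key
variable {p n : ℕ} {K A : Type*} [Field K] [Ring A] [Algebra K A] [Algebra.IsCentral K A] [IsSimpleRing A]
  [FiniteDimensional K A]

variable {E E' : Type*} [Field E] [Field E'] [Algebra E E'] {ζ b : E} {θ : E'}

/-- `g` conjugates `φ` to its twist. -/
def Tw (h : Kum p E ζ b θ) (φ : A →+* Matrix (Fin n) (Fin n) E') (g : Matrix (Fin n) (Fin n) E') : Prop :=
  ∀ a, φ a * g = g * h.s n (φ a)

lemma s_Ov (h : Kum p E ζ b θ) {i : K →+* E} {φ : A →+* Matrix (Fin n) (Fin n) E'} (hφ : Ov ((algebraMap E E').comp i) φ) :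
    Ov ((algebraMap E E').comp i) ((h.s n).comp φ) := by
  intro k
  rw [RingHom.comp_apply, hφ k, Kum.s, mm_alg]
  simp

lemma alg_inj (hn : 0 < n) : Function.Injective (algebraMap E (Matrix (Fin n) (Fin n) E)) := by
  have : NeZero n := ⟨hn.ne'⟩
  exact (algebraMap E (Matrix (Fin n) (Fin n) E)).injective

lemma n_pos (hn : n * n = Module.finrank K A) : 0 < n := by
  rcases Nat.eq_zero_or_pos n with rfl | h
  · have : 0 < Module.finrank K A := Module.finrank_pos
    omega
  · exact h

theorem exists_tw (hn : n * n = Module.finrank K A) (h : Kum p E ζ b θ) {i : K →+* E} {φ : A →+* Matrix (Fin n) (Fin n) E'}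
    (hφ : Ov ((algebraMap E E').comp i) φ) : ∃ (g : (Matrix (Fin n) (Fin n) E')ˣ) (a : E), a ≠ 0 ∧
      Tw h φ g ∧ GG (h.s n) (g : Matrix (Fin n) (Fin n) E') p = algebraMap E' _ (algebraMap E E' a) := by
  obtain ⟨g, hg⟩ := skolem_noether hn hφ (s_Ov h hφ)
  have hg' : Tw h φ g := hg
  have hit : ∀ (k : ℕ) (a : A), (h.s n)^[k] (φ a) * (h.s n)^[k] g = (h.s n)^[k] g * (h.s n)^[k+1] (φ a) := by
    intro k a
    have h1 := congrArg ((h.s n)^[k]) (hg' a)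
    have h2 := it_mul (h.s n : _ →* _) k (φ a) (g : Matrix (Fin n) (Fin n) E')
    have h3 := it_mul (h.s n : _ →* _) k (g : Matrix (Fin n) (Fin n) E') (h.s n (φ a))
    exact (h2.symm.trans h1).trans h3
  obtain ⟨c, hc⟩ := commutant hn hφ (GG (h.s n) (g : Matrix (Fin n) (Fin n) E') p) (by
    intro a
    have := GG_comm (h.s n : _ →* _) (g : Matrix (Fin n) (Fin n) E') (φ a) (fun k => hit k a) p
    refine this.trans ?_
    congr 1
    exact h.s_pow _)
  have hσc : h.σ c = c := by
    have h1 : GG (h.s n) (g : Matrix (Fin n) (Fin n) E') (p+1) = GG (h.s n) g p * (h.s n)^[p] g := rfl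
    have h2 : GG (h.s n) (g : Matrix (Fin n) (Fin n) E') (p+1) = g * (h.s n) (GG (h.s n) g p) := GG_succ' (h.s n : _ →* _) (g : Matrix (Fin n) (Fin n) E') p
    have h3 : h.s n (algebraMap E' _ c) = algebraMap E' _ (h.σ c) := mm_alg _ _
    rw [h2, hc, h.s_pow, h3, ← Algebra.commutes] at h1
    exact alg_inj (n_pos hn) (g.isUnit.mul_right_cancel h1)
  obtain ⟨a, rfl⟩ := h.fixed c hσc
  refine ⟨g, a, ?_, hg', hc⟩
  rintro rfl
  rw [map_zero, map_zero] at hc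
  have hu : ∀ k, IsUnit (GG (h.s n) (g : Matrix (Fin n) (Fin n) E') k) := by
    intro k
    induction k with
    | zero => exact isUnit_one
    | succ k ih =>
      refine ih.mul ?_
      have : ∀ k, IsUnit ((h.s n)^[k] (g : Matrix (Fin n) (Fin n) E')) := by
        intro k
        induction k with
        | zero => exact g.isUnit
        | succ k ih =>
          rw [Function.iterate_succ_apply']
          exact ih.map _
      exact this k
  have := hu p
  rw [hc] at this
  have : NeZero n := ⟨(n_pos hn).ne'⟩
  exact not_isUnit_zero ‹IsUnit (0 : Matrix (Fin n) (Fin n) E')›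

/-- coboundary computation -/
lemma norm_of_tw (h : Kum p E ζ b θ) (hn : 0 < n) {g u : Matrix (Fin n) (Fin n) E'} (hu : IsUnit u) {c : E'}
    (hc : g * h.s n u = algebraMap E' _ c * u) {a : E} (ha : GG (h.s n) g p = algebraMap E' _ (algebraMap E E' a)) :
    Algebra.norm E c = a := by
  have key : ∀ k, GG (h.s n) g k * (h.s n)^[k] u = algebraMap E' _ (∏ j ∈ Finset.range k, h.σ^[j] c) * u := by
    intro k
    induction k with
    | zero => simp [GG]
    | succ k ih =>
      have h1 : (h.s n)^[k] (g * h.s n u) = (h.s n)^[k] g * (h.s n)^[k+1] u := it_mul (h.s n : _ →* _) k g (h.s n u)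
      have h2 : (h.s n)^[k] (algebraMap E' _ c * u) = algebraMap E' _ (h.σ^[k] c) * (h.s n)^[k] u := by
        refine (it_mul (h.s n : _ →* _) k (algebraMap E' _ c) u).trans ?_
        congr 1
        exact mm_it_alg _ _ _
      rw [GG, mul_assoc, ← h1, hc, h2, ← mul_assoc, ← Algebra.commutes, mul_assoc, ih, ← mul_assoc, ← map_mul,
        Finset.prod_range_succ, mul_comm (h.σ^[k] c)]
  have h1 := key p
  rw [h.s_pow, ha, ← h.norm_eq] at h1
  exact ((algebraMap E E').injective (alg_inj hn (hu.mul_right_cancel h1))).symm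

open Polynomial in
theorem normRes_aux (hn : n * n = Module.finrank K A) (h : Kum p E ζ b θ) {i : K →+* E}
    {φ : A →+* Matrix (Fin n) (Fin n) E'} (hφ : Ov ((algebraMap E E').comp i) φ)
    {g : (Matrix (Fin n) (Fin n) E')ˣ} (hg : Tw h φ g) {a : E}
    (ha : GG (h.s n) (g : Matrix (Fin n) (Fin n) E') p = algebraMap E' _ (algebraMap E E' a))
    {F F' : Type*} [Field F] [Field F'] [Algebra F F'] (j : E →+* F) {ψ : A →+* Matrix (Fin n) (Fin n) F} (hψ : Ov (j.comp i) ψ)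
    {θ' : F'} (h' : Kum p F (j ζ) (j b) θ') :
    NormRes p (j ζ) (j b) (j a) := by
  let _ : Algebra E F' := ((algebraMap F F').comp j).toAlgebra
  have hEF : ∀ x, algebraMap E F' x = algebraMap F F' (j x) := fun x => rfl
  obtain ⟨ρ, hρ⟩ := h.exists_hom (E := F') (β := θ') h'.pow
  have hρσ : ∀ x, ρ (h.σ x) = h'.σ (ρ x) := by
    intro x
    obtain ⟨f, rfl⟩ := h.exists_aeval x
    have e1 := h.σ_it_aeval 1 f
    simp only [Function.iterate_one, pow_one] at e1
    rw [e1, ← aeval_algHom_apply, ← aeval_algHom_apply, hρ, map_mul, AlgHom.commutes, hρ, hEF, ← h'.σ_θ]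
    have e2 : aeval θ' f = aeval θ' (f.map j) := by
      rw [aeval_def, aeval_def, eval₂_map]
      rfl
    have e3 : aeval (h'.σ θ') f = aeval (h'.σ θ') (f.map j) := by
      rw [aeval_def, aeval_def, eval₂_map]
      rfl
    rw [e2, e3]
    exact aeval_algHom_apply h'.σ θ' _
  let R : Matrix (Fin n) (Fin n) E' →+* Matrix (Fin n) (Fin n) F' := (ρ : E' →+* F').mapMatrix
  have hRs : ∀ x, R (h.s n x) = h'.s n (R x) := by
    intro x
    ext k l
    exact hρσ _
  have h1 : Ov ((algebraMap F F').comp (j.comp i)) (R.comp φ) := by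
    have := hφ.map (ρ : E' →+* F')
    intro k
    rw [this k]
    congr 1
    exact AlgHom.commutes ρ (i k)
  have h2 : Ov ((algebraMap F F').comp (j.comp i)) ((algebraMap F F').mapMatrix.comp ψ) := hψ.map _
  obtain ⟨u, hu⟩ := skolem_noether hn h1 h2
  have hs : ∀ a, h'.s n ((algebraMap F F').mapMatrix (ψ a)) = (algebraMap F F').mapMatrix (ψ a) := by
    intro a
    ext k l
    exact h'.σ.commutes _
  have hgR : ∀ a, R (φ a) * R g = R g * h'.s n (R (φ a)) := by
    intro a
    rw [← map_mul, hg a, map_mul, hRs]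
  have hus : ∀ a, h'.s n (R (φ a)) * h'.s n u = h'.s n u * (algebraMap F F').mapMatrix (ψ a) := by
    intro a
    have := congrArg (h'.s n) (hu a)
    rw [map_mul, map_mul] at this
    rw [RingHom.comp_apply] at this
    rw [this, RingHom.comp_apply, hs]
  obtain ⟨c, hc⟩ := commutant hn h2 ((↑u⁻¹ : Matrix (Fin n) (Fin n) F') * R g * h'.s n u) (by
    intro a
    have e := hu a
    simp only [RingHom.comp_apply] at e ⊢
    have e' : (algebraMap F F').mapMatrix (ψ a) * (↑u⁻¹ : Matrix (Fin n) (Fin n) F') = (↑u⁻¹ : Matrix (Fin n) (Fin n) F') * R (φ a) := by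
      rw [← Units.inv_mul_cancel_left u ((algebraMap F F').mapMatrix (ψ a)), ← e, mul_assoc, mul_assoc,
        Units.mul_inv, mul_one]
    rw [← mul_assoc, ← mul_assoc, e', mul_assoc (↑u⁻¹ : Matrix (Fin n) (Fin n) F') (R (φ a)), hgR, mul_assoc, mul_assoc, hus]
    simp only [mul_assoc])
  have hc' : R g * h'.s n u = algebraMap F' _ c * u := by
    rw [Algebra.commutes, ← hc, mul_assoc, Units.mul_inv_cancel_left]
  have hG : GG (h'.s n) (R g) p = algebraMap F' _ (algebraMap F F' (j a)) := by
    have := GG_map (h.s n) (h'.s n) (R : _ →* _) hRs g p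
    refine this.symm.trans ?_
    rw [ha]
    refine (mm_alg _ _).trans ?_
    congr 1
    exact AlgHom.commutes ρ a
  rw [h'.normRes_iff]
  exact ⟨c, norm_of_tw h' (n_pos hn) u.isUnit hc' hG⟩

open Polynomial in
/-- local step -/
theorem normRes_of_split (hn : n * n = Module.finrank K A) (h : Kum p E ζ b θ) {i : K →+* E}
    {φ : A →+* Matrix (Fin n) (Fin n) E'} (hφ : Ov ((algebraMap E E').comp i) φ)
    {g : (Matrix (Fin n) (Fin n) E')ˣ} (hg : Tw h φ g) {a : E}
    (ha : GG (h.s n) (g : Matrix (Fin n) (Fin n) E') p = algebraMap E' _ (algebraMap E E' a))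
    {F : Type*} [Field F] (j : E →+* F) {ψ : A →+* Matrix (Fin n) (Fin n) F} (hψ : Ov (j.comp i) ψ) :
    NormRes p (j ζ) (j b) (j a) := by
  have hζ : IsPrimitiveRoot (j ζ) p := h.prim.map_of_injective j.injective
  by_cases hb : ∃ β, β ^ p = j b
  · obtain ⟨β, hβ⟩ := hb
    rw [← hβ]
    refine NormRes.of_pow h.prime hζ ?_ _
    rintro rfl
    rw [zero_pow h.prime.ne_zero] at hβ
    exact h.ne_zero ((map_eq_zero j).1 hβ.symm)
  push Not at hb
  have hirr : Fact (Irreducible (X ^ p - C (j b))) := ⟨X_pow_sub_C_irreducible_of_prime h.prime hb⟩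
  exact normRes_aux hn h hφ hg ha j hψ (exists_Kum h.prime hζ hb)

lemma exists_conjHom {A B : Type*} [Ring A] [Ring B] (φ : A →+* B) (u : Bˣ) : ∃ ψ : A →+* B, ∀ x, (u : B) * ψ x = φ x * u :=
  ⟨{ toFun := fun x => (↑u⁻¹ : B) * φ x * (u : B)
     map_one' := by simp
     map_mul' := fun x y => by simp [mul_assoc]
     map_zero' := by simp
     map_add' := fun x y => by simp [mul_add, add_mul] }, fun x => by
    change (u : B) * ((↑u⁻¹ : B) * φ x * (u : B)) = _
    rw [mul_assoc, Units.mul_inv_cancel_left]⟩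

/-- descent -/
theorem descend (hn : n * n = Module.finrank K A) (h : Kum p E ζ b θ) {i : K →+* E}
    {φ : A →+* Matrix (Fin n) (Fin n) E'} (hφ : Ov ((algebraMap E E').comp i) φ)
    {g : (Matrix (Fin n) (Fin n) E')ˣ} (hg : Tw h φ g) {a : E} (ha0 : a ≠ 0)
    (ha : GG (h.s n) (g : Matrix (Fin n) (Fin n) E') p = algebraMap E' _ (algebraMap E E' a)) (hN : NormRes p ζ b a) :
    ∃ ψ : A →+* Matrix (Fin n) (Fin n) E, Ov i ψ := by
  obtain ⟨c, hc⟩ := h.normRes_iff.1 hN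
  have hfd := h.finDim
  have hc0 : c ≠ 0 := by
    rintro rfl
    rw [Algebra.norm_zero] at hc
    exact ha0 hc.symm
  let g1 : Matrix (Fin n) (Fin n) E' := algebraMap E' _ c⁻¹ * g
  have key : ∀ k, GG (h.s n) g1 k = algebraMap E' _ (∏ j ∈ Finset.range k, h.σ^[j] c⁻¹) * GG (h.s n) g k := by
    intro k
    induction k with
    | zero => simp [GG]
    | succ k ih =>
      have h1 : (h.s n)^[k] g1 = algebraMap E' _ (h.σ^[k] c⁻¹) * (h.s n)^[k] g := by
        refine (it_mul (h.s n : _ →* _) k (algebraMap E' _ c⁻¹) (g : Matrix (Fin n) (Fin n) E')).trans ?_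
        congr 1
        exact mm_it_alg _ _ _
      rw [GG, ih, h1, Finset.prod_range_succ, map_mul, GG]
      simp only [mul_assoc]
      congr 1
      rw [← mul_assoc, ← Algebra.commutes, mul_assoc]
  have hg1 : GG (h.s n) g1 p = 1 := by
    rw [key, ha, ← h.norm_eq, Algebra.norm_inv, hc, ← map_mul, ← map_mul, inv_mul_cancel₀ ha0, map_one, map_one]
  obtain ⟨u, hu⟩ := h.h90GL g1 hg1
  have htw : ∀ x, φ x * g1 = g1 * h.s n (φ x) := by
    intro x
    simp only [g1]
    rw [← mul_assoc, ← Algebra.commutes, mul_assoc, hg x, mul_assoc]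
  obtain ⟨ψ', hψ'⟩ := exists_conjHom φ u
  have hfix : ∀ x, h.s n (ψ' x) = ψ' x := by
    intro x
    have h1 := congrArg (h.s n) (hψ' x)
    rw [map_mul, map_mul] at h1
    have h2 : g1 * (h.s n u * h.s n (ψ' x)) = g1 * (h.s n (φ x) * h.s n u) := by rw [h1]
    rw [← mul_assoc, hu, ← mul_assoc, ← htw, mul_assoc, hu, ← hψ'] at h2
    exact u.isUnit.mul_left_cancel h2
  obtain ⟨ψ, hψ⟩ := exists_factor ψ' (algebraMap E E').mapMatrix (by
    intro x y hxy
    ext k l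
    exact (algebraMap E E').injective (congrFun (congrFun hxy k) l)) (by
    intro x
    have : ∀ k l, ∃ y, algebraMap E E' y = ψ' x k l := fun k l => h.fixed _ (congrFun (congrFun (hfix x) k) l)
    choose y hy using this
    exact ⟨Matrix.of y, by ext k l; exact hy k l⟩)
  refine ⟨ψ, fun k => ?_⟩
  have hinj : Function.Injective ((algebraMap E E').mapMatrix : Matrix (Fin n) (Fin n) E →+* _) := by
    intro x y hxy
    ext k l
    exact (algebraMap E E').injective (congrFun (congrFun hxy k) l)
  apply hinj
  rw [hψ, mm_alg]
  apply u.isUnit.mul_left_cancel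
  rw [hψ', hφ, Algebra.commutes, RingHom.comp_apply]

end key
end ABHN
end FileAlg3

section FileAlg4
set_option autoImplicit false
set_option linter.unusedSectionVars false
open scoped TensorProduct
open IsDedekindDomain NumberField
universe u

namespace ABHN

section tower
variable {p n : ℕ} {K A : Type*} [Field K] [Ring A] [Algebra K A] [Algebra.IsCentral K A] [IsSimpleRing A]
  [FiniteDimensional K A]

/-- locally split -/
def LocSpl (n : ℕ) (A : Type*) [Ring A] [Algebra K A] {E : Type u} [Field E] [NumberField E] (i : K →+* E) : Prop :=
  (∀ w : HeightOneSpectrum (𝓞 E), ∃ ψ : A →+* Matrix (Fin n) (Fin n) (w.adicCompletion E), Ov ((emb w).comp i) ψ) ∧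
  (∀ τ : E →+* ℝ, ∃ ψ : A →+* Matrix (Fin n) (Fin n) ℝ, Ov (τ.comp i) ψ)

lemma LocSpl.up {E : Type u} [Field E] [NumberField E] {i : K →+* E} (h : LocSpl n A i)
    (E1 : Type u) [Field E1] [NumberField E1] [Algebra E E1] : LocSpl n A ((algebraMap E E1).comp i) := by
  refine ⟨fun w => ?_, fun τ => ?_⟩
  · obtain ⟨g, hg⟩ := exists_cmap (K := E) w
    obtain ⟨ψ, hψ⟩ := h.1 (resP (K := E) w)
    refine ⟨g.mapMatrix.comp ψ, fun k => ?_⟩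
    rw [hψ.map g k]
    congr 1
    exact hg (i k)
  · obtain ⟨ψ, hψ⟩ := h.2 (τ.comp (algebraMap E E1))
    exact ⟨ψ, hψ⟩

theorem kum_descend (hn : n * n = Module.finrank K A) {E E1 : Type u} [Field E] [NumberField E] [Field E1]
    [Algebra E E1] {ζ b : E} {θ : E1} (h : Kum p E ζ b θ) {i : K →+* E} (hl : LocSpl n A i)
    {φ : A →+* Matrix (Fin n) (Fin n) E1} (hφ : Ov ((algebraMap E E1).comp i) φ) :
    ∃ ψ : A →+* Matrix (Fin n) (Fin n) E, Ov i ψ := by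
  obtain ⟨g, a, ha0, hg, ha⟩ := exists_tw hn h hφ
  refine descend hn h hφ hg ha0 ha ?_
  refine hasse_norm h.prime h.prim (Units.mk0 a ha0) (Units.mk0 b h.ne_zero) (fun v => ?_) (fun τ => ?_)
  · obtain ⟨ψ, hψ⟩ := hl.1 v
    exact normRes_of_split hn h hφ hg ha (emb v) hψ
  · obtain ⟨ψ, hψ⟩ := hl.2 τ
    exact normRes_of_split hn h hφ hg ha τ hψ

open IntermediateField in
theorem exists_kum_sub (hp : p.Prime) {E F : Type u} [Field E] [Field F] [Algebra E F]
    [FiniteDimensional E F] [IsGalois E F] {k : ℕ} (hk : Module.finrank E F = p ^ (k + 1)) {ζ : E} (hζ : IsPrimitiveRoot ζ p) :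
    ∃ (E1 : IntermediateField E F) (b : E) (θ : E1), Kum p E ζ b θ ∧ Module.finrank E1 F = p ^ k := by
  have hpf : Fact p.Prime := ⟨hp⟩
  have hcard : Nat.card (F ≃ₐ[E] F) = p ^ (k + 1) := by rw [IsGalois.card_aut_eq_finrank, hk]
  obtain ⟨Q, hQ⟩ := Sylow.exists_subgroup_card_pow_prime p (G := F ≃ₐ[E] F) (n := k) (by rw [hcard]; exact pow_dvd_pow _ (Nat.le_succ _))
  have hidx : Q.index = p := by
    have := Q.card_mul_index
    rw [hQ, hcard, pow_succ] at this
    exact Nat.eq_of_mul_eq_mul_left (pow_pos hp.pos _) this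
  have hnorm : Q.Normal := by
    apply Subgroup.normal_of_index_eq_minFac_card
    rw [hidx, hcard, hp.pow_minFac (Nat.succ_ne_zero _)]
  let E1 := fixedField Q
  have hr1 : Module.finrank E1 F = p ^ k := by rw [finrank_fixedField_eq_card, hQ]
  have hr : Module.finrank E E1 = p := by
    have := Module.finrank_mul_finrank E E1 F
    rw [hr1, hk, pow_succ, mul_comm] at this
    exact Nat.eq_of_mul_eq_mul_left (pow_pos hp.pos _) this
  have hgal : IsGalois E E1 := IsGalois.of_fixedField_normal_subgroup Q
  have hcyc : IsCyclic (E1 ≃ₐ[E] E1) := isCyclic_of_prime_card (p := p) (by rw [IsGalois.card_aut_eq_finrank, hr])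
  obtain ⟨θ, ⟨b, hb⟩, hθ⟩ := exists_root_adjoin_eq_top_of_isCyclic E E1 ⟨ζ, by
    rw [hr]; exact (mem_primitiveRoots hp.pos).2 hζ⟩
  rw [hr] at hb
  exact ⟨E1, b, θ, ⟨hp, hζ, hb.symm, hθ, hr⟩, hr1⟩

theorem tower (hn : n * n = Module.finrank K A) (hp : p.Prime) (k : ℕ) : ∀ {E F : Type u} [Field E] [NumberField E] [Field F]
    [Algebra E F] [FiniteDimensional E F] [IsGalois E F] (_ : Module.finrank E F = p ^ k) {ζ : E} (_ : IsPrimitiveRoot ζ p)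
    {i : K →+* E} (_ : LocSpl n A i) {φ : A →+* Matrix (Fin n) (Fin n) F} (_ : Ov ((algebraMap E F).comp i) φ),
    ∃ ψ : A →+* Matrix (Fin n) (Fin n) E, Ov i ψ := by
  induction k with
  | zero =>
    intro E F _ _ _ _ _ _ hr ζ hζ i hl φ hφ
    rw [pow_zero] at hr
    have hs : Function.Surjective (algebraMap E F) := by
      have := Algebra.finrank_eq_one_iff_bijective_algebraMap.1 hr
      exact this.2
    let e : E ≃+* F := RingEquiv.ofBijective (algebraMap E F) ⟨(algebraMap E F).injective, hs⟩
    refine ⟨(e.symm : F →+* E).mapMatrix.comp φ, fun k => ?_⟩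
    rw [hφ.map (e.symm : F →+* E) k]
    congr 1
    exact e.symm_apply_apply _
  | succ k ih =>
    intro E F _ _ _ _ _ _ hr ζ hζ i hl φ hφ
    obtain ⟨E1, b, θ, h, hr1⟩ := exists_kum_sub hp hr hζ
    have : NumberField E1 := NumberField.of_module_finite E E1
    have hζ1 : IsPrimitiveRoot (algebraMap E E1 ζ) p := hζ.map_of_injective (algebraMap E E1).injective
    obtain ⟨ψ, hψ⟩ := ih (E := E1) (F := F) hr1 hζ1 (hl.up E1) (φ := φ) hφ
    exact kum_descend hn h hl hψ

end tower
end ABHN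
end FileAlg4

section FileAlg5
set_option autoImplicit false
set_option linter.unusedSectionVars false
open scoped TensorProduct
open IsDedekindDomain NumberField
universe u

namespace ABHN

section fin
variable {p n : ℕ} {K : Type u} {A : Type*} [Field K] [Ring A] [Algebra K A] [Algebra.IsCentral K A] [IsSimpleRing A]
  [FiniteDimensional K A]

lemma exists_split_closed (K : Type u) (A : Type*) [Field K] [Ring A] [Algebra K A] [Algebra.IsCentral K A] [IsSimpleRing A]
  [FiniteDimensional K A] : ∃ n : ℕ, n * n = Module.finrank K A ∧
    ∃ φ : A →ₐ[K] Matrix (Fin n) (Fin n) (AlgebraicClosure K), True := by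
  have := tens_simple (K := K) (E := AlgebraicClosure K) (A := A)
  obtain ⟨n, hn, ⟨e⟩⟩ := IsSimpleRing.exists_algEquiv_matrix_of_isAlgClosed (AlgebraicClosure K) (AlgebraicClosure K ⊗[K] A)
  refine ⟨n, ?_, (e.toAlgHom.restrictScalars K).comp Algebra.TensorProduct.includeRight, trivial⟩
  have h1 := e.toLinearEquiv.finrank_eq
  rw [Module.finrank_baseChange, Module.finrank_matrix] at h1
  simp at h1
  exact h1.symm

open IntermediateField in
theorem exists_split_galois [CharZero K] (hp : p.Prime) (φ : A →ₐ[K] Matrix (Fin n) (Fin n) (AlgebraicClosure K)) :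
    ∃ F : IntermediateField K (AlgebraicClosure K), FiniteDimensional K F ∧ IsGalois K F ∧ (∃ ζ : F, IsPrimitiveRoot ζ p) ∧
      ∃ ψ : A →+* Matrix (Fin n) (Fin n) F, Ov (algebraMap K F) ψ := by
  classical
  have : NeZero (p : AlgebraicClosure K) := ⟨by exact_mod_cast hp.ne_zero⟩
  obtain ⟨ζ, hζ⟩ := HasEnoughRootsOfUnity.exists_primitiveRoot (AlgebraicClosure K) p
  let bas := Module.finBasis K A
  let S : Set (AlgebraicClosure K) := insert ζ (Set.range fun x : Fin (Module.finrank K A) × Fin n × Fin n => φ (bas x.1) x.2.1 x.2.2)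
  have hS : S.Finite := (Set.finite_range _).insert _
  have hfin : Finite S := hS
  have hfd : FiniteDimensional K (adjoin K S) :=
    finiteDimensional_adjoin fun x _ => Algebra.IsIntegral.isIntegral x
  let F := normalClosure K (adjoin K S) (AlgebraicClosure K)
  have hle : adjoin K S ≤ F := le_normalClosure _
  have hSF : ∀ x ∈ S, x ∈ F := fun x hx => hle (subset_adjoin K S hx)
  refine ⟨F, inferInstance, IsGalois.normalClosure K (adjoin K S) (AlgebraicClosure K), ⟨⟨ζ, hSF ζ (Set.mem_insert _ _)⟩, ?_⟩, ?_⟩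
  · exact IsPrimitiveRoot.of_map_of_injective (f := algebraMap F (AlgebraicClosure K)) hζ (algebraMap F (AlgebraicClosure K)).injective
  have hinj : Function.Injective ((algebraMap F (AlgebraicClosure K)).mapMatrix : Matrix (Fin n) (Fin n) F →+* _) := by
    intro x y hxy
    ext k l
    exact congrFun (congrFun hxy k) l
  have hent : ∀ a k l, φ a k l ∈ F := by
    intro a k l
    rw [← bas.sum_repr a, map_sum, Matrix.sum_apply]
    refine sum_mem fun j _ => ?_
    rw [map_smul, Matrix.smul_apply]
    refine F.smul_mem (hSF _ ?_)
    exact Set.mem_insert_of_mem _ ⟨(j, k, l), rfl⟩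
  obtain ⟨ψ, hψ⟩ := exists_factor (φ : A →+* Matrix (Fin n) (Fin n) (AlgebraicClosure K)) (algebraMap F (AlgebraicClosure K)).mapMatrix hinj
    (fun a => ⟨Matrix.of fun k l => ⟨φ a k l, hent a k l⟩, by ext k l; rfl⟩)
  refine ⟨ψ, fun k => hinj ?_⟩
  rw [hψ, mm_alg]
  exact φ.commutes k

open IntermediateField in
lemma zeta_fixed (hp : p.Prime) {F : Type*} [Field F] [Algebra K F] [FiniteDimensional K F] {ζ : F} (hζ : IsPrimitiveRoot ζ p)
    (P : Subgroup (F ≃ₐ[K] F)) (hP : IsPGroup p P) : ζ ∈ fixedField P := by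
  have : Fact p.Prime := ⟨hp⟩
  rw [mem_fixedField_iff]
  intro f hf
  obtain ⟨k, hk⟩ := hP ⟨f, hf⟩
  have hk' : f ^ p ^ k = 1 := congrArg Subtype.val hk
  have h1 : hζ.autToPow K f ^ p ^ k = 1 := by rw [← map_pow, hk', map_one]
  have h2 : hζ.autToPow K f ^ (p - 1) = 1 := ZMod.units_pow_card_sub_one_eq_one p _
  have hcop : Nat.Coprime (p ^ k) (p - 1) := by
    apply Nat.Coprime.pow_left
    apply Nat.coprime_of_lt_prime
    · have := hp.two_le
      omega
    · exact Nat.sub_lt hp.pos one_pos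
    · exact hp
  have h3 : hζ.autToPow K f = 1 := by
    have h4 := Nat.dvd_gcd (orderOf_dvd_of_pow_eq_one h1) (orderOf_dvd_of_pow_eq_one h2)
    rw [hcop] at h4
    exact orderOf_eq_one_iff.1 (Nat.dvd_one.1 h4)
  have h5 := hζ.autToPow_spec K f
  rw [h3] at h5
  have : Fact (1 < p) := ⟨hp.one_lt⟩
  rw [Units.val_one, ZMod.val_one, pow_one] at h5
  exact h5.symm

open IntermediateField in
theorem exists_split_prime [NumberField K] (hn : n * n = Module.finrank K A)
    (φ : A →ₐ[K] Matrix (Fin n) (Fin n) (AlgebraicClosure K))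
    (hl : LocSpl n A (RingHom.id K)) (hp : p.Prime) : ∃ (E : Type u) (_ : Field E) (_ : Algebra K E), FiniteDimensional K E ∧
    ¬ p ∣ Module.finrank K E ∧ ∃ ψ : A →+* Matrix (Fin n) (Fin n) E, Ov (algebraMap K E) ψ := by
  obtain ⟨F, hF, hG, ⟨ζ, hζ⟩, ψ, hψ⟩ := exists_split_galois hp φ
  have : Fact p.Prime := ⟨hp⟩
  let P : Sylow p (F ≃ₐ[K] F) := default
  let E := fixedField (P : Subgroup (F ≃ₐ[K] F))
  have hζE := zeta_fixed hp hζ (P : Subgroup (F ≃ₐ[K] F)) P.isPGroup'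
  have hζ1 : IsPrimitiveRoot (⟨ζ, hζE⟩ : E) p :=
    IsPrimitiveRoot.of_map_of_injective (f := algebraMap E F) hζ (algebraMap E F).injective
  have hrEF : Module.finrank E F = Nat.card P := finrank_fixedField_eq_card _
  obtain ⟨k, hk⟩ := IsPGroup.iff_card.1 P.isPGroup'
  have hrKE : Module.finrank K E = (P : Subgroup (F ≃ₐ[K] F)).index := by
    have h1 := (P : Subgroup (F ≃ₐ[K] F)).card_mul_index
    rw [IsGalois.card_aut_eq_finrank, ← Module.finrank_mul_finrank K E F, hrEF, mul_comm] at h1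
    exact (Nat.eq_of_mul_eq_mul_right Nat.card_pos h1).symm
  have : NumberField E := NumberField.of_module_finite K E
  refine ⟨E, inferInstance, inferInstance, inferInstance, ?_, ?_⟩
  · rw [hrKE]
    exact P.not_dvd_index
  · obtain ⟨ψ', hψ'⟩ := tower hn hp k (E := E) (F := F) (hrEF.trans hk) hζ1 (hl.up E) (φ := ψ) hψ
    exact ⟨ψ', hψ'⟩

end fin

section modules
variable {K A : Type*} [Field K] [Ring A] [Algebra K A] [IsSimpleRing A] [FiniteDimensional K A]

theorem dvd_of_module (S : Ideal A) [IsSimpleModule A S] (V : Type*) [AddCommGroup V] [Module A V] [Module K V]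
    [IsScalarTower K A V] [FiniteDimensional K V] : Module.finrank K S ∣ Module.finrank K V := by
  have : IsArtinianRing A := IsArtinianRing.of_finite K A
  have h1 : IsIsotypicOfType A (V × S) S := by
    have hi := LinearMap.inr_injective (R := A) (M := V) (M₂ := S)
    let e := LinearEquiv.ofInjective (LinearMap.inr A V S) hi
    have : IsSimpleModule A (LinearMap.range (LinearMap.inr A V S)) := IsSimpleModule.congr e.symm
    exact (IsSimpleRing.isIsotypic A (V × S) (LinearMap.range (LinearMap.inr A V S))).of_linearEquiv_type e.symm
  have h2 : IsIsotypicOfType A V S := h1.of_injective (LinearMap.inl A V S) LinearMap.inl_injective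
  have : Module.Finite A V := Module.Finite.of_restrictScalars_finite K A V
  obtain ⟨m, ⟨e⟩⟩ := h2.linearEquiv_fun
  have := (e.restrictScalars K).finrank_eq
  rw [this, Module.finrank_pi_fintype]
  simp

lemma nat_aux {d n : ℕ} (hn : 0 < n) (h : ∀ p : ℕ, p.Prime → ∃ m, ¬ p ∣ m ∧ d ∣ n * m) : d ∣ n := by
  have hg : 0 < Nat.gcd d n := Nat.gcd_pos_of_pos_right _ hn
  by_contra hd
  have h1 : d / Nat.gcd d n ≠ 1 := by
    intro h1
    have := Nat.div_mul_cancel (Nat.gcd_dvd_left d n)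
    rw [h1, one_mul] at this
    exact hd (this ▸ Nat.gcd_dvd_right d n)
  obtain ⟨p, hp, hpd⟩ := Nat.exists_prime_and_dvd h1
  obtain ⟨m, hm, hdm⟩ := h p hp
  apply hm
  refine hpd.trans ?_
  have h2 : d / Nat.gcd d n ∣ (n / Nat.gcd d n) * m := by
    rw [← Nat.mul_dvd_mul_iff_left hg, Nat.mul_div_cancel' (Nat.gcd_dvd_left d n), ← mul_assoc,
      Nat.mul_div_cancel' (Nat.gcd_dvd_right d n)]
    exact hdm
  exact (Nat.coprime_div_gcd_div_gcd hg).dvd_of_dvd_mul_left h2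

theorem dvd_of_split (S : Ideal A) [IsSimpleModule A S] {E : Type*} [Field E] [Algebra K E] [FiniteDimensional K E] {n : ℕ}
    {ψ : A →+* Matrix (Fin n) (Fin n) E} (hψ : Ov (algebraMap K E) ψ) : Module.finrank K S ∣ n * Module.finrank K E := by
  let _ : Module A (Fin n → E) := Module.compHom (Fin n → E)
    ((Matrix.toLinAlgEquiv' : Matrix (Fin n) (Fin n) E ≃ₐ[E] Module.End E (Fin n → E)).toRingEquiv.toRingHom.comp ψ)
  have hs : ∀ (a : A) (v : Fin n → E), a • v = (ψ a).mulVec v := fun a v => Matrix.toLin'_apply _ _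
  have : IsScalarTower K A (Fin n → E) := ⟨fun k a v => by
    rw [hs, hs, Algebra.smul_def, map_mul, hψ, ← Algebra.smul_def, Matrix.smul_mulVec, algebraMap_smul]⟩
  have h := dvd_of_module (K := K) S (Fin n → E)
  rw [Module.finrank_pi_fintype] at h
  simpa using h

theorem split_of_primes [Algebra.IsCentral K A] {n : ℕ} (hn : n * n = Module.finrank K A)
    (h : ∀ p : ℕ, p.Prime → ∃ (E : Type*) (_ : Field E) (_ : Algebra K E), FiniteDimensional K E ∧
    ¬ p ∣ Module.finrank K E ∧ ∃ ψ : A →+* Matrix (Fin n) (Fin n) E, Ov (algebraMap K E) ψ) :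
    Nonempty (A ≃ₐ[K] Matrix (Fin n) (Fin n) K) := by
  have : IsArtinianRing A := IsArtinianRing.of_finite K A
  obtain ⟨S, hS⟩ := IsSemisimpleModule.exists_simple_submodule A A
  have hn0 := n_pos hn
  have hd : Module.finrank K S ∣ n := nat_aux hn0 (fun p hp => by
    obtain ⟨E, _, _, _, h1, ψ, h2⟩ := h p hp
    exact ⟨_, h1, dvd_of_split S h2⟩)
  have : Nontrivial S := IsSimpleModule.nontrivial A S
  let f : A →ₐ[K] Module.End K S := Algebra.lsmul K K S
  have hinj : Function.Injective f := f.toRingHom.injective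
  have h1 := LinearMap.finrank_le_finrank_of_injective (f := f.toLinearMap) hinj
  have h2 : Module.finrank K (Module.End K S) = Module.finrank K S * Module.finrank K S := Module.finrank_linearMap K K S S
  have h3 : Module.finrank K S = n := by
    refine le_antisymm (Nat.le_of_dvd hn0 hd) ?_
    rw [h2, ← hn] at h1
    exact Nat.mul_self_le_mul_self_iff.1 h1
  have hbij : Function.Bijective f := by
    refine ⟨hinj, ?_⟩
    exact (LinearMap.injective_iff_surjective_of_finrank_eq_finrank (f := f.toLinearMap) (by rw [h2, h3, hn])).1 hinj
  exact ⟨(AlgEquiv.ofBijective f hbij).trans (algEquivMatrix (Module.finBasisOfFinrankEq K S h3))⟩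

end modules
end ABHN
end FileAlg5

section FileAlg6
set_option autoImplicit false
set_option linter.unusedSectionVars false
open scoped TensorProduct
open IsDedekindDomain NumberField
universe u v

namespace ABHN

lemma Ov_of_equiv {K A E : Type*} [Field K] [Ring A] [Algebra K A] [Field E] [Algebra K E] {n m : ℕ}
    (hn : n * n = Module.finrank K A)
    (e : (E ⊗[K] A) ≃ₐ[E] Matrix (Fin m) (Fin m) E) : ∃ ψ : A →+* Matrix (Fin n) (Fin n) E, Ov (algebraMap K E) ψ := by
  have h1 := e.toLinearEquiv.finrank_eq
  rw [Module.finrank_baseChange, Module.finrank_matrix] at h1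
  simp only [Fintype.card_fin, Module.finrank_self, mul_one] at h1
  have : m = n := Nat.mul_self_inj.1 (h1.symm.trans hn.symm)
  subst this
  let f : A →ₐ[K] Matrix (Fin m) (Fin m) E := (e.toAlgHom.restrictScalars K).comp Algebra.TensorProduct.includeRight
  exact ⟨f, fun k => f.commutes k⟩

theorem main (K : Type u) [Field K] [NumberField K]
    (A : Type v) [Ring A] [Algebra K A] [FiniteDimensional K A]
    [Algebra.IsCentral K A] [IsSimpleRing A]
    (hfin : ∀ v : HeightOneSpectrum (𝓞 K), ∃ m : ℕ,
        Nonempty ((v.adicCompletion K ⊗[K] A) ≃ₐ[v.adicCompletion K]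
          Matrix (Fin m) (Fin m) (v.adicCompletion K)))
    (hreal : ∀ τ : K →+* ℝ, ∃ m : ℕ,
      (letI : Algebra K ℝ := τ.toAlgebra
       Nonempty ((ℝ ⊗[K] A) ≃ₐ[ℝ] Matrix (Fin m) (Fin m) ℝ))) :
    ∃ m : ℕ, 0 < m ∧ Nonempty (A ≃ₐ[K] Matrix (Fin m) (Fin m) K) := by
  obtain ⟨n, hn, φ, -⟩ := exists_split_closed K A
  refine ⟨n, n_pos hn, split_of_primes hn fun p hp => exists_split_prime hn φ ⟨fun v => ?_, fun τ => ?_⟩ hp⟩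
  · obtain ⟨m, ⟨e⟩⟩ := hfin v
    obtain ⟨ψ, hψ⟩ := Ov_of_equiv hn e
    refine ⟨ψ, ?_⟩
    rw [RingHom.comp_id, emb_eq]
    exact hψ
  · obtain ⟨m, ⟨e⟩⟩ := hreal τ
    let _ : Algebra K ℝ := τ.toAlgebra
    exact Ov_of_equiv hn e

end ABHN
end FileAlg6

open scoped TensorProduct
open IsDedekindDomain NumberField

/-- Hasse principle for central simple algebras: if a finite-dimensional central
simple algebra `A` over a number field `K` becomes a matrix algebra over every
completion `K_v` at a finite place `v` and over `ℝ` for every real embedding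
`τ : K → ℝ` (equivalently, for every `K`-algebra structure on `ℝ`), then `A` is
a matrix algebra over `K`.  (Equivalently, `Br K → ∏_v Br K_v` is injective.) -/
theorem stmt2 (K : Type*) [Field K] [NumberField K]
    (A : Type*) [Ring A] [Algebra K A] [FiniteDimensional K A]
    [Algebra.IsCentral K A] [IsSimpleRing A]
    (hfin : ∀ v : HeightOneSpectrum (𝓞 K),
      haveI : SMulCommClass K (v.adicCompletion K) (v.adicCompletion K) :=
        Algebra.to_smulCommClass
      ∃ m : ℕ, 0 < m ∧
        Nonempty ((v.adicCompletion K ⊗[K] A) ≃ₐ[v.adicCompletion K]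
          Matrix (Fin m) (Fin m) (v.adicCompletion K)))
    (hreal : ∀ τ : K →+* ℝ, ∃ m : ℕ, 0 < m ∧
      (letI : Algebra K ℝ := τ.toAlgebra
       Nonempty ((ℝ ⊗[K] A) ≃ₐ[ℝ] Matrix (Fin m) (Fin m) ℝ))) :
    ∃ m : ℕ, 0 < m ∧ Nonempty (A ≃ₐ[K] Matrix (Fin m) (Fin m) K) := by
  refine ABHN.main K A (fun v => ?_) (fun τ => ?_)
  · obtain ⟨m, _, h⟩ := hfin v
    exact ⟨m, h⟩
  · obtain ⟨m, _, h⟩ := hreal τ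
    exact ⟨m, h⟩
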